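/- (1-d global existence for γ > 3.) Fix γ > 3. There exist ε₀ > 0 and C ≥ 1 such that for every 0 < ε ≤ ε₀ and every u₀ ∈ C^∞([−1,1]) with Σ_{b=0}^{4} ∫_{−1}^{1} d(x)^{(1+b(γ−1))/(γ−1)} |∂_x^b u₀(x)|² dx < ε, there exists a global-in-time solution (η, v) of the 1-d γ-perturbation system on Ω₀ × [0,∞) with initial data η(x,0) = x, v(x,0) = u₀(x), satisfying E_γ(t) ≤ C·ε for all t ≥ 0. -/

import Mathlib

open Set MeasureTheory Filter

noncomputable section

open scoped Classical

/-- The spatial domain `Ω₀ = (−1, 1)`. -/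
def Ω₀ : Set ℝ := Ioo (-1) 1

/-- The weight `d(x) = ((γ−1)/(2γ))(1 − x²)`. -/
def ddg (γ : ℝ) (x : ℝ) : ℝ := (γ - 1) / (2 * γ) * (1 - x ^ 2)

/-- Squared integer Sobolev norm `‖f‖_{H^n(Ω₀)}²`. -/
def HSq (n : ℕ) (f : ℝ → ℝ) : ℝ :=
  ∑ j ∈ Finset.range (n + 1), ∫ x in Ω₀, (iteratedDeriv j f x) ^ 2

/-- Squared `W^{1,∞}(Ω₀)` norm. -/
def W1InfSq (f : ℝ → ℝ) : ℝ :=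
  (sSup ((fun x => |f x|) '' Ω₀)) ^ 2 + (sSup ((fun x => |deriv f x|) '' Ω₀)) ^ 2

/-- Squared (fractional) Sobolev norm `‖f‖_s²` on `Ω₀`: for non-integer `s` it is
`‖f‖_{H^{⌊s⌋}}²` plus the Gagliardo seminorm of `∂_x^{⌊s⌋} f`; for integer `s` it is the
integer Sobolev norm. -/
def SobSq (s : ℝ) (f : ℝ → ℝ) : ℝ :=
  HSq ⌊s⌋₊ f +
    if (⌊s⌋₊ : ℝ) = s then 0 else
      ∫ x in Ω₀, ∫ y in Ω₀,
        (iteratedDeriv ⌊s⌋₊ f x - iteratedDeriv ⌊s⌋₊ f y) ^ 2 /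
          |x - y| ^ (1 + 2 * (s - (⌊s⌋₊ : ℝ)))

/-- The higher-order energy `e_γ(t)` for `γ > 3` in 1-d. -/
def eγ (γ : ℝ) (α : ℝ → ℝ) (η v : ℝ → ℝ → ℝ) (t : ℝ) : ℝ :=
  α t ^ (3 - γ) *
      (∫ x in Ω₀, ddg γ x ^ ((5 * γ - 4) / (γ - 1)) *
        (iteratedDeriv 5 (fun y => η y t - y) x) ^ 2) +
    ∑ b ∈ Finset.range 5,
      ((α t ^ 4 * ∫ x in Ω₀, ddg γ x ^ ((1 + (b : ℝ) * (γ - 1)) / (γ - 1)) *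
          (iteratedDeriv b (fun y => v y t) x) ^ 2) +
        ∫ x in Ω₀, ddg γ x ^ ((1 + (b : ℝ) * (γ - 1)) / (γ - 1)) *
          (iteratedDeriv b (fun y => η y t - y) x) ^ 2)

/-- The norm `E_γ(t)` for `γ > 3` in 1-d. -/
def Eγ (γ : ℝ) (α : ℝ → ℝ) (η v : ℝ → ℝ → ℝ) (t : ℝ) : ℝ :=
  eγ γ α η v t + W1InfSq (fun y => η y t - y) + α t ^ 4 * W1InfSq (fun y => v y t) +
    ∑ b ∈ Finset.range 3,
      (α t ^ 4 * SobSq ((4 * γ - 5) / (2 * γ - 2) + b) (fun y => ddg γ y ^ b * v y t) +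
        SobSq ((4 * γ - 5) / (2 * γ - 2) + b) (fun y => ddg γ y ^ b * (η y t - y)))

/-- `(η, v)` is a (sufficiently smooth, globally defined) solution of the 1-d
`γ`-perturbation system: `∂_t η = v`, `∂_x η > 0`, and
`α^{γ+1} ∂_t v + 2α^γ α' v + η + (γ/(γ−1)) d' (∂_x η)^{−γ} − γ d (∂_x η)^{−γ−1} ∂_x² η = 0`. -/
def IsSolγ (γ : ℝ) (α α' : ℝ → ℝ) (η v : ℝ → ℝ → ℝ) : Prop :=
  (∀ t ∈ Ici (0 : ℝ), ContDiffOn ℝ 2 (fun y => η y t) Ω₀) ∧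
  (∀ x ∈ Ω₀, ∀ t ∈ Ici (0 : ℝ), 0 < deriv (fun y => η y t) x) ∧
  (∀ x ∈ Ω₀, ∀ t ∈ Ici (0 : ℝ), HasDerivWithinAt (fun s => η x s) (v x t) (Ici 0) t) ∧
  (∀ x ∈ Ω₀, ∀ t > (0 : ℝ), DifferentiableAt ℝ (fun s => v x s) t) ∧
  (∀ x ∈ Ω₀, ∀ t > (0 : ℝ),
    α t ^ (γ + 1) * deriv (fun s => v x s) t + 2 * α t ^ γ * α' t * v x t + η x t
      + γ / (γ - 1) * deriv (ddg γ) x * (deriv (fun y => η y t) x) ^ (-γ)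
      - γ * ddg γ x * (deriv (fun y => η y t) x) ^ (-γ - 1) *
          iteratedDeriv 2 (fun y => η y t) x = 0)

/-! ### Weights -/

/-- The coefficient `(γ−1)/(2γ)` of the weight. -/
def mu (γ : ℝ) : ℝ := (γ - 1) / (2 * γ)

/-- The exponent `β = 1/(γ−1)` of the density. -/
def bt (γ : ℝ) : ℝ := 1 / (γ - 1)

/-- The power `d^a` of the weight `d`. -/
def wt (γ a x : ℝ) : ℝ := ddg γ x ^ a

theorem bt_pos {γ : ℝ} (hγ : 3 < γ) : 0 < bt γ := by
  unfold bt; apply div_pos one_pos; linarith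

theorem bt_lt_half {γ : ℝ} (hγ : 3 < γ) : bt γ < 1 / 2 := by
  unfold bt; rw [div_lt_div_iff₀ (by linarith) (by norm_num)]; linarith

theorem mu_gt {γ : ℝ} (hγ : 3 < γ) : 1 / 3 < mu γ := by
  unfold mu; rw [div_lt_div_iff₀ (by norm_num) (by linarith)]; linarith

theorem mu_lt {γ : ℝ} (hγ : 3 < γ) : mu γ < 1 / 2 := by
  unfold mu; rw [div_lt_div_iff₀ (by linarith) (by norm_num)]; linarith

theorem ddg_eq (γ x : ℝ) : ddg γ x = mu γ * (1 - x ^ 2) := rfl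

theorem ddg_nonneg {γ : ℝ} (hγ : 3 < γ) {x : ℝ} (hx : x ∈ Icc (-1 : ℝ) 1) : 0 ≤ ddg γ x := by
  rw [ddg_eq]; apply mul_nonneg
  · linarith [mu_gt hγ]
  · nlinarith [hx.1, hx.2]

theorem ddg_pos {γ : ℝ} (hγ : 3 < γ) {x : ℝ} (hx : x ∈ Ioo (-1 : ℝ) 1) : 0 < ddg γ x := by
  rw [ddg_eq]; apply mul_pos
  · linarith [mu_gt hγ]
  · nlinarith [hx.1, hx.2]

theorem ddg_le {γ : ℝ} (hγ : 3 < γ) {x : ℝ} : ddg γ x ≤ 1 := by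
  rw [ddg_eq]; nlinarith [mu_gt hγ, mu_lt hγ, sq_nonneg x]

theorem hasDerivAt_ddg (γ x : ℝ) : HasDerivAt (ddg γ) (-2 * mu γ * x) x := by
  refine (((hasDerivAt_const x (1 : ℝ)).sub ((hasDerivAt_id x).pow 2)).const_mul
    (mu γ)).congr_deriv ?_
  simp; ring

@[fun_prop]
theorem continuous_ddg (γ : ℝ) : Continuous (ddg γ) := by
  unfold ddg; fun_prop

theorem wt_nonneg {γ : ℝ} (hγ : 3 < γ) (a : ℝ) {x : ℝ} (hx : x ∈ Icc (-1 : ℝ) 1) :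
    0 ≤ wt γ a x := Real.rpow_nonneg (ddg_nonneg hγ hx) _

theorem wt_pos {γ : ℝ} (hγ : 3 < γ) (a : ℝ) {x : ℝ} (hx : x ∈ Ioo (-1 : ℝ) 1) :
    0 < wt γ a x := Real.rpow_pos_of_pos (ddg_pos hγ hx) _

theorem wt_zero (γ x : ℝ) : wt γ 0 x = 1 := Real.rpow_zero _

theorem continuous_wt (γ : ℝ) {a : ℝ} (ha : 0 ≤ a) : Continuous (wt γ a) :=
  (continuous_ddg γ).rpow_const fun _ => Or.inr ha

theorem wt_anti {γ : ℝ} (hγ : 3 < γ) {a b : ℝ} (ha : 0 ≤ a) (hab : a ≤ b) {x : ℝ}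
    (hx : x ∈ Icc (-1 : ℝ) 1) : wt γ b x ≤ wt γ a x := by
  rcases hab.eq_or_lt with rfl | hab
  · rfl
  rcases (ddg_nonneg hγ hx).eq_or_lt with h | h
  · unfold wt; rw [← h, Real.zero_rpow (by linarith)]
    exact Real.rpow_nonneg le_rfl _
  · exact Real.rpow_le_rpow_of_exponent_ge h (ddg_le hγ) hab.le

theorem wt_le_one {γ : ℝ} (hγ : 3 < γ) {a : ℝ} (ha : 0 ≤ a) {x : ℝ}
    (hx : x ∈ Icc (-1 : ℝ) 1) : wt γ a x ≤ 1 := by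
  simpa [wt_zero] using wt_anti hγ le_rfl ha hx

theorem wt_add {γ : ℝ} (hγ : 3 < γ) {a b : ℝ} (ha : 0 ≤ a) (hb : 0 ≤ b) {x : ℝ}
    (hx : x ∈ Icc (-1 : ℝ) 1) : wt γ (a + b) x = wt γ a x * wt γ b x :=
  Real.rpow_add_of_nonneg (ddg_nonneg hγ hx) ha hb

theorem wt_nat (γ : ℝ) (n : ℕ) (x : ℝ) : wt γ n x = ddg γ x ^ n := Real.rpow_natCast _ _

theorem wt_add_nat {γ : ℝ} (hγ : 3 < γ) {a : ℝ} (ha : 0 ≤ a) (n : ℕ) {x : ℝ}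
    (hx : x ∈ Icc (-1 : ℝ) 1) : wt γ (a + n) x = wt γ a x * ddg γ x ^ n := by
  rw [wt_add hγ ha (Nat.cast_nonneg n) hx, wt_nat]

theorem hasDerivAt_wt {γ : ℝ} (hγ : 3 < γ) (a : ℝ) {x : ℝ} (hx : x ∈ Ioo (-1 : ℝ) 1) :
    HasDerivAt (wt γ (a + 1)) (wt γ a x * ((a + 1) * (-2 * mu γ * x))) x := by
  have := (hasDerivAt_ddg γ x).rpow_const (p := a + 1) (Or.inl (ddg_pos hγ hx).ne')
  refine this.congr_deriv ?_
  unfold wt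
  rw [add_sub_cancel_right]; ring

theorem ddg_one (γ : ℝ) : ddg γ 1 = 0 := by simp [ddg]

theorem ddg_neg_one (γ : ℝ) : ddg γ (-1) = 0 := by simp [ddg]

/-- Integration by parts against a power of the weight. -/
theorem wt_ibp {γ : ℝ} (hγ : 3 < γ) {a : ℝ} (ha : 0 ≤ a) {U U' : ℝ → ℝ}
    (hU : ContinuousOn U (Icc (-1) 1)) (hU' : ContinuousOn U' (Icc (-1) 1))
    (hd : ∀ x ∈ Ioo (-1 : ℝ) 1, HasDerivAt U (U' x) x) :
    ∫ x in (-1 : ℝ)..1, wt γ a x * ((a + 1) * (-2 * mu γ * x) * U x + ddg γ x * U' x) = 0 := by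
  have h := intervalIntegral.integral_eq_sub_of_hasDerivAt_of_le (a := -1) (b := 1)
    (f := fun x => wt γ (a + 1) x * U x)
    (f' := fun x => wt γ a x * ((a + 1) * (-2 * mu γ * x) * U x + ddg γ x * U' x)) (by norm_num)
    ((continuous_wt γ (by linarith)).continuousOn.mul hU) ?_ ?_
  · rw [h]; simp [wt, ddg_one, ddg_neg_one, Real.zero_rpow (by linarith : a + 1 ≠ 0)]
  · intro x hx
    refine ((hasDerivAt_wt hγ a hx).mul (hd x hx)).congr_deriv ?_
    have := wt_add hγ ha zero_le_one (Ioo_subset_Icc_self hx)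
    rw [this]
    have : wt γ 1 x = ddg γ x := by simp [wt]
    rw [this]; ring
  · apply ContinuousOn.intervalIntegrable
    rw [uIcc_of_le (by norm_num)]
    have := continuous_wt γ ha
    fun_prop

theorem iint_mono {f g : ℝ → ℝ} (hf : ContinuousOn f (Icc (-1) 1))
    (hg : ContinuousOn g (Icc (-1) 1)) (h : ∀ x ∈ Icc (-1 : ℝ) 1, f x ≤ g x) :
    ∫ x in (-1 : ℝ)..1, f x ≤ ∫ x in (-1 : ℝ)..1, g x := by
  apply intervalIntegral.integral_mono_on (by norm_num) _ _ h
  · apply ContinuousOn.intervalIntegrable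
    rwa [uIcc_of_le (by norm_num)]
  · apply ContinuousOn.intervalIntegrable
    rwa [uIcc_of_le (by norm_num)]

theorem iintegrable {f : ℝ → ℝ} (hf : ContinuousOn f (Icc (-1) 1)) :
    IntervalIntegrable f volume (-1) 1 := by
  apply ContinuousOn.intervalIntegrable
  rwa [uIcc_of_le (by norm_num)]

theorem iint_nonneg {f : ℝ → ℝ} (h : ∀ x ∈ Icc (-1 : ℝ) 1, 0 ≤ f x) :
    0 ≤ ∫ x in (-1 : ℝ)..1, f x :=
  intervalIntegral.integral_nonneg (by norm_num) h

/-- Weighted Hardy inequality. -/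
theorem hardy {γ : ℝ} (hγ : 3 < γ) {a : ℝ} (ha : 0 ≤ a) :
    ∃ C > (0 : ℝ), ∀ h h' : ℝ → ℝ, Continuous h → Continuous h' →
      (∀ x, HasDerivAt h (h' x) x) →
      ∫ x in (-1 : ℝ)..1, wt γ a x * h x ^ 2 ≤
        C * ∫ x in (-1 : ℝ)..1, wt γ (a + 2) x * (h x ^ 2 + h' x ^ 2) := by
  have hmu := mu_gt hγ
  set δ : ℝ := mu γ * (a + 1) / (2 * a + 4) with hδ
  have hδ0 : 0 < δ := by positivity
  refine ⟨(2 * a + 4) / (δ * (mu γ * (a + 1))), by positivity, fun h h' hc hc' hd => ?_⟩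
  have w0 := continuous_wt γ ha
  have w1 := continuous_wt γ (by linarith : 0 ≤ a + 1)
  have w2 := continuous_wt γ (by linarith : 0 ≤ a + 2)
  have key := wt_ibp hγ ha (U := fun x => x * h x ^ 2)
    (U' := fun x => h x ^ 2 + x * (2 * h x * h' x)) (by fun_prop) (by fun_prop) (fun x _ => by
      refine ((hasDerivAt_id x).mul ((hd x).pow 2)).congr_deriv ?_
      simp)
  have h2 : ∫ x in (-1 : ℝ)..1, (mu γ * (a + 1)) * (wt γ a x * h x ^ 2) -
      ((2 * a + 4) / δ) * (wt γ (a + 2) x * (h x ^ 2 + h' x ^ 2)) ≤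
      ∫ x in (-1 : ℝ)..1, -(wt γ a x * ((a + 1) * (-2 * mu γ * x) * (x * h x ^ 2) +
        ddg γ x * (h x ^ 2 + x * (2 * h x * h' x)))) := by
    apply iint_mono (by fun_prop) (by fun_prop)
    intro x hx
    have e2 : wt γ (a + 2) x = wt γ a x * ddg γ x ^ 2 := by
      have := wt_add_nat hγ ha 2 hx
      simpa using this
    rw [e2]
    have hw := wt_nonneg hγ a hx
    have hdd := ddg_nonneg hγ hx
    have hx2 : 2 * mu γ * x ^ 2 = 2 * mu γ - 2 * ddg γ x := by rw [ddg_eq]; ring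
    have hxx : x ^ 2 ≤ 1 := by nlinarith [hx.1, hx.2]
    set D := ddg γ x
    have goal : mu γ * (a + 1) * h x ^ 2 - (2 * a + 4) / δ * (D ^ 2 * (h x ^ 2 + h' x ^ 2)) ≤
        (a + 1) * (2 * mu γ - 2 * D) * h x ^ 2 - D * h x ^ 2 - 2 * D * x * h x * h' x := by
      have i1 : D * h x ^ 2 ≤ (δ / 1) * h x ^ 2 + 1 / δ * (D ^ 2 * h x ^ 2) := by
        have : 0 ≤ (1 / δ) * (δ - D) ^ 2 * h x ^ 2 := by positivity
        have e : (1 / δ) * (δ - D) ^ 2 * h x ^ 2 =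
          δ * h x ^ 2 - 2 * (D * h x ^ 2) + 1 / δ * (D ^ 2 * h x ^ 2) := by
          field_simp; ring
        have : 0 ≤ D * h x ^ 2 := by positivity
        nlinarith
      have i2 : 2 * D * x * h x * h' x ≤ δ * h x ^ 2 + 1 / δ * (D ^ 2 * h' x ^ 2) := by
        have : 0 ≤ (1 / δ) * (δ * (x * h x) - D * h' x) ^ 2 := by positivity
        have e : (1 / δ) * (δ * (x * h x) - D * h' x) ^ 2 =
          δ * (x ^ 2 * h x ^ 2) - 2 * D * x * h x * h' x + 1 / δ * (D ^ 2 * h' x ^ 2) := by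
          field_simp; ring
        have : δ * (x ^ 2 * h x ^ 2) ≤ δ * h x ^ 2 := by
          apply mul_le_mul_of_nonneg_left _ hδ0.le
          nlinarith [sq_nonneg (h x)]
        linarith
      have i3 : δ * (2 * a + 4) = mu γ * (a + 1) := by rw [hδ]; field_simp
      have i4 : 0 ≤ 1 / δ * (D ^ 2 * h x ^ 2) := by positivity
      have i5 : 0 ≤ 1 / δ * (D ^ 2 * h' x ^ 2) := by positivity
      have e : (2 * a + 4) / δ * (D ^ 2 * (h x ^ 2 + h' x ^ 2)) =
        (2 * a + 4) * (1 / δ * (D ^ 2 * h x ^ 2)) + (2 * a + 4) * (1 / δ * (D ^ 2 * h' x ^ 2)) := by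
        ring
      rw [e]
      have i6 : mu γ * (a + 1) * h x ^ 2 = δ * (2 * a + 4) * h x ^ 2 := by rw [i3]
      nlinarith [mul_nonneg ha i5, mul_le_mul_of_nonneg_left i1 (by linarith : 0 ≤ 2 * a + 3),
        mul_nonneg ha i4]
    have := mul_le_mul_of_nonneg_left goal hw
    have e4 : -(wt γ a x * ((a + 1) * (-2 * mu γ * x) * (x * h x ^ 2) +
        D * (h x ^ 2 + x * (2 * h x * h' x)))) = wt γ a x * ((a + 1) * (2 * mu γ * x ^ 2) * h x ^ 2 - D * h x ^ 2 - 2 * D * x * h x * h' x) := by ring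
    rw [e4, hx2]
    refine le_trans (le_of_eq ?_) this
    ring
  rw [intervalIntegral.integral_neg, key, neg_zero, intervalIntegral.integral_sub,
    intervalIntegral.integral_const_mul, intervalIntegral.integral_const_mul] at h2
  · have : 0 < mu γ * (a + 1) := by positivity
    rw [div_mul_eq_mul_div, le_div_iff₀ (by positivity)]
    have h3 := mul_le_mul_of_nonneg_left (sub_nonpos.1 h2) hδ0.le
    calc _ = δ * (mu γ * (a + 1) * ∫ x in (-1 : ℝ)..1, wt γ a x * h x ^ 2) := by ring
      _ ≤ _ := h3
      _ = _ := by field_simp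
  · exact iintegrable (by fun_prop)
  · exact iintegrable (by fun_prop)

/-! ### Weighted norms of polynomials -/

/-- The `k`-th derivative of a polynomial function. -/
def dv (p : Polynomial ℝ) (k : ℕ) (x : ℝ) : ℝ := (Polynomial.derivative^[k] p).eval x

theorem hasDerivAt_dv (p : Polynomial ℝ) (k : ℕ) (x : ℝ) :
    HasDerivAt (dv p k) (dv p (k + 1) x) x := by
  unfold dv
  rw [Function.iterate_succ_apply']
  exact Polynomial.hasDerivAt _ x

@[fun_prop]
theorem continuous_dv (p : Polynomial ℝ) (k : ℕ) : Continuous (dv p k) :=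
  Polynomial.continuous _

/-- Weighted `L²` norm (squared) of the `k`-th derivative. -/
def J (γ a : ℝ) (p : Polynomial ℝ) (k : ℕ) : ℝ := ∫ x in (-1 : ℝ)..1, wt γ a x * dv p k x ^ 2

theorem J_nonneg {γ : ℝ} (hγ : 3 < γ) (a : ℝ) (p : Polynomial ℝ) (k : ℕ) : 0 ≤ J γ a p k :=
  iint_nonneg fun _ hx => mul_nonneg (wt_nonneg hγ a hx) (sq_nonneg _)

theorem J_anti {γ : ℝ} (hγ : 3 < γ) {a b : ℝ} (ha : 0 ≤ a) (hab : a ≤ b) (p : Polynomial ℝ)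
    (k : ℕ) : J γ b p k ≤ J γ a p k := by
  have h1 := continuous_wt γ ha
  have h2 := continuous_wt γ (ha.trans hab)
  exact iint_mono (by fun_prop) (by fun_prop) fun x hx =>
    mul_le_mul_of_nonneg_right (wt_anti hγ ha hab hx) (sq_nonneg _)

theorem hardy_J {γ : ℝ} (hγ : 3 < γ) {a : ℝ} (ha : 0 ≤ a) : ∃ C > (0 : ℝ), ∀ p k,
    J γ a p k ≤ C * (J γ (a + 2) p k + J γ (a + 2) p (k + 1)) := by
  obtain ⟨C, hC, h⟩ := hardy hγ ha
  refine ⟨C, hC, fun p k => ?_⟩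
  have w2 := continuous_wt γ (by linarith : 0 ≤ a + 2)
  refine (h _ _ (continuous_dv p k) (continuous_dv p (k + 1)) (hasDerivAt_dv p k)).trans
    (le_of_eq ?_)
  unfold J
  rw [← intervalIntegral.integral_add (iintegrable (by fun_prop)) (iintegrable (by fun_prop))]
  simp only [mul_add]

theorem J_interp {γ : ℝ} (hγ : 3 < γ) (k : ℕ) {e : ℝ} (he : 0 < e) : ∃ C > (0 : ℝ), ∀ p,
    J γ (bt γ + k + 1) p (k + 1) ≤ e * J γ (bt γ + k + 2) p (k + 2) + C * J γ (bt γ + k) p k := by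
  have hb := bt_pos hγ
  have hk : (0 : ℝ) ≤ k := Nat.cast_nonneg k
  have ha : 0 ≤ bt γ + k := by positivity
  obtain ⟨H, hH, hardy⟩ := hardy_J hγ ha
  set c : ℝ := bt γ + k + 1
  have hc : 0 < c := by positivity
  obtain ⟨θ, hθ, hθ1, hθ2⟩ : ∃ θ > (0 : ℝ), θ * H ≤ 1 / 2 ∧ θ * H ≤ e / 4 := by
    refine ⟨min (1 / 2) (e / 4) / H, by positivity, ?_, ?_⟩
    · rw [div_mul_cancel₀ _ hH.ne']; exact min_le_left _ _
    · rw [div_mul_cancel₀ _ hH.ne']; exact min_le_right _ _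
  refine ⟨2 * (1 / e + c ^ 2 / θ), by positivity, fun p => ?_⟩
  have w0 := continuous_wt γ ha
  have w1 := continuous_wt γ (by linarith : 0 ≤ bt γ + k + 1)
  have w2 := continuous_wt γ (by linarith : 0 ≤ bt γ + k + 2)
  have key := wt_ibp hγ ha (U := fun x => dv p (k + 1) x * dv p k x)
    (U' := fun x => dv p (k + 2) x * dv p k x + dv p (k + 1) x * dv p (k + 1) x)
    (by fun_prop) (by fun_prop)
    (fun x _ => (hasDerivAt_dv p (k + 1) x).mul (hasDerivAt_dv p k x))
  have h2 : ∫ x in (-1 : ℝ)..1, (wt γ c x * dv p (k + 1) x ^ 2 -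
      wt γ (bt γ + k) x * ((bt γ + k + 1) * (-2 * mu γ * x) *
        (dv p (k + 1) x * dv p k x) + ddg γ x * (dv p (k + 2) x * dv p k x +
          dv p (k + 1) x * dv p (k + 1) x))) ≤
      ∫ x in (-1 : ℝ)..1, ((e / 4) * (wt γ (bt γ + k + 2) x * dv p (k + 2) x ^ 2) +
        (1 / e + c ^ 2 / θ) * (wt γ (bt γ + k) x * dv p k x ^ 2) +
        θ * (wt γ (bt γ + k) x * dv p (k + 1) x ^ 2)) := by
    apply iint_mono (by fun_prop) (by fun_prop)
    intro x hx
    have e1 : wt γ c x = wt γ (bt γ + k) x * ddg γ x := by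
      have := wt_add_nat hγ ha 1 hx
      simpa using this
    have e2 : wt γ (bt γ + k + 2) x = wt γ (bt γ + k) x * ddg γ x ^ 2 := by
      have := wt_add_nat hγ ha 2 hx
      simpa using this
    rw [e1, e2]
    have hw := wt_nonneg hγ (bt γ + k) hx
    have hxx : x ^ 2 ≤ 1 := by nlinarith [hx.1, hx.2]
    have hmu := mu_gt hγ
    have hmu2 := mu_lt hγ
    change wt γ (bt γ + k) x * ddg γ x * dv p (k + 1) x ^ 2 -
      wt γ (bt γ + k) x * (c * (-2 * mu γ * x) *
        (dv p (k + 1) x * dv p k x) + ddg γ x * (dv p (k + 2) x * dv p k x +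
          dv p (k + 1) x * dv p (k + 1) x)) ≤ _
    generalize dv p (k + 2) x = h2, dv p (k + 1) x = h1, dv p k x = h0, ddg γ x = D,
      wt γ (bt γ + k) x = w at *
    have i1 : -(D * h2 * h0) ≤ e / 4 * (D ^ 2 * h2 ^ 2) + 1 / e * h0 ^ 2 := by
      have : 0 ≤ 1 / (4 * e) * (e * (D * h2) + 2 * h0) ^ 2 := by positivity
      have e' : 1 / (4 * e) * (e * (D * h2) + 2 * h0) ^ 2 =
        e / 4 * (D ^ 2 * h2 ^ 2) + 1 / e * h0 ^ 2 + D * h2 * h0 := by field_simp; ring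
      linarith
    have i2 : c * (2 * mu γ * x) * (h1 * h0) ≤ θ * h1 ^ 2 + c ^ 2 / θ * h0 ^ 2 := by
      have : 0 ≤ 1 / θ * (θ * h1 - c * (2 * mu γ * x) / 2 * h0) ^ 2 := by positivity
      have e' : 1 / θ * (θ * h1 - c * (2 * mu γ * x) / 2 * h0) ^ 2 =
        θ * h1 ^ 2 - c * (2 * mu γ * x) * (h1 * h0) + c ^ 2 / θ * h0 ^ 2 * (mu γ ^ 2 * x ^ 2) := by
        field_simp; ring
      have : mu γ ^ 2 * x ^ 2 ≤ 1 := by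
        have : mu γ ^ 2 ≤ 1 := by nlinarith
        nlinarith [sq_nonneg x, sq_nonneg (mu γ)]
      have := mul_le_mul_of_nonneg_left this (by positivity : 0 ≤ c ^ 2 / θ * h0 ^ 2)
      linarith
    have := mul_le_mul_of_nonneg_left (add_le_add i1 i2) hw
    linarith
  rw [intervalIntegral.integral_sub (iintegrable (by fun_prop)) (iintegrable (by fun_prop)), key,
    sub_zero, intervalIntegral.integral_add (iintegrable (by fun_prop)) (iintegrable (by fun_prop)),
    intervalIntegral.integral_add (iintegrable (by fun_prop)) (iintegrable (by fun_prop)),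
    intervalIntegral.integral_const_mul, intervalIntegral.integral_const_mul,
    intervalIntegral.integral_const_mul] at h2
  have h3 := hardy p (k + 1)
  change J γ c p (k + 1) ≤ e / 4 * J γ (bt γ + k + 2) p (k + 2) +
    (1 / e + c ^ 2 / θ) * J γ (bt γ + k) p k + θ * J γ (bt γ + k) p (k + 1) at h2
  have h4 := J_anti hγ hc.le (by linarith : c ≤ bt γ + k + 2) p (k + 1)
  have n1 := J_nonneg hγ c p (k + 1)
  have n2 := J_nonneg hγ (bt γ + k + 2) p (k + 2)
  have h5 : θ * J γ (bt γ + k) p (k + 1) ≤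
      1 / 2 * J γ c p (k + 1) + e / 4 * J γ (bt γ + k + 2) p (k + 2) := by
    calc _ ≤ θ * (H * (J γ c p (k + 1) + J γ (bt γ + k + 2) p (k + 2))) := by
          apply mul_le_mul_of_nonneg_left _ hθ.le
          refine h3.trans (mul_le_mul_of_nonneg_left ?_ hH.le)
          exact add_le_add h4 le_rfl
      _ = θ * H * J γ c p (k + 1) + θ * H * J γ (bt γ + k + 2) p (k + 2) := by ring
      _ ≤ _ := add_le_add (mul_le_mul_of_nonneg_right hθ1 n1) (mul_le_mul_of_nonneg_right hθ2 n2)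
  linarith

theorem iint_abs_sup {u u' : ℝ → ℝ} (hc : Continuous u) (hc' : Continuous u')
    (hd : ∀ x, HasDerivAt u (u' x) x) {x : ℝ} (hx : x ∈ Icc (-1 : ℝ) 1) :
    |u x| ≤ (∫ y in (-1 : ℝ)..1, |u y|) + ∫ y in (-1 : ℝ)..1, |u' y| := by
  set B := ∫ y in (-1 : ℝ)..1, |u' y|
  have hB : 0 ≤ B := iint_nonneg fun _ _ => abs_nonneg _
  have h1 : ∀ y ∈ Icc (-1 : ℝ) 1, |u x| ≤ |u y| + B := by
    intro y hy
    have : ∫ s in y..x, u' s = u x - u y :=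
      intervalIntegral.integral_eq_sub_of_hasDerivAt (fun s _ => hd s) (hc'.intervalIntegrable _ _)
    have h2 : |∫ s in y..x, u' s| ≤ B := by
      refine (intervalIntegral.norm_integral_le_integral_norm_uIoc (f := u')).trans ?_
      rw [show B = ∫ s in Ioc (-1 : ℝ) 1, |u' s| from intervalIntegral.integral_of_le (by norm_num)]
      apply setIntegral_mono_set
      · exact (hc'.abs.integrableOn_Icc).mono_set Ioc_subset_Icc_self
      · exact Eventually.of_forall fun _ => abs_nonneg _
      · apply LE.le.eventuallyLE
        exact Ioc_subset_Ioc (le_min hy.1 hx.1) (max_le hy.2 hx.2)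
    rw [this] at h2
    calc |u x| = |u y + (u x - u y)| := by ring_nf
      _ ≤ _ := (abs_add_le _ _).trans (by linarith)
  have h2 := iint_mono (f := fun _ => |u x|) (g := fun y => |u y| + B) (by fun_prop)
    (by fun_prop) h1
  rw [intervalIntegral.integral_const, intervalIntegral.integral_add
    (iintegrable (by fun_prop)) (iintegrable (by fun_prop)), intervalIntegral.integral_const] at h2
  have h3 : 0 ≤ ∫ y in (-1 : ℝ)..1, |u y| := iint_nonneg fun _ _ => abs_nonneg _
  simp only [smul_eq_mul] at h2
  linarith

theorem wt_neg_integrable {γ : ℝ} (hγ : 3 < γ) :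
    IntervalIntegrable (wt γ (-bt γ)) volume (-1) 1 := by
  have h1 : IntegrableOn (fun x : ℝ => 1 / √(1 - x ^ 2)) (Ioc (-1) 1) :=
    intervalIntegral.integrableOn_deriv_of_nonneg (g := Real.arcsin)
      Real.continuous_arcsin.continuousOn
      (fun x hx => Real.hasDerivAt_arcsin hx.1.ne' hx.2.ne) (fun x _ => by positivity)
  rw [intervalIntegrable_iff_integrableOn_Ioo_of_le (by norm_num)]
  have h2 := (h1.mono_set Ioo_subset_Ioc_self).const_mul (2 : ℝ)
  refine Integrable.mono' h2 ?_ ?_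
  · apply Measurable.aestronglyMeasurable
    exact (continuous_ddg γ).measurable.pow_const _
  · filter_upwards [ae_restrict_mem measurableSet_Ioo] with x hx
    have hd := ddg_pos hγ hx
    rw [Real.norm_of_nonneg (wt_nonneg hγ _ (Ioo_subset_Icc_self hx)), wt]
    have h3 : ddg γ x ^ (-bt γ) ≤ ddg γ x ^ (-(1 / 2 : ℝ)) :=
      Real.rpow_le_rpow_of_exponent_ge hd (ddg_le hγ) (by linarith [bt_lt_half hγ])
    refine h3.trans ?_
    rw [Real.rpow_neg hd.le, ← Real.sqrt_eq_rpow, ddg_eq]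
    have h4 : 0 < 1 - x ^ 2 := by nlinarith [hx.1, hx.2]
    have h5 : 0 < √(1 - x ^ 2) := Real.sqrt_pos.2 h4
    have h6 : √(1 - x ^ 2) ≤ 2 * √(mu γ * (1 - x ^ 2)) := by
      have : √(1 - x ^ 2) ≤ √(4 * (mu γ * (1 - x ^ 2))) :=
        Real.sqrt_le_sqrt (by nlinarith [mu_gt hγ])
      refine this.trans (le_of_eq ?_)
      rw [Real.sqrt_mul (by norm_num), show (4 : ℝ) = 2 ^ 2 by norm_num, Real.sqrt_sq (by norm_num)]
    rw [inv_eq_one_div, mul_one_div, div_le_div_iff₀ _ h5]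
    · linarith
    · linarith

theorem iint_abs_sq_le {γ : ℝ} (hγ : 3 < γ) : ∃ C > (0 : ℝ), ∀ u : ℝ → ℝ, Continuous u →
    (∫ x in (-1 : ℝ)..1, |u x|) ^ 2 ≤ C * ∫ x in (-1 : ℝ)..1, wt γ (bt γ) x * u x ^ 2 := by
  have hb := bt_pos hγ
  have hi := wt_neg_integrable hγ
  set B := ∫ x in (-1 : ℝ)..1, wt γ (-bt γ) x with hB
  have hB0 : 0 ≤ B := iint_nonneg fun x hx => wt_nonneg hγ _ hx
  refine ⟨(B + 1), by positivity, fun u hu => ?_⟩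
  have w0 := continuous_wt γ hb.le
  set A := ∫ x in (-1 : ℝ)..1, wt γ (bt γ) x * u x ^ 2
  have hA0 : 0 ≤ A := iint_nonneg fun x hx => mul_nonneg (wt_nonneg hγ _ hx) (sq_nonneg _)
  set T := ∫ x in (-1 : ℝ)..1, |u x|
  have hT0 : 0 ≤ T := iint_nonneg fun x _ => abs_nonneg _
  have key : ∀ l > (0 : ℝ), 2 * T ≤ l * A + 1 / l * B := by
    intro l hl
    have : ∫ x in (-1 : ℝ)..1, 2 * |u x| ≤ ∫ x in (-1 : ℝ)..1,
        (l * (wt γ (bt γ) x * u x ^ 2) + 1 / l * wt γ (-bt γ) x) := by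
      apply intervalIntegral.integral_mono_on_of_le_Ioo (by norm_num) (iintegrable (by fun_prop))
      · exact (iintegrable (by fun_prop)).add (hi.const_mul _)
      · intro x hx
        have hd := ddg_pos hγ hx
        have hw := wt_pos hγ (bt γ) hx
        have : wt γ (-bt γ) x = 1 / wt γ (bt γ) x := by
          unfold wt; rw [Real.rpow_neg hd.le, one_div]
        rw [this]
        have h1 : 0 ≤ 1 / (l * wt γ (bt γ) x) * (l * wt γ (bt γ) x * |u x| - 1) ^ 2 := by positivity
        have h2 : 1 / (l * wt γ (bt γ) x) * (l * wt γ (bt γ) x * |u x| - 1) ^ 2 =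
          l * (wt γ (bt γ) x * |u x| ^ 2) + 1 / l * (1 / wt γ (bt γ) x) - 2 * |u x| := by
          field_simp; ring
        rw [sq_abs] at h2
        linarith
    rw [intervalIntegral.integral_add (iintegrable (by fun_prop)) (hi.const_mul _),
      intervalIntegral.integral_const_mul, intervalIntegral.integral_const_mul,
      intervalIntegral.integral_const_mul] at this
    exact this
  rcases hT0.eq_or_lt with h | h
  · have : 0 ≤ (B + 1) * A := by positivity
    rw [← h]; simpa using this
  · have := key ((B + 1) / T) (by positivity)
    have h2 := mul_le_mul_of_nonneg_left this h.le
    have e : T * ((B + 1) / T * A + 1 / ((B + 1) / T) * B) = (B + 1) * A + T ^ 2 * (B / (B + 1)) := by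
      field_simp
    rw [e] at h2
    have : B / (B + 1) ≤ 1 := by rw [div_le_one (by positivity)]; linarith
    nlinarith [mul_le_mul_of_nonneg_left this (sq_nonneg T)]

/-- Sobolev embedding into bounded functions. -/
theorem sup_sq_le_J {γ : ℝ} (hγ : 3 < γ) : ∃ C > (0 : ℝ), ∀ p k, ∀ x ∈ Icc (-1 : ℝ) 1,
    dv p k x ^ 2 ≤ C * (J γ (bt γ) p k + J γ (bt γ) p (k + 1)) := by
  obtain ⟨C, hC, h⟩ := iint_abs_sq_le hγ
  refine ⟨2 * C, by positivity, fun p k x hx => ?_⟩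
  have h1 := iint_abs_sup (continuous_dv p k) (continuous_dv p (k + 1)) (hasDerivAt_dv p k) hx
  have h2 := h _ (continuous_dv p k)
  have h3 := h _ (continuous_dv p (k + 1))
  rw [← sq_abs]
  unfold J
  set a := ∫ x in (-1 : ℝ)..1, |dv p k x|
  set b := ∫ x in (-1 : ℝ)..1, |dv p (k + 1) x|
  have : |dv p k x| ^ 2 ≤ (a + b) ^ 2 := by gcongr
  nlinarith [sq_nonneg (a - b)]

/-- Weighted sup bound. -/
theorem wsup_sq_le_J {γ : ℝ} (hγ : 3 < γ) (m : ℕ) (p : Polynomial ℝ) (k : ℕ) {x : ℝ}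
    (hx : x ∈ Icc (-1 : ℝ) 1) :
    ddg γ x ^ (m + 1) * dv p k x ^ 2 ≤ (m + 3) * (J γ m p k + J γ (m + 2) p (k + 1)) := by
  have hm : (0 : ℝ) ≤ m := Nat.cast_nonneg m
  have w0 := continuous_wt γ hm
  have w2 := continuous_wt γ (by linarith : 0 ≤ (m : ℝ) + 2)
  have h1 := iint_abs_sup (u := fun x => ddg γ x ^ (m + 1) * dv p k x ^ 2)
    (u' := fun x => (m + 1) * ddg γ x ^ m * (-2 * mu γ * x) * dv p k x ^ 2 +
      ddg γ x ^ (m + 1) * (2 * dv p k x * dv p (k + 1) x)) (by fun_prop) (by fun_prop)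
    (fun x => by
      refine (((hasDerivAt_ddg γ x).pow (m + 1)).mul ((hasDerivAt_dv p k x).pow 2)).congr_deriv ?_
      simp) hx
  refine (le_abs_self _).trans (h1.trans ?_)
  rw [← intervalIntegral.integral_add (iintegrable (by fun_prop)) (iintegrable (by fun_prop))]
  unfold J
  rw [← intervalIntegral.integral_add (iintegrable (by fun_prop)) (iintegrable (by fun_prop)),
    ← intervalIntegral.integral_const_mul]
  apply iint_mono (by fun_prop) (by fun_prop)
  intro y hy
  have hd := ddg_nonneg hγ hy
  have hd1 := ddg_le hγ (x := y)
  have e2 : wt γ (m + 2) y = ddg γ y ^ (m + 2) := by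
    have := wt_nat γ (m + 2) y
    push_cast at this; exact this
  rw [wt_nat, e2]
  have hmu := mu_gt hγ
  have hmu2 := mu_lt hγ
  have hyy : |2 * mu γ * y| ≤ 1 := by rw [abs_le]; constructor <;> nlinarith [hy.1, hy.2]
  set D := ddg γ y
  set h0 := dv p k y
  set h1 := dv p (k + 1) y
  have hDm : 0 ≤ D ^ m := by positivity
  have a1 : |D ^ (m + 1) * h0 ^ 2| ≤ D ^ m * h0 ^ 2 := by
    rw [abs_of_nonneg (by positivity), pow_succ]
    apply mul_le_mul_of_nonneg_right _ (sq_nonneg _)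
    exact mul_le_of_le_one_right hDm hd1
  have a2 : |(m + 1) * D ^ m * (-2 * mu γ * y) * h0 ^ 2| ≤ (m + 1) * (D ^ m * h0 ^ 2) := by
    have : (m + 1) * D ^ m * (-2 * mu γ * y) * h0 ^ 2 =
      -((2 * mu γ * y) * ((m + 1) * (D ^ m * h0 ^ 2))) := by ring
    rw [this, abs_neg, abs_mul, abs_of_nonneg (by positivity : 0 ≤ (m + 1) * (D ^ m * h0 ^ 2))]
    exact mul_le_of_le_one_left (by positivity) hyy
  have a3 : |D ^ (m + 1) * (2 * h0 * h1)| ≤ D ^ m * h0 ^ 2 + D ^ (m + 2) * h1 ^ 2 := by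
    have e : D ^ m * h0 ^ 2 + D ^ (m + 2) * h1 ^ 2 = D ^ m * (h0 ^ 2 + (D * h1) ^ 2) := by ring
    rw [e, show D ^ (m + 1) * (2 * h0 * h1) = D ^ m * (2 * h0 * (D * h1)) by ring, abs_mul,
      abs_of_nonneg hDm]
    apply mul_le_mul_of_nonneg_left _ hDm
    rw [abs_le]; constructor <;> nlinarith [sq_nonneg (h0 - D * h1), sq_nonneg (h0 + D * h1)]
  have a4 := abs_add_le ((m + 1) * D ^ m * (-2 * mu γ * y) * h0 ^ 2) (D ^ (m + 1) * (2 * h0 * h1))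
  have p2 : 0 ≤ (m + 2) * (D ^ (m + 2) * h1 ^ 2) := by positivity
  linarith

/-- Low-high norm of a polynomial, equivalent to the full fourth order weighted norm. -/
def S4 (γ : ℝ) (p : Polynomial ℝ) : ℝ := J γ (bt γ) p 0 + J γ (bt γ + 4) p 4

/-- Fifth order weighted norm of a polynomial. -/
def S5 (γ : ℝ) (p : Polynomial ℝ) : ℝ := S4 γ p + J γ (bt γ + 5) p 5

theorem S4_nonneg {γ : ℝ} (hγ : 3 < γ) (p : Polynomial ℝ) : 0 ≤ S4 γ p :=
  add_nonneg (J_nonneg hγ _ _ _) (J_nonneg hγ _ _ _)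

theorem S5_nonneg {γ : ℝ} (hγ : 3 < γ) (p : Polynomial ℝ) : 0 ≤ S5 γ p :=
  add_nonneg (S4_nonneg hγ _) (J_nonneg hγ _ _ _)

theorem J_interp_S4 {γ : ℝ} (hγ : 3 < γ) : ∃ C > (0 : ℝ), ∀ p,
    J γ (bt γ + 1) p 1 ≤ C * S4 γ p ∧ J γ (bt γ + 2) p 2 ≤ C * S4 γ p ∧
      J γ (bt γ + 3) p 3 ≤ C * S4 γ p := by
  obtain ⟨C3, hC3, h3⟩ := J_interp hγ 2 one_pos
  obtain ⟨C2, hC2, h2⟩ := J_interp hγ 1 (show (0 : ℝ) < 1 / (4 * C3) by positivity)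
  obtain ⟨C1, hC1, h1⟩ := J_interp hγ 0 (show (0 : ℝ) < 1 / (2 * C2) by positivity)
  norm_num [add_assoc] at h1 h2 h3
  have key : ∀ p, ∃ A0 A1 A2 A3 A4 : ℝ, J γ (bt γ) p 0 = A0 ∧ J γ (bt γ + 1) p 1 = A1 ∧
      J γ (bt γ + 2) p 2 = A2 ∧ J γ (bt γ + 3) p 3 = A3 ∧ J γ (bt γ + 4) p 4 = A4 ∧
      0 ≤ A0 ∧ 0 ≤ A1 ∧ 0 ≤ A2 ∧ 0 ≤ A3 ∧ 0 ≤ A4 ∧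
      A3 ≤ 2 * A4 + 4 * C3 * C2 * C1 * A0 ∧ 2 * C3 * A2 ≤ A3 + 4 * C3 * C2 * C1 * A0 ∧
      2 * C2 * A1 ≤ A2 + 2 * C2 * C1 * A0 := by
    intro p
    refine ⟨_, _, _, _, _, rfl, rfl, rfl, rfl, rfl, J_nonneg hγ _ _ _, J_nonneg hγ _ _ _,
      J_nonneg hγ _ _ _, J_nonneg hγ _ _ _, J_nonneg hγ _ _ _, ?_⟩
    have a1 := h1 p
    have a2 := h2 p
    have a3 := h3 p
    generalize J γ (bt γ) p 0 = A0, J γ (bt γ + 1) p 1 = A1, J γ (bt γ + 2) p 2 = A2,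
      J γ (bt γ + 3) p 3 = A3, J γ (bt γ + 4) p 4 = A4 at *
    have b1 : 2 * C2 * A1 ≤ A2 + 2 * C2 * C1 * A0 := by
      have := mul_le_mul_of_nonneg_left a1 (by positivity : 0 ≤ 2 * C2)
      field_simp at this
      linarith
    have b2 : 4 * C3 * A2 ≤ A3 + 4 * C3 * (C2 * A1) := by
      have := mul_le_mul_of_nonneg_left a2 (by positivity : 0 ≤ 4 * C3)
      field_simp at this
      linarith
    have b3 : 2 * C3 * A2 ≤ A3 + 4 * C3 * C2 * C1 * A0 := by
      have := mul_le_mul_of_nonneg_left b1 (by positivity : 0 ≤ 2 * C3)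
      linarith
    exact ⟨by linarith, b3, b1⟩
  refine ⟨2 + 4 * C3 * C2 * C1 + (2 + 8 * C3 * C2 * C1) / (2 * C3) +
    ((2 + 8 * C3 * C2 * C1) / (2 * C3) + 2 * C2 * C1) / (2 * C2), by positivity, fun p => ?_⟩
  obtain ⟨A0, A1, A2, A3, A4, e0, e1, e2, e3, e4, n0, n1, n2, n3, n4, k3, k2, k1⟩ := key p
  rw [S4, e0, e1, e2, e3, e4]
  have hS : 0 ≤ A0 + A4 := by positivity
  have m3 : A3 ≤ (2 + 4 * C3 * C2 * C1) * (A0 + A4) := by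
    have : 0 ≤ 4 * C3 * C2 * C1 * A4 := by positivity
    linarith
  have m2 : A2 ≤ (2 + 8 * C3 * C2 * C1) / (2 * C3) * (A0 + A4) := by
    rw [div_mul_eq_mul_div, le_div_iff₀ (by positivity)]
    have : 0 ≤ 4 * C3 * C2 * C1 * A4 := by positivity
    linarith
  have m1 : A1 ≤ ((2 + 8 * C3 * C2 * C1) / (2 * C3) + 2 * C2 * C1) / (2 * C2) * (A0 + A4) := by
    rw [div_mul_eq_mul_div, le_div_iff₀ (by positivity)]
    have : 0 ≤ 2 * C2 * C1 * A4 := by positivity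
    linarith
  have q1 : 0 ≤ 4 * C3 * C2 * C1 := by positivity
  have q2 : 0 ≤ (2 + 8 * C3 * C2 * C1) / (2 * C3) := by positivity
  have q3 : 0 ≤ ((2 + 8 * C3 * C2 * C1) / (2 * C3) + 2 * C2 * C1) / (2 * C2) := by positivity
  refine ⟨m1.trans ?_, m2.trans ?_, m3.trans ?_⟩ <;>
  · apply mul_le_mul_of_nonneg_right _ hS
    linarith

/-- Collected weighted Hardy and Sobolev bounds with a common constant. -/
structure StatBd (γ C : ℝ) : Prop where
  one_le : 1 ≤ C
  j1 : ∀ p, J γ (bt γ) p 1 ≤ C * S4 γ p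
  j2 : ∀ p, J γ (bt γ) p 2 ≤ C * S4 γ p
  j3 : ∀ p, J γ (bt γ + 2) p 3 ≤ C * S4 γ p
  s0 : ∀ p, ∀ x ∈ Icc (-1 : ℝ) 1, dv p 0 x ^ 2 ≤ C * S4 γ p
  s1 : ∀ p, ∀ x ∈ Icc (-1 : ℝ) 1, dv p 1 x ^ 2 ≤ C * S4 γ p
  s2 : ∀ p, ∀ x ∈ Icc (-1 : ℝ) 1, ddg γ x ^ 2 * dv p 2 x ^ 2 ≤ C * S4 γ p
  s3 : ∀ p, ∀ x ∈ Icc (-1 : ℝ) 1, ddg γ x ^ 4 * dv p 3 x ^ 2 ≤ C * S4 γ p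
  t4 : ∀ p, J γ (bt γ + 3) p 4 ≤ C * S5 γ p
  t3 : ∀ p, J γ (bt γ + 1) p 3 ≤ C * S5 γ p
  u2 : ∀ p, ∀ x ∈ Icc (-1 : ℝ) 1, ddg γ x * dv p 2 x ^ 2 ≤ C * S5 γ p
  u3 : ∀ p, ∀ x ∈ Icc (-1 : ℝ) 1, ddg γ x ^ 3 * dv p 3 x ^ 2 ≤ C * S5 γ p
  u4 : ∀ p, ∀ x ∈ Icc (-1 : ℝ) 1, ddg γ x ^ 6 * dv p 4 x ^ 2 ≤ C * S5 γ p

theorem exists_bound_j {γ : ℝ} (hγ : 3 < γ) : ∃ C > (0 : ℝ), ∀ p,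
    J γ (bt γ) p 1 ≤ C * S4 γ p ∧ J γ (bt γ) p 2 ≤ C * S4 γ p ∧
      J γ (bt γ + 2) p 3 ≤ C * S4 γ p := by
  have hb := bt_pos hγ
  obtain ⟨C0, hC0, h0⟩ := J_interp_S4 hγ
  obtain ⟨C1, hC1, h1⟩ := hardy_J hγ (by linarith : 0 ≤ bt γ + 2)
  obtain ⟨C2, hC2, h2⟩ := hardy_J hγ hb.le
  have e : bt γ + 2 + 2 = bt γ + 4 := by ring
  rw [e] at h1
  have k3 : ∀ p, J γ (bt γ + 2) p 3 ≤ C1 * (C0 + 1) * S4 γ p := fun p => by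
    have a := h1 p 3
    have b := (J_anti hγ (by linarith : 0 ≤ bt γ + 3) (by linarith : bt γ + 3 ≤ bt γ + 4)
      p 3).trans (h0 p).2.2
    have c : J γ (bt γ + 4) p 4 ≤ S4 γ p := by
      unfold S4; linarith [J_nonneg hγ (bt γ) p 0]
    have := mul_le_mul_of_nonneg_left (add_le_add b c) hC1.le
    linarith
  have k2 : ∀ p, J γ (bt γ) p 2 ≤ C2 * (C0 + C1 * (C0 + 1)) * S4 γ p := fun p => by
    have a := h2 p 2
    have := mul_le_mul_of_nonneg_left (add_le_add (h0 p).2.1 (k3 p)) hC2.le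
    linarith
  have k1 : ∀ p, J γ (bt γ) p 1 ≤ C2 * (C0 + C0) * S4 γ p := fun p => by
    have a := h2 p 1
    have b := (J_anti hγ (by linarith : 0 ≤ bt γ + 1) (by linarith : bt γ + 1 ≤ bt γ + 2)
      p 1).trans (h0 p).1
    have := mul_le_mul_of_nonneg_left (add_le_add b (h0 p).2.1) hC2.le
    linarith
  have m1 : 0 ≤ C1 * (C0 + 1) := by positivity
  have m2 : 0 ≤ C2 * (C0 + C1 * (C0 + 1)) := by positivity
  have m3 : 0 ≤ C2 * (C0 + C0) := by positivity
  refine ⟨C1 * (C0 + 1) + C2 * (C0 + C1 * (C0 + 1)) + C2 * (C0 + C0), by positivity, fun p => ?_⟩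
  have hS := S4_nonneg hγ p
  refine ⟨(k1 p).trans ?_, (k2 p).trans ?_, (k3 p).trans ?_⟩ <;>
  · apply mul_le_mul_of_nonneg_right _ hS
    linarith

theorem exists_bound_t {γ : ℝ} (hγ : 3 < γ) : ∃ C > (0 : ℝ), ∀ p,
    J γ (bt γ + 3) p 4 ≤ C * S5 γ p ∧ J γ (bt γ + 1) p 3 ≤ C * S5 γ p ∧
      J γ 0 p 2 ≤ C * S5 γ p := by
  have hb := bt_pos hγ
  have hb2 := bt_lt_half hγ
  obtain ⟨C0, hC0, h0⟩ := exists_bound_j hγ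
  obtain ⟨C1, hC1, h1⟩ := hardy_J hγ (by linarith : 0 ≤ bt γ + 3)
  obtain ⟨C2, hC2, h2⟩ := hardy_J hγ (by linarith : 0 ≤ bt γ + 1)
  obtain ⟨C3, hC3, h3⟩ := hardy_J hγ le_rfl
  rw [show bt γ + 3 + 2 = bt γ + 5 by ring] at h1
  rw [show bt γ + 1 + 2 = bt γ + 3 by ring] at h2
  have le5 : ∀ p, S4 γ p ≤ S5 γ p := fun p => by
    unfold S5; linarith [J_nonneg hγ (bt γ + 5) p 5]
  have k4 : ∀ p, J γ (bt γ + 3) p 4 ≤ C1 * S5 γ p := fun p => by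
    refine (h1 p 4).trans (mul_le_mul_of_nonneg_left ?_ hC1.le)
    have := J_anti hγ (by linarith : 0 ≤ bt γ + 4) (by linarith : bt γ + 4 ≤ bt γ + 5) p 4
    unfold S5 S4; linarith [J_nonneg hγ (bt γ) p 0]
  have k3 : ∀ p, J γ (bt γ + 1) p 3 ≤ C2 * (C0 + C1) * S5 γ p := fun p => by
    have a := h2 p 3
    have b := J_anti hγ (by linarith : 0 ≤ bt γ + 2) (by linarith : bt γ + 2 ≤ bt γ + 3) p 3
    have c := (b.trans (h0 p).2.2).trans (mul_le_mul_of_nonneg_left (le5 p) hC0.le)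
    have := mul_le_mul_of_nonneg_left (add_le_add c (k4 p)) hC2.le
    linarith
  have k2 : ∀ p, J γ 0 p 2 ≤ C3 * (C0 + C2 * (C0 + C1)) * S5 γ p := fun p => by
    have a := h3 p 2
    rw [zero_add] at a
    have b := J_anti hγ hb.le (by linarith : bt γ ≤ 2) p 2
    have b' := J_anti hγ (by linarith : 0 ≤ bt γ + 1) (by linarith : bt γ + 1 ≤ 2) p 3
    have c := (b.trans (h0 p).2.1).trans (mul_le_mul_of_nonneg_left (le5 p) hC0.le)
    have := mul_le_mul_of_nonneg_left (add_le_add c (b'.trans (k3 p))) hC3.le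
    linarith
  have m2 : 0 ≤ C2 * (C0 + C1) := by positivity
  have m3 : 0 ≤ C3 * (C0 + C2 * (C0 + C1)) := by positivity
  refine ⟨C1 + C2 * (C0 + C1) + C3 * (C0 + C2 * (C0 + C1)), by positivity, fun p => ?_⟩
  have hS := S5_nonneg hγ p
  refine ⟨(k4 p).trans ?_, (k3 p).trans ?_, (k2 p).trans ?_⟩ <;>
  · apply mul_le_mul_of_nonneg_right _ hS
    linarith

theorem exists_statBd {γ : ℝ} (hγ : 3 < γ) : ∃ C, StatBd γ C := by
  have hb := bt_pos hγ
  have hb2 := bt_lt_half hγ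
  obtain ⟨C0, hC0, h0⟩ := exists_bound_j hγ
  obtain ⟨C1, hC1, h1⟩ := exists_bound_t hγ
  obtain ⟨C2, hC2, h2⟩ := sup_sq_le_J hγ
  set C := 16 * (C0 + C1 + 1) * (C2 + 1) with hC
  have le5 : ∀ p, S4 γ p ≤ S5 γ p := fun p => by
    unfold S5; linarith [J_nonneg hγ (bt γ + 5) p 5]
  have p0 : ∀ p, J γ (bt γ) p 0 ≤ S4 γ p := fun p => by
    unfold S4; linarith [J_nonneg hγ (bt γ + 4) p 4]
  have p4 : ∀ p, J γ (bt γ + 4) p 4 ≤ S4 γ p := fun p => by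
    unfold S4; linarith [J_nonneg hγ (bt γ) p 0]
  have p5 : ∀ p, J γ (bt γ + 5) p 5 ≤ S5 γ p := fun p => by
    unfold S5; linarith [S4_nonneg hγ p]
  have fin4 : ∀ p {u c : ℝ}, u ≤ c * S4 γ p → c ≤ C → u ≤ C * S4 γ p := fun p u c h hc =>
    h.trans (mul_le_mul_of_nonneg_right hc (S4_nonneg hγ p))
  have fin5 : ∀ p {u c : ℝ}, u ≤ c * S5 γ p → c ≤ C → u ≤ C * S5 γ p := fun p u c h hc =>
    h.trans (mul_le_mul_of_nonneg_right hc (S5_nonneg hγ p))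
  have q1 : 0 ≤ (C0 + C1 + 1) * C2 := by positivity
  have q2 : 0 ≤ C0 * C2 := by positivity
  have q3 : 0 ≤ C1 * C2 := by positivity
  refine ⟨C, ?_, fun p => fin4 p (h0 p).1 ?_, fun p => fin4 p (h0 p).2.1 ?_,
    fun p => fin4 p (h0 p).2.2 ?_, fun p x hx => ?_, fun p x hx => ?_, fun p x hx => ?_,
    fun p x hx => ?_, fun p => fin5 p (h1 p).1 ?_, fun p => fin5 p (h1 p).2.1 ?_,
    fun p x hx => ?_, fun p x hx => ?_, fun p x hx => ?_⟩
  · rw [hC]; linarith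
  · rw [hC]; linarith
  · rw [hC]; linarith
  · rw [hC]; linarith
  · refine fin4 p (c := C2 * (1 + C0)) ((h2 p 0 x hx).trans ?_) (by rw [hC]; linarith)
    have := mul_le_mul_of_nonneg_left (add_le_add (p0 p) (h0 p).1) hC2.le
    linarith
  · refine fin4 p (c := C2 * (C0 + C0)) ((h2 p 1 x hx).trans ?_) (by rw [hC]; linarith)
    have := mul_le_mul_of_nonneg_left (add_le_add (h0 p).1 (h0 p).2.1) hC2.le
    linarith
  · refine fin4 p (c := 4 * (C0 + C0)) ((wsup_sq_le_J hγ 1 p 2 hx).trans ?_) (by rw [hC]; linarith)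
    have a := (J_anti hγ hb.le (by linarith : bt γ ≤ 1) p 2).trans (h0 p).2.1
    have b := (J_anti hγ (by linarith) (by linarith : bt γ + 2 ≤ 3) p 3).trans (h0 p).2.2
    norm_num
    linarith
  · refine fin4 p (c := 6 * (C0 + 1)) ((wsup_sq_le_J hγ 3 p 3 hx).trans ?_) (by rw [hC]; linarith)
    have a := (J_anti hγ (by linarith) (by linarith : bt γ + 2 ≤ 3) p 3).trans (h0 p).2.2
    have b := (J_anti hγ (by linarith) (by linarith : bt γ + 4 ≤ 5) p 4).trans (p4 p)
    norm_num
    linarith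
  · rw [hC]; linarith
  · rw [hC]; linarith
  · have := wsup_sq_le_J hγ 0 p 2 hx
    norm_num at this
    refine fin5 p (c := 3 * (C1 + C1)) (this.trans ?_) (by rw [hC]; linarith)
    have a := (J_anti hγ (by linarith) (by linarith : bt γ + 1 ≤ 2) p 3).trans (h1 p).2.1
    linarith [(h1 p).2.2]
  · refine fin5 p (c := 5 * (C1 + C1)) ((wsup_sq_le_J hγ 2 p 3 hx).trans ?_) (by rw [hC]; linarith)
    have a := (J_anti hγ (by linarith) (by linarith : bt γ + 1 ≤ 2) p 3).trans (h1 p).2.1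
    have b := (J_anti hγ (by linarith) (by linarith : bt γ + 3 ≤ 4) p 4).trans (h1 p).1
    norm_num
    linarith
  · refine fin5 p (c := 8 * (C1 + 1)) ((wsup_sq_le_J hγ 5 p 4 hx).trans ?_) (by rw [hC]; linarith)
    have a := (J_anti hγ (by linarith) (by linarith : bt γ + 3 ≤ 5) p 4).trans (h1 p).1
    have b := (J_anti hγ (by linarith) (by linarith : bt γ + 5 ≤ 7) p 5).trans (p5 p)
    norm_num
    linarith

/-- Weighted Cauchy–Schwarz inequality for continuous functions. -/
theorem iint_cs {w u v : ℝ → ℝ} (hw : ContinuousOn w (Icc (-1) 1)) (hu : ContinuousOn u (Icc (-1) 1))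
    (hv : ContinuousOn v (Icc (-1) 1)) (h0 : ∀ x ∈ Icc (-1 : ℝ) 1, 0 ≤ w x) :
    (∫ x in (-1 : ℝ)..1, w x * (u x * v x)) ^ 2 ≤
      (∫ x in (-1 : ℝ)..1, w x * u x ^ 2) * ∫ x in (-1 : ℝ)..1, w x * v x ^ 2 := by
  have key : ∀ t : ℝ, 0 ≤ (∫ x in (-1 : ℝ)..1, w x * u x ^ 2) * (t * t) +
      (2 * ∫ x in (-1 : ℝ)..1, w x * (u x * v x)) * t + ∫ x in (-1 : ℝ)..1, w x * v x ^ 2 := by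
    intro t
    have : 0 ≤ ∫ x in (-1 : ℝ)..1, w x * (u x * t + v x) ^ 2 :=
      iint_nonneg fun x hx => mul_nonneg (h0 x hx) (sq_nonneg _)
    have e : ∫ x in (-1 : ℝ)..1, w x * (u x * t + v x) ^ 2 =
        (∫ x in (-1 : ℝ)..1, w x * u x ^ 2 * (t * t) + w x * (u x * v x) * (2 * t)) +
          ∫ x in (-1 : ℝ)..1, w x * v x ^ 2 := by
      rw [← intervalIntegral.integral_add (iintegrable (by fun_prop)) (iintegrable (by fun_prop))]
      congr 1; ext x; ring
    rw [e, intervalIntegral.integral_add (iintegrable (by fun_prop)) (iintegrable (by fun_prop)),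
      intervalIntegral.integral_mul_const, intervalIntegral.integral_mul_const] at this
    linarith
  have := discrim_le_zero key
  unfold discrim at this
  nlinarith

/-- The spatial derivative `∂ₓη = 1 + ∂ₓδη` of the flow map. -/
def qq (p : Polynomial ℝ) (x : ℝ) : ℝ := 1 + dv p 1 x

/-- The `k`-th derivative of `q ↦ q ^ (-γ)` evaluated at `qq p x`. -/
def En (γ : ℝ) (p : Polynomial ℝ) (k : ℕ) (x : ℝ) : ℝ :=
  (∏ i ∈ Finset.range k, (-γ - i)) * qq p x ^ (-γ - k)

/-- The flow map stays close to the identity. -/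
def NearId (p : Polynomial ℝ) : Prop := ∀ x ∈ Icc (-1 : ℝ) 1, |dv p 1 x| ≤ 1 / 2

theorem NearId.half_le {p : Polynomial ℝ} (h : NearId p) {x : ℝ} (hx : x ∈ Icc (-1 : ℝ) 1) :
    1 / 2 ≤ qq p x := by
  have := (abs_le.1 (h x hx)).1
  unfold qq; linarith

theorem hasDerivAt_qq (p : Polynomial ℝ) (x : ℝ) : HasDerivAt (qq p) (dv p 2 x) x :=
  (hasDerivAt_dv p 1 x).const_add 1

theorem hasDerivAt_En (γ : ℝ) {p : Polynomial ℝ} (h : NearId p) (k : ℕ) {x : ℝ}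
    (hx : x ∈ Icc (-1 : ℝ) 1) : HasDerivAt (En γ p k) (En γ p (k + 1) x * dv p 2 x) x := by
  have hq : qq p x ≠ 0 := by have := h.half_le hx; linarith
  refine (((hasDerivAt_qq p x).rpow_const (p := -γ - k) (Or.inl hq)).const_mul
    (∏ i ∈ Finset.range k, (-γ - (i : ℝ)))).congr_deriv ?_
  unfold En
  rw [Finset.prod_range_succ]
  push_cast
  rw [show -γ - k - 1 = -γ - (k + 1) by ring]
  ring

theorem continuousOn_En (γ : ℝ) {p : Polynomial ℝ} (h : NearId p) (k : ℕ) :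
    ContinuousOn (En γ p k) (Icc (-1) 1) := fun _ hx =>
  (hasDerivAt_En γ h k hx).continuousAt.continuousWithinAt

theorem En_sq_le {γ : ℝ} (hγ : 3 < γ) : ∃ C ≥ (1 : ℝ), ∀ p, NearId p → ∀ k ≤ 5,
    ∀ x ∈ Icc (-1 : ℝ) 1, En γ p k x ^ 2 ≤ C := by
  refine ⟨(∏ i ∈ Finset.range 5, (γ + i)) ^ 2 * ((1 / 2 : ℝ) ^ (-γ - 5)) ^ 2, ?_,
    fun p h k hk x hx => ?_⟩
  · have a : (1 : ℝ) ≤ ∏ i ∈ Finset.range 5, (γ + i) := by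
      have := Finset.prod_le_prod (s := Finset.range 5) (f := fun _ => (1 : ℝ))
        (g := fun i : ℕ => γ + i) (fun _ _ => zero_le_one)
        (fun i _ => by have : (0 : ℝ) ≤ i := Nat.cast_nonneg _
                       linarith)
      simpa using this
    have b : (1 : ℝ) ≤ (1 / 2 : ℝ) ^ (-γ - 5) :=
      Real.one_le_rpow_of_pos_of_le_one_of_nonpos (by norm_num) (by norm_num) (by linarith)
    have := one_le_mul_of_one_le_of_one_le (one_le_pow₀ a (n := 2)) (one_le_pow₀ b (n := 2))
    exact this
  · unfold En
    rw [mul_pow]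
    have hq := h.half_le hx
    have hpos : 0 < qq p x := by linarith
    apply mul_le_mul _ _ (sq_nonneg _) (sq_nonneg _)
    · rw [← sq_abs, Finset.abs_prod]
      apply pow_le_pow_left₀ (Finset.prod_nonneg fun _ _ => abs_nonneg _)
      calc ∏ i ∈ Finset.range k, |(-γ - (i : ℝ))| = ∏ i ∈ Finset.range k, (γ + i) :=
            Finset.prod_congr rfl fun i _ => by
              rw [show -γ - (i : ℝ) = -(γ + i) by ring, abs_neg, abs_of_nonneg]; positivity
        _ ≤ _ := Finset.prod_le_prod_of_subset_of_one_le (by simpa using hk)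
            (fun i _ => by positivity) fun i _ _ => by
              have : (0 : ℝ) ≤ i := Nat.cast_nonneg _
              linarith
    · apply pow_le_pow_left₀ (by positivity)
      calc qq p x ^ (-γ - k) ≤ (1 / 2 : ℝ) ^ (-γ - k) :=
            Real.rpow_le_rpow_of_nonpos (by norm_num) hq (by
              have : (0 : ℝ) ≤ k := Nat.cast_nonneg _
              linarith)
        _ ≤ _ := by
          apply Real.rpow_le_rpow_of_exponent_ge (by norm_num) (by norm_num)
          have : (k : ℝ) ≤ 5 := by exact_mod_cast hk
          linarith

/-- The derivatives `∂ₓ^k (q^{-γ})` for `k ≤ 3`. -/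
def gk (γ : ℝ) (p : Polynomial ℝ) : ℕ → ℝ → ℝ
  | 0, x => En γ p 0 x
  | 1, x => En γ p 1 x * dv p 2 x
  | 2, x => En γ p 2 x * dv p 2 x ^ 2 + En γ p 1 x * dv p 3 x
  | 3, x => En γ p 3 x * dv p 2 x ^ 3 + 3 * En γ p 2 x * dv p 2 x * dv p 3 x
      + En γ p 1 x * dv p 4 x
  | _, _ => 0

/-- The lower order part of `∂ₓ⁴ (q^{-γ})`. -/
def gR (γ : ℝ) (p : Polynomial ℝ) (x : ℝ) : ℝ :=
  En γ p 4 x * dv p 2 x ^ 4 + 6 * En γ p 3 x * dv p 2 x ^ 2 * dv p 3 x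
    + 3 * En γ p 2 x * dv p 3 x ^ 2 + 4 * En γ p 2 x * dv p 2 x * dv p 4 x

/-- The derivative of `gR`. -/
def gR' (γ : ℝ) (p : Polynomial ℝ) (x : ℝ) : ℝ :=
  En γ p 5 x * dv p 2 x ^ 5 + 10 * En γ p 4 x * dv p 2 x ^ 3 * dv p 3 x
    + 15 * En γ p 3 x * dv p 2 x * dv p 3 x ^ 2 + 10 * En γ p 3 x * dv p 2 x ^ 2 * dv p 4 x
    + 10 * En γ p 2 x * dv p 3 x * dv p 4 x + 4 * En γ p 2 x * dv p 2 x * dv p 5 x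

/-- The principal part of `∂ₓ⁴ (q^{-γ})`. -/
def gA (γ : ℝ) (p : Polynomial ℝ) (x : ℝ) : ℝ := En γ p 1 x * dv p 5 x

/-- The derivative of `gA`. -/
def gA' (γ : ℝ) (p : Polynomial ℝ) (x : ℝ) : ℝ :=
  En γ p 2 x * dv p 2 x * dv p 5 x + En γ p 1 x * dv p 6 x

theorem hasDerivAt_gk0 (γ : ℝ) {p : Polynomial ℝ} (h : NearId p) {x : ℝ}
    (hx : x ∈ Icc (-1 : ℝ) 1) :
    HasDerivAt (gk γ p 0) (gk γ p 1 x) x :=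
  hasDerivAt_En γ h 0 hx

theorem hasDerivAt_gk1 (γ : ℝ) {p : Polynomial ℝ} (h : NearId p) {x : ℝ}
    (hx : x ∈ Icc (-1 : ℝ) 1) :
    HasDerivAt (gk γ p 1) (gk γ p 2 x) x := by
  refine ((hasDerivAt_En γ h 1 hx).mul (hasDerivAt_dv p 2 x)).congr_deriv ?_
  simp only [gk]; ring

theorem hasDerivAt_gk2 (γ : ℝ) {p : Polynomial ℝ} (h : NearId p) {x : ℝ}
    (hx : x ∈ Icc (-1 : ℝ) 1) :
    HasDerivAt (gk γ p 2) (gk γ p 3 x) x := by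
  refine (((hasDerivAt_En γ h 2 hx).mul ((hasDerivAt_dv p 2 x).pow 2)).add
    ((hasDerivAt_En γ h 1 hx).mul (hasDerivAt_dv p 3 x))).congr_deriv ?_
  simp only [gk, Pi.pow_apply]; push_cast; ring

theorem hasDerivAt_gk3 (γ : ℝ) {p : Polynomial ℝ} (h : NearId p) {x : ℝ}
    (hx : x ∈ Icc (-1 : ℝ) 1) :
    HasDerivAt (gk γ p 3) (gA γ p x + gR γ p x) x := by
  refine ((((hasDerivAt_En γ h 3 hx).mul ((hasDerivAt_dv p 2 x).pow 3)).add
    ((((hasDerivAt_En γ h 2 hx).const_mul 3).mul (hasDerivAt_dv p 2 x)).mul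
      (hasDerivAt_dv p 3 x))).add
    ((hasDerivAt_En γ h 1 hx).mul (hasDerivAt_dv p 4 x))).congr_deriv ?_
  simp only [gA, gR, Pi.pow_apply, Pi.mul_apply]; push_cast; ring

theorem hasDerivAt_gA (γ : ℝ) {p : Polynomial ℝ} (h : NearId p) {x : ℝ}
    (hx : x ∈ Icc (-1 : ℝ) 1) :
    HasDerivAt (gA γ p) (gA' γ p x) x := by
  refine ((hasDerivAt_En γ h 1 hx).mul (hasDerivAt_dv p 5 x)).congr_deriv ?_
  simp only [gA']

theorem hasDerivAt_gR (γ : ℝ) {p : Polynomial ℝ} (h : NearId p) {x : ℝ}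
    (hx : x ∈ Icc (-1 : ℝ) 1) :
    HasDerivAt (gR γ p) (gR' γ p x) x := by
  refine (((((hasDerivAt_En γ h 4 hx).mul ((hasDerivAt_dv p 2 x).pow 4)).add
    ((((hasDerivAt_En γ h 3 hx).const_mul 6).mul ((hasDerivAt_dv p 2 x).pow 2)).mul
      (hasDerivAt_dv p 3 x))).add
    (((hasDerivAt_En γ h 2 hx).const_mul 3).mul ((hasDerivAt_dv p 3 x).pow 2))).add
    ((((hasDerivAt_En γ h 2 hx).const_mul 4).mul (hasDerivAt_dv p 2 x)).mul
      (hasDerivAt_dv p 4 x))).congr_deriv ?_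
  simp only [gR', Pi.pow_apply, Pi.mul_apply]; push_cast; ring

/-- The derivatives `∂ₓ^k` (`k ≤ 4`) of the force
`η + κ d' q^{-γ} + d ∂ₓ(q^{-γ})`, with `κ = 1 + 1 / (γ - 1)`. -/
def GG (γ : ℝ) (p : Polynomial ℝ) : ℕ → ℝ → ℝ
  | 0, x => dv p 0 x + x + ddg γ x * gk γ p 1 x + (bt γ + 1) * (-2 * mu γ * x) * gk γ p 0 x
  | 1, x => dv p 1 x + 1 + ddg γ x * gk γ p 2 x + (bt γ + 2) * (-2 * mu γ * x) * gk γ p 1 x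
      + (bt γ + 1) * (-2 * mu γ) * gk γ p 0 x
  | 2, x => dv p 2 x + ddg γ x * gk γ p 3 x + (bt γ + 3) * (-2 * mu γ * x) * gk γ p 2 x
      + (2 * bt γ + 3) * (-2 * mu γ) * gk γ p 1 x
  | 3, x => dv p 3 x + ddg γ x * (gA γ p x + gR γ p x)
      + (bt γ + 4) * (-2 * mu γ * x) * gk γ p 3 x + (3 * bt γ + 6) * (-2 * mu γ) * gk γ p 2 x
  | 4, x => dv p 4 x + ddg γ x * (gA' γ p x + gR' γ p x)
      + (bt γ + 5) * (-2 * mu γ * x) * (gA γ p x + gR γ p x)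
      + (4 * bt γ + 10) * (-2 * mu γ) * gk γ p 3 x
  | _, _ => 0

theorem hasDerivAt_ddg' (γ x : ℝ) (c : ℝ) :
    HasDerivAt (fun x => c * (-2 * mu γ * x)) (c * (-2 * mu γ)) x := by
  have := ((hasDerivAt_id x).const_mul (-2 * mu γ)).const_mul c
  simpa using this

theorem hasDerivAt_GG (γ : ℝ) {p : Polynomial ℝ} (h : NearId p) {x : ℝ}
    (hx : x ∈ Icc (-1 : ℝ) 1) :
    ∀ k < 4, HasDerivAt (GG γ p k) (GG γ p (k + 1) x) x := by
  have d := hasDerivAt_ddg γ x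
  have d' := hasDerivAt_ddg' γ x
  have f := fun k => hasDerivAt_dv p k x
  have g0 := hasDerivAt_gk0 γ h hx
  have g1 := hasDerivAt_gk1 γ h hx
  have g2 := hasDerivAt_gk2 γ h hx
  have g3 := hasDerivAt_gk3 γ h hx
  have g4 := (hasDerivAt_gA γ h hx).add (hasDerivAt_gR γ h hx)
  intro k hk
  interval_cases k
  · refine ((((f 0).add (hasDerivAt_id x)).add (d.mul g1)).add ((d' _).mul g0)).congr_deriv ?_
    simp only [GG]; ring
  · refine (((((f 1).add_const 1).add (d.mul g2)).add ((d' _).mul g1)).add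
      (g0.const_mul _)).congr_deriv ?_
    simp only [GG]; ring
  · refine ((((f 2).add (d.mul g3)).add ((d' _).mul g2)).add (g1.const_mul _)).congr_deriv ?_
    simp only [GG]; ring
  · refine ((((f 3).add (d.mul g4)).add ((d' _).mul g3)).add (g2.const_mul _)).congr_deriv ?_
    simp only [GG, Pi.add_apply]; ring

theorem continuousOn_GG (γ : ℝ) {p : Polynomial ℝ} (h : NearId p) :
    ∀ k ≤ 4, ContinuousOn (GG γ p k) (Icc (-1) 1) := by
  intro k hk
  rcases hk.lt_or_eq with hk | rfl
  · exact fun x hx => (hasDerivAt_GG γ h hx k hk).continuousAt.continuousWithinAt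
  · have e := continuousOn_En γ h
    have f := fun k => (continuous_dv p k).continuousOn (s := Icc (-1 : ℝ) 1)
    have d := (continuous_ddg γ).continuousOn (s := Icc (-1 : ℝ) 1)
    have cA : ContinuousOn (gA γ p) (Icc (-1) 1) := by unfold gA; fun_prop
    have cA' : ContinuousOn (gA' γ p) (Icc (-1) 1) := by unfold gA'; fun_prop
    have cR : ContinuousOn (gR γ p) (Icc (-1) 1) := by unfold gR; fun_prop
    have cR' : ContinuousOn (gR' γ p) (Icc (-1) 1) := by unfold gR'; fun_prop
    have c3 : ContinuousOn (gk γ p 3) (Icc (-1) 1) := fun x hx =>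
      (hasDerivAt_gk3 γ h hx).continuousAt.continuousWithinAt
    change ContinuousOn (fun x => dv p 4 x + ddg γ x * (gA' γ p x + gR' γ p x)
      + (bt γ + 5) * (-2 * mu γ * x) * (gA γ p x + gR γ p x)
      + (4 * bt γ + 10) * (-2 * mu γ) * gk γ p 3 x) _
    fun_prop

/-- The weight `d` as a polynomial. -/
def dP (γ : ℝ) : Polynomial ℝ := Polynomial.C (mu γ) * (1 - Polynomial.X ^ 2)

/-- Adjoint of the derivative with respect to consecutive weights. -/
def Tp (γ : ℝ) (k : ℕ) (ψ : Polynomial ℝ) : Polynomial ℝ :=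
  -(dP γ * Polynomial.derivative ψ
    + Polynomial.C ((bt γ + k + 1) * (-2 * mu γ)) * (Polynomial.X * ψ))

theorem eval_Tp (γ : ℝ) (k : ℕ) (ψ : Polynomial ℝ) (x : ℝ) : dv (Tp γ k ψ) 0 x =
    -(ddg γ x * dv ψ 1 x + (bt γ + k + 1) * (-2 * mu γ * x) * dv ψ 0 x) := by
  simp [Tp, dv, dP, ddg_eq]; ring

theorem natDegree_Tp_le (γ : ℝ) (k : ℕ) (ψ : Polynomial ℝ) :
    (Tp γ k ψ).natDegree ≤ ψ.natDegree + 1 := by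
  by_cases h0 : ψ.natDegree = 0
  · rw [Polynomial.natDegree_eq_zero] at h0
    obtain ⟨c, rfl⟩ := h0
    simp only [Tp, Polynomial.derivative_C, mul_zero, zero_add, Polynomial.natDegree_neg]
    rw [Polynomial.natDegree_C]
    compute_degree
  · unfold Tp dP
    rw [Polynomial.natDegree_neg]
    have := Polynomial.natDegree_derivative_lt h0
    refine (Polynomial.natDegree_add_le _ _).trans (max_le ?_ ?_)
    · refine (Polynomial.natDegree_mul_le).trans ?_
      have : (Polynomial.C (mu γ) * (1 - Polynomial.X ^ 2) : Polynomial ℝ).natDegree ≤ 2 := by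
        compute_degree
      omega
    · refine (Polynomial.natDegree_C_mul_le _ _).trans ((Polynomial.natDegree_mul_le).trans ?_)
      rw [Polynomial.natDegree_X]; omega

theorem iint_Tp {γ : ℝ} (hγ : 3 < γ) (k : ℕ) {u u' : ℝ → ℝ} (hu : ContinuousOn u (Icc (-1) 1))
    (hu' : ContinuousOn u' (Icc (-1) 1)) (hd : ∀ x ∈ Ioo (-1 : ℝ) 1, HasDerivAt u (u' x) x)
    (ψ : Polynomial ℝ) :
    ∫ x in (-1 : ℝ)..1, wt γ (bt γ + k) x * (u x * dv (Tp γ k ψ) 0 x) =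
      ∫ x in (-1 : ℝ)..1, wt γ (bt γ + (k + 1 : ℕ)) x * (u' x * dv ψ 0 x) := by
  have hb : 0 ≤ bt γ + k := by have := bt_pos hγ; positivity
  have c0 := (continuous_dv ψ 0).continuousOn (s := Icc (-1 : ℝ) 1)
  have c1 := (continuous_dv ψ 1).continuousOn (s := Icc (-1 : ℝ) 1)
  have cT := (continuous_dv (Tp γ k ψ) 0).continuousOn (s := Icc (-1 : ℝ) 1)
  have cw := (continuous_wt γ hb).continuousOn (s := Icc (-1 : ℝ) 1)
  have cw' := (continuous_wt γ (a := bt γ + (k + 1 : ℕ))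
    (by push_cast; linarith)).continuousOn (s := Icc (-1 : ℝ) 1)
  have h := wt_ibp hγ hb (U := fun x => u x * dv ψ 0 x)
    (U' := fun x => u' x * dv ψ 0 x + u x * dv ψ 1 x) (by fun_prop) (by fun_prop)
    (fun x hx => (hd x hx).mul (hasDerivAt_dv ψ 0 x))
  rw [← sub_eq_zero, ← neg_eq_zero, neg_sub, ← intervalIntegral.integral_sub
    (iintegrable (by fun_prop)) (iintegrable (by fun_prop)), ← h]
  apply intervalIntegral.integral_congr
  intro x hx
  rw [uIcc_of_le (by norm_num)] at hx
  have e : wt γ (bt γ + (k + 1 : ℕ)) x = wt γ (bt γ + k) x * ddg γ x := by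
    have := wt_add_nat hγ hb 1 hx
    rw [pow_one] at this
    rw [← this]; congr 1; push_cast; ring
  simp only [eval_Tp, e]
  ring

/-- Four integrations by parts. -/
theorem iint_Tp4 {γ : ℝ} (hγ : 3 < γ) {u : ℕ → ℝ → ℝ}
    (hu : ∀ k ≤ 4, ContinuousOn (u k) (Icc (-1) 1))
    (hd : ∀ k < 4, ∀ x ∈ Ioo (-1 : ℝ) 1, HasDerivAt (u k) (u (k + 1) x) x) (ψ : Polynomial ℝ) :
    ∫ x in (-1 : ℝ)..1, wt γ (bt γ) x *
        (u 0 x * dv (Tp γ 0 (Tp γ 1 (Tp γ 2 (Tp γ 3 ψ)))) 0 x) =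
      ∫ x in (-1 : ℝ)..1, wt γ (bt γ + 4) x * (u 4 x * dv ψ 0 x) := by
  have h0 := iint_Tp hγ 0 (hu 0 (by norm_num)) (hu 1 (by norm_num)) (hd 0 (by norm_num))
    (Tp γ 1 (Tp γ 2 (Tp γ 3 ψ)))
  have h1 := iint_Tp hγ 1 (hu 1 (by norm_num)) (hu 2 (by norm_num)) (hd 1 (by norm_num))
    (Tp γ 2 (Tp γ 3 ψ))
  have h2 := iint_Tp hγ 2 (hu 2 (by norm_num)) (hu 3 (by norm_num)) (hd 2 (by norm_num)) (Tp γ 3 ψ)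
  have h3 := iint_Tp hγ 3 (hu 3 (by norm_num)) (hu 4 (by norm_num)) (hd 3 (by norm_num)) ψ
  have := ((h0.trans h1).trans h2).trans h3
  simpa using this

theorem dv_iterate (p : Polynomial ℝ) (j k : ℕ) (x : ℝ) :
    dv (Polynomial.derivative^[j] p) k x = dv p (k + j) x := by
  simp [dv, Function.iterate_add_apply]

/-- The weak form of the equation, tested to obtain the fourth order identity. -/
theorem weak_top {γ : ℝ} (hγ : 3 < γ) {p Z r : Polynomial ℝ} (h : NearId p) {N : ℕ} (hN : 4 ≤ N)
    (hr : r.natDegree ≤ N) {a : ℝ}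
    (hw : ∀ φ : Polynomial ℝ, φ.natDegree ≤ N → ∫ x in (-1 : ℝ)..1, wt γ (bt γ) x *
      (dv Z 0 x * dv φ 0 x) = a * ∫ x in (-1 : ℝ)..1, wt γ (bt γ) x * (GG γ p 0 x * dv φ 0 x)) :
    ∫ x in (-1 : ℝ)..1, wt γ (bt γ + 4) x * (dv Z 4 x * dv r 4 x) =
      a * ∫ x in (-1 : ℝ)..1, wt γ (bt γ + 4) x * (GG γ p 4 x * dv r 4 x) := by
  set ψ := Polynomial.derivative^[4] r with hψ
  have e : ∀ x, dv r 4 x = dv ψ 0 x := fun x => by rw [hψ, dv_iterate]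
  have deg : (Tp γ 0 (Tp γ 1 (Tp γ 2 (Tp γ 3 ψ)))).natDegree ≤ N := by
    have d4 := Polynomial.natDegree_iterate_derivative r 4
    have := natDegree_Tp_le γ 3 ψ
    have := natDegree_Tp_le γ 2 (Tp γ 3 ψ)
    have := natDegree_Tp_le γ 1 (Tp γ 2 (Tp γ 3 ψ))
    have := natDegree_Tp_le γ 0 (Tp γ 1 (Tp γ 2 (Tp γ 3 ψ)))
    rw [← hψ] at d4
    omega
  have h1 := iint_Tp4 hγ (u := dv Z) (fun k _ => (continuous_dv Z k).continuousOn)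
    (fun k _ x _ => hasDerivAt_dv Z k x) ψ
  have h2 := iint_Tp4 hγ (u := GG γ p) (continuousOn_GG γ h)
    (fun k hk x hx => hasDerivAt_GG γ h (Ioo_subset_Icc_self hx) k hk) ψ
  simp only [e]
  rw [← h1, ← h2]
  exact hw _ deg

/-- The part of the fourth derivative of the force that does not contain the principal term. -/
def gH (γ : ℝ) (p : Polynomial ℝ) (x : ℝ) : ℝ :=
  dv p 4 x + ddg γ x * gR' γ p x + (bt γ + 5) * (-2 * mu γ * x) * gR γ p x
    + (4 * bt γ + 10) * (-2 * mu γ) * gk γ p 3 x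

theorem continuousOn_gparts (γ : ℝ) {p : Polynomial ℝ} (h : NearId p) :
    ContinuousOn (gR γ p) (Icc (-1) 1) ∧ ContinuousOn (gR' γ p) (Icc (-1) 1) ∧
      ContinuousOn (gA γ p) (Icc (-1) 1) ∧ ContinuousOn (gA' γ p) (Icc (-1) 1) ∧
      ContinuousOn (gk γ p 3) (Icc (-1) 1) ∧ ContinuousOn (gH γ p) (Icc (-1) 1) := by
  have e := continuousOn_En γ h
  have f := fun k => (continuous_dv p k).continuousOn (s := Icc (-1 : ℝ) 1)
  have d := (continuous_ddg γ).continuousOn (s := Icc (-1 : ℝ) 1)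
  have cR : ContinuousOn (gR γ p) (Icc (-1) 1) := by unfold gR; fun_prop
  have cR' : ContinuousOn (gR' γ p) (Icc (-1) 1) := by unfold gR'; fun_prop
  have c3 : ContinuousOn (gk γ p 3) (Icc (-1) 1) := fun x hx =>
    (hasDerivAt_gk3 γ h hx).continuousAt.continuousWithinAt
  refine ⟨cR, cR', ?_, ?_, c3, ?_⟩
  · unfold gA; fun_prop
  · unfold gA'; fun_prop
  · unfold gH; fun_prop

theorem sum_sq_le_of_each {d X L : ℝ} {n : ℕ} (t : Fin n → ℝ) (h : ∀ i, d ^ 4 * t i ^ 2 ≤ L * X) :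
    d ^ 4 * (∑ i, t i) ^ 2 ≤ n * n * L * X := by
  have h1 := sq_sum_le_card_mul_sum_sq (s := Finset.univ) (f := t)
  have h2 : d ^ 4 * ((Finset.univ : Finset (Fin n)).card * ∑ i, t i ^ 2) ≤ n * (n * (L * X)) := by
    rw [Finset.card_univ, Fintype.card_fin, mul_left_comm]
    apply mul_le_mul_of_nonneg_left _ (Nat.cast_nonneg _)
    rw [Finset.mul_sum]
    calc ∑ i, d ^ 4 * t i ^ 2 ≤ ∑ _i : Fin n, L * X := Finset.sum_le_sum fun i _ => h i
      _ = n * (L * X) := by simp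
  nlinarith [mul_le_mul_of_nonneg_left h1 (by positivity : 0 ≤ d ^ 4)]

theorem gH_pointwise {d a b c e K K0 M B F : ℝ} (E : ℕ → ℝ) (hd0 : 0 ≤ d) (hd1 : d ≤ 1)
    (hK0 : 1 ≤ K0) (hM : 1 ≤ M) (h1 : d * a ^ 2 ≤ K) (h2 : d ^ 2 * a ^ 2 ≤ K0)
    (h3 : d ^ 3 * b ^ 2 ≤ K) (hE : ∀ k ≤ 5, E k ^ 2 ≤ M) (hB : B ^ 2 ≤ 36) (hF : F ^ 2 ≤ 144) :
    d ^ 4 * (c + d * (E 5 * a ^ 5 + 10 * E 4 * a ^ 3 * b + 15 * E 3 * a * b ^ 2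
      + 10 * E 3 * a ^ 2 * c + 10 * E 2 * b * c + 4 * E 2 * a * e)
      + B * (E 4 * a ^ 4 + 6 * E 3 * a ^ 2 * b + 3 * E 2 * b ^ 2 + 4 * E 2 * a * c)
      + F * (E 3 * a ^ 3 + 3 * E 2 * a * b + E 1 * c)) ^ 2 ≤
    14 * 14 * (1300 * M * K0 ^ 2) *
      (d ^ 4 * c ^ 2 + K * (K * a ^ 2 + d * b ^ 2 + d ^ 3 * c ^ 2 + d ^ 5 * e ^ 2)) := by
  have hK : 0 ≤ K := le_trans (by positivity) h1
  set X := d ^ 4 * c ^ 2 + K * (K * a ^ 2 + d * b ^ 2 + d ^ 3 * c ^ 2 + d ^ 5 * e ^ 2) with hX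
  have hKK : K0 ≤ K0 ^ 2 := by nlinarith
  have hKK1 : 1 ≤ K0 ^ 2 := by nlinarith
  have x1 : d ^ 4 * c ^ 2 ≤ X := by rw [hX]; exact le_add_of_nonneg_right (by positivity)
  have x2 : K ^ 2 * a ^ 2 ≤ X := by
    have : 0 ≤ d ^ 4 * c ^ 2 + K * (d * b ^ 2 + d ^ 3 * c ^ 2 + d ^ 5 * e ^ 2) := by positivity
    rw [hX]; linarith
  have x3 : K * (d * b ^ 2) ≤ X := by
    have : 0 ≤ d ^ 4 * c ^ 2 + K * (K * a ^ 2 + d ^ 3 * c ^ 2 + d ^ 5 * e ^ 2) := by positivity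
    rw [hX]; linarith
  have x4 : K * (d ^ 3 * c ^ 2) ≤ X := by
    have : 0 ≤ d ^ 4 * c ^ 2 + K * (K * a ^ 2 + d * b ^ 2 + d ^ 5 * e ^ 2) := by positivity
    rw [hX]; linarith
  have x5 : K * (d ^ 5 * e ^ 2) ≤ X := by
    have : 0 ≤ d ^ 4 * c ^ 2 + K * (K * a ^ 2 + d * b ^ 2 + d ^ 3 * c ^ 2) := by positivity
    rw [hX]; linarith
  have hX0 : 0 ≤ X := le_trans (by positivity) x1
  have up : ∀ {u Y κ : ℝ}, u ≤ κ * Y → Y ≤ X → 0 ≤ κ → κ ≤ K0 ^ 2 → u ≤ K0 ^ 2 * X :=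
    fun hu hY hκ hκ2 => hu.trans ((mul_le_mul_of_nonneg_left hY hκ).trans
      (mul_le_mul_of_nonneg_right hκ2 hX0))
  have m1 : d ^ 4 * (d * a ^ 5) ^ 2 ≤ K0 ^ 2 * X := by
    refine up (κ := K0 ^ 2) (Y := K ^ 2 * a ^ 2) ?_ x2 (by positivity) le_rfl
    calc d ^ 4 * (d * a ^ 5) ^ 2 = (d * a ^ 2) ^ 2 * (d ^ 2 * a ^ 2) ^ 2 * a ^ 2 := by ring
      _ ≤ K ^ 2 * K0 ^ 2 * a ^ 2 := by gcongr
      _ = _ := by ring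
  have m2 : d ^ 4 * (d * (a ^ 3 * b)) ^ 2 ≤ K0 ^ 2 * X := by
    refine up (κ := K0 ^ 2) (Y := K * (d * b ^ 2)) ?_ x3 (by positivity) le_rfl
    calc d ^ 4 * (d * (a ^ 3 * b)) ^ 2 = (d * a ^ 2) * (d ^ 2 * a ^ 2) ^ 2 * (d * b ^ 2) := by ring
      _ ≤ K * K0 ^ 2 * (d * b ^ 2) := by gcongr
      _ = _ := by ring
  have m3 : d ^ 4 * (d * (a * b ^ 2)) ^ 2 ≤ K0 ^ 2 * X := by
    refine up (κ := K0) (Y := K * (d * b ^ 2)) ?_ x3 (by positivity) hKK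
    calc d ^ 4 * (d * (a * b ^ 2)) ^ 2 = (d ^ 2 * a ^ 2) * (d ^ 3 * b ^ 2) * (d * b ^ 2) := by ring
      _ ≤ K0 * K * (d * b ^ 2) := by gcongr
      _ = _ := by ring
  have m4 : d ^ 4 * (d * (a ^ 2 * c)) ^ 2 ≤ K0 ^ 2 * X := by
    refine up (κ := K0) (Y := K * (d ^ 3 * c ^ 2)) ?_ x4 (by positivity) hKK
    calc d ^ 4 * (d * (a ^ 2 * c)) ^ 2 = (d * a ^ 2) * (d ^ 2 * a ^ 2) * (d ^ 3 * c ^ 2) := by ring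
      _ ≤ K * K0 * (d ^ 3 * c ^ 2) := by gcongr
      _ = _ := by ring
  have m5 : d ^ 4 * (d * (b * c)) ^ 2 ≤ K0 ^ 2 * X := by
    refine up (κ := 1) (Y := K * (d ^ 3 * c ^ 2)) ?_ x4 (by positivity) hKK1
    calc d ^ 4 * (d * (b * c)) ^ 2 = (d ^ 3 * b ^ 2) * (d ^ 3 * c ^ 2) := by ring
      _ ≤ K * (d ^ 3 * c ^ 2) := by gcongr
      _ = _ := by ring
  have m6 : d ^ 4 * (d * (a * e)) ^ 2 ≤ K0 ^ 2 * X := by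
    refine up (κ := 1) (Y := K * (d ^ 5 * e ^ 2)) ?_ x5 (by positivity) hKK1
    calc d ^ 4 * (d * (a * e)) ^ 2 = (d * a ^ 2) * (d ^ 5 * e ^ 2) := by ring
      _ ≤ K * (d ^ 5 * e ^ 2) := by gcongr
      _ = _ := by ring
  have m7 : d ^ 4 * (a ^ 4) ^ 2 ≤ K0 ^ 2 * X := by
    refine up (κ := K0) (Y := K ^ 2 * a ^ 2) ?_ x2 (by positivity) hKK
    calc d ^ 4 * (a ^ 4) ^ 2 = (d * a ^ 2) ^ 2 * (d ^ 2 * a ^ 2) * a ^ 2 := by ring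
      _ ≤ K ^ 2 * K0 * a ^ 2 := by gcongr
      _ = _ := by ring
  have m8 : d ^ 4 * (a ^ 2 * b) ^ 2 ≤ K0 ^ 2 * X := by
    refine up (κ := K0) (Y := K * (d * b ^ 2)) ?_ x3 (by positivity) hKK
    calc d ^ 4 * (a ^ 2 * b) ^ 2 = (d * a ^ 2) * (d ^ 2 * a ^ 2) * (d * b ^ 2) := by ring
      _ ≤ K * K0 * (d * b ^ 2) := by gcongr
      _ = _ := by ring
  have m9 : d ^ 4 * (b ^ 2) ^ 2 ≤ K0 ^ 2 * X := by
    refine up (κ := 1) (Y := K * (d * b ^ 2)) ?_ x3 (by positivity) hKK1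
    calc d ^ 4 * (b ^ 2) ^ 2 = (d ^ 3 * b ^ 2) * (d * b ^ 2) := by ring
      _ ≤ K * (d * b ^ 2) := by gcongr
      _ = _ := by ring
  have m10 : d ^ 4 * (a * c) ^ 2 ≤ K0 ^ 2 * X := by
    refine up (κ := 1) (Y := K * (d ^ 3 * c ^ 2)) ?_ x4 (by positivity) hKK1
    calc d ^ 4 * (a * c) ^ 2 = (d * a ^ 2) * (d ^ 3 * c ^ 2) := by ring
      _ ≤ K * (d ^ 3 * c ^ 2) := by gcongr
      _ = _ := by ring
  have m11 : d ^ 4 * (a ^ 3) ^ 2 ≤ K0 ^ 2 * X := by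
    refine up (κ := 1) (Y := K ^ 2 * a ^ 2) ?_ x2 (by positivity) hKK1
    calc d ^ 4 * (a ^ 3) ^ 2 = (d * a ^ 2) ^ 2 * d ^ 2 * a ^ 2 := by ring
      _ ≤ K ^ 2 * 1 ^ 2 * a ^ 2 := by gcongr
      _ = _ := by ring
  have m12 : d ^ 4 * (a * b) ^ 2 ≤ K0 ^ 2 * X := by
    refine up (κ := 1) (Y := K * (d * b ^ 2)) ?_ x3 (by positivity) hKK1
    calc d ^ 4 * (a * b) ^ 2 = (d * a ^ 2) * (d * b ^ 2) * d ^ 2 := by ring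
      _ ≤ K * (d * b ^ 2) * 1 ^ 2 := by gcongr
      _ = _ := by ring
  have m13 : d ^ 4 * c ^ 2 ≤ K0 ^ 2 * X := up (by rw [one_mul]) x1 zero_le_one hKK1
  have tm : ∀ {m k ε : ℝ}, d ^ 4 * m ^ 2 ≤ K0 ^ 2 * X → k ^ 2 ≤ 1300 → ε ^ 2 ≤ M →
      d ^ 4 * (k * ε * m) ^ 2 ≤ 1300 * M * K0 ^ 2 * X := by
    intro m k ε hm hk hε
    calc d ^ 4 * (k * ε * m) ^ 2 = k ^ 2 * ε ^ 2 * (d ^ 4 * m ^ 2) := by ring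
      _ ≤ 1300 * M * (K0 ^ 2 * X) := by gcongr
      _ = _ := by ring
  have key := sum_sq_le_of_each (d := d) (X := X) (L := 1300 * M * K0 ^ 2)
    ![1 * 1 * c, 1 * E 5 * (d * a ^ 5), 10 * E 4 * (d * (a ^ 3 * b)),
      15 * E 3 * (d * (a * b ^ 2)), 10 * E 3 * (d * (a ^ 2 * c)), 10 * E 2 * (d * (b * c)),
      4 * E 2 * (d * (a * e)), B * E 4 * a ^ 4, (6 * B) * E 3 * (a ^ 2 * b),
      (3 * B) * E 2 * b ^ 2, (4 * B) * E 2 * (a * c), F * E 3 * a ^ 3, (3 * F) * E 2 * (a * b),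
      F * E 1 * c] (by
    intro i
    have hM1 : (1 : ℝ) ^ 2 ≤ M := by linarith
    fin_cases i
    · exact tm m13 (by norm_num) hM1
    · exact tm m1 (by norm_num) (hE 5 (by norm_num))
    · exact tm m2 (by norm_num) (hE 4 (by norm_num))
    · exact tm m3 (by norm_num) (hE 3 (by norm_num))
    · exact tm m4 (by norm_num) (hE 3 (by norm_num))
    · exact tm m5 (by norm_num) (hE 2 (by norm_num))
    · exact tm m6 (by norm_num) (hE 2 (by norm_num))
    · exact tm m7 (by linarith) (hE 4 (by norm_num))
    · exact tm m8 (by linarith) (hE 3 (by norm_num))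
    · exact tm m9 (by linarith) (hE 2 (by norm_num))
    · exact tm m10 (by linarith) (hE 2 (by norm_num))
    · exact tm m11 (by linarith) (hE 3 (by norm_num))
    · exact tm m12 (by linarith) (hE 2 (by norm_num))
    · exact tm m13 (by linarith) (hE 1 (by norm_num)))
  refine le_of_eq_of_le ?_ key
  congr 2
  simp [Fin.sum_univ_succ]
  ring

theorem iint_gH_sq_le {γ : ℝ} (hγ : 3 < γ) : ∃ C ≥ (1 : ℝ), ∀ p, NearId p → S4 γ p ≤ 1 →
    ∫ x in (-1 : ℝ)..1, wt γ (bt γ + 4) x * gH γ p x ^ 2 ≤ C * (S4 γ p + S5 γ p ^ 2) := by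
  have hb := bt_pos hγ
  have hb2 := bt_lt_half hγ
  obtain ⟨K0, hS⟩ := exists_statBd hγ
  obtain ⟨M, hM, hE⟩ := En_sq_le hγ
  have hK0 := hS.one_le
  set L := 14 * 14 * (1300 * M * K0 ^ 2) with hL
  have hL0 : 1 ≤ L := by
    have : 1 ≤ K0 ^ 2 := one_le_pow₀ hK0
    rw [hL]; nlinarith
  refine ⟨L * (4 * K0 ^ 3), one_le_mul_of_one_le_of_one_le hL0 (by
    have := one_le_pow₀ hK0 (n := 3)
    linarith), fun p hp h1 => ?_⟩
  set K := K0 * S5 γ p with hK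
  have hS5 := S5_nonneg hγ p
  have hS4 := S4_nonneg hγ p
  have hKn : 0 ≤ K := by positivity
  have c0 : ∀ k, ContinuousOn (dv p k) (Icc (-1) 1) := fun k => (continuous_dv p k).continuousOn
  have w : ∀ n : ℕ, Continuous (wt γ (bt γ + n)) := fun n => continuous_wt γ (by positivity)
  have w0 : Continuous (wt γ (bt γ)) := continuous_wt γ hb.le
  have w1 : Continuous (wt γ (bt γ + 1)) := continuous_wt γ (by positivity)
  have w3 : Continuous (wt γ (bt γ + 3)) := continuous_wt γ (by positivity)
  have w4 : Continuous (wt γ (bt γ + 4)) := continuous_wt γ (by positivity)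
  have w5 : Continuous (wt γ (bt γ + 5)) := continuous_wt γ (by positivity)
  have cH := (continuousOn_gparts γ hp).2.2.2.2.2
  have step : ∫ x in (-1 : ℝ)..1, wt γ (bt γ + 4) x * gH γ p x ^ 2 ≤
      ∫ x in (-1 : ℝ)..1, L * (wt γ (bt γ + 4) x * dv p 4 x ^ 2
        + K * (K * (wt γ (bt γ) x * dv p 2 x ^ 2) + wt γ (bt γ + 1) x * dv p 3 x ^ 2
          + wt γ (bt γ + 3) x * dv p 4 x ^ 2 + wt γ (bt γ + 5) x * dv p 5 x ^ 2)) := by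
    apply iint_mono (by fun_prop) (by fun_prop)
    intro x hx
    have e := fun n => wt_add_nat hγ hb.le n hx
    have e1 := e 1
    have e3 := e 3
    have e4 := e 4
    have e5 := e 5
    push_cast at e1 e3 e4 e5
    rw [e1, e3, e4, e5]
    have hx1 := abs_le.2 hx
    have hm := mu_lt hγ
    have hm' := mu_gt hγ
    have hB : ((bt γ + 5) * (-2 * mu γ * x)) ^ 2 ≤ 36 := by
      have h1 : |(bt γ + 5) * (-2 * mu γ * x)| ≤ 6 := by
        rw [abs_mul, abs_mul, abs_of_pos (by linarith : 0 < bt γ + 5),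
          abs_of_neg (by linarith : -2 * mu γ < 0)]
        calc (bt γ + 5) * (-(-2 * mu γ) * |x|) ≤ 6 * (1 * 1) :=
              mul_le_mul (by linarith) (mul_le_mul (by linarith) hx1 (abs_nonneg _) zero_le_one)
                (mul_nonneg (by linarith) (abs_nonneg _)) (by norm_num)
          _ = 6 := by norm_num
      calc _ = |(bt γ + 5) * (-2 * mu γ * x)| ^ 2 := (sq_abs _).symm
        _ ≤ 6 ^ 2 := by gcongr
        _ = 36 := by norm_num
    have hF : ((4 * bt γ + 10) * (-2 * mu γ)) ^ 2 ≤ 144 := by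
      have h1 : |(4 * bt γ + 10) * (-2 * mu γ)| ≤ 12 := by
        rw [abs_mul, abs_of_pos (by linarith : 0 < 4 * bt γ + 10),
          abs_of_neg (by linarith : -2 * mu γ < 0)]
        calc (4 * bt γ + 10) * (-(-2 * mu γ)) ≤ 12 * 1 := by
              gcongr <;> linarith
          _ = 12 := by norm_num
      calc _ = |(4 * bt γ + 10) * (-2 * mu γ)| ^ 2 := (sq_abs _).symm
        _ ≤ 12 ^ 2 := by gcongr
        _ = 144 := by norm_num
    have key := gH_pointwise (a := dv p 2 x) (b := dv p 3 x) (c := dv p 4 x) (e := dv p 5 x)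
      (fun k => En γ p k x) (ddg_nonneg hγ hx) (ddg_le hγ) hK0 hM (hS.u2 p x hx)
      ((hS.s2 p x hx).trans (by nlinarith)) (hS.u3 p x hx) (fun k hk => hE p hp k hk x hx) hB hF
      (K := K)
    have := mul_le_mul_of_nonneg_left key (wt_nonneg hγ (bt γ) hx)
    refine le_of_eq_of_le ?_ (this.trans (le_of_eq ?_))
    · simp only [gH, gR, gR', gk]; ring
    · rw [hL]; ring
  refine step.trans ?_
  have split : ∫ x in (-1 : ℝ)..1, L * (wt γ (bt γ + 4) x * dv p 4 x ^ 2
        + K * (K * (wt γ (bt γ) x * dv p 2 x ^ 2) + wt γ (bt γ + 1) x * dv p 3 x ^ 2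
          + wt γ (bt γ + 3) x * dv p 4 x ^ 2 + wt γ (bt γ + 5) x * dv p 5 x ^ 2)) =
      L * (J γ (bt γ + 4) p 4 + K * (K * J γ (bt γ) p 2 + J γ (bt γ + 1) p 3
        + J γ (bt γ + 3) p 4 + J γ (bt γ + 5) p 5)) := by
    unfold J
    simp only [← intervalIntegral.integral_const_mul]
    rw [← intervalIntegral.integral_add (iintegrable (by fun_prop)) (iintegrable (by fun_prop)),
      ← intervalIntegral.integral_add (iintegrable (by fun_prop)) (iintegrable (by fun_prop)),
      ← intervalIntegral.integral_add (iintegrable (by fun_prop)) (iintegrable (by fun_prop)),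
      ← intervalIntegral.integral_const_mul,
      ← intervalIntegral.integral_add (iintegrable (by fun_prop)) (iintegrable (by fun_prop)),
      ← intervalIntegral.integral_const_mul]
  rw [split, mul_assoc L]
  apply mul_le_mul_of_nonneg_left _ (by linarith)
  have a1 : J γ (bt γ + 4) p 4 ≤ S4 γ p := by
    unfold S4; linarith [J_nonneg hγ (bt γ) p 0]
  have a2 : J γ (bt γ + 5) p 5 ≤ K := by
    have : J γ (bt γ + 5) p 5 ≤ S5 γ p := by unfold S5; linarith
    nlinarith
  have a3 : K * J γ (bt γ) p 2 ≤ K0 * K := by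
    have : J γ (bt γ) p 2 ≤ K0 := (hS.j2 p).trans (by nlinarith)
    nlinarith
  have a4 := hS.t3 p
  have a5 := hS.t4 p
  have : K * (K * J γ (bt γ) p 2 + J γ (bt γ + 1) p 3
        + J γ (bt γ + 3) p 4 + J γ (bt γ + 5) p 5) ≤ K * (K0 * K + K + K + K) := by gcongr
  have h4 : K0 * K + K + K + K ≤ 4 * K0 * K := by nlinarith
  have h5 : K * (K0 * K + K + K + K) ≤ K * (4 * K0 * K) := by gcongr
  have h6 : K * (4 * K0 * K) = 4 * K0 ^ 3 * S5 γ p ^ 2 := by rw [hK]; ring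
  have h7 : S4 γ p ≤ 4 * K0 ^ 3 * S4 γ p := by
    have := one_le_pow₀ hK0 (n := 3)
    nlinarith
  linarith


/-- The fourth order force paired with a test function, up to the principal part. -/
theorem top_remainder {γ : ℝ} (hγ : 3 < γ) : ∃ C ≥ (1 : ℝ), ∀ p r, NearId p → S4 γ p ≤ 1 →
    ((∫ x in (-1 : ℝ)..1, wt γ (bt γ + 4) x * (GG γ p 4 x * dv r 4 x))
      + ∫ x in (-1 : ℝ)..1, wt γ (bt γ + 5) x * (gA γ p x * dv r 5 x)) ^ 2 ≤
      C * S4 γ r * (S4 γ p + S5 γ p ^ 2) := by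
  have hb := bt_pos hγ
  obtain ⟨C, hC, hH⟩ := iint_gH_sq_le hγ
  refine ⟨C, hC, fun p r hp h1 => ?_⟩
  have w4 : Continuous (wt γ (bt γ + 4)) := continuous_wt γ (by positivity)
  have w5 : Continuous (wt γ (bt γ + 5)) := continuous_wt γ (by positivity)
  obtain ⟨cR, cR', cA, cA', c3, cH⟩ := continuousOn_gparts γ hp
  have c0' : ∀ k, ContinuousOn (dv r k) (Icc (-1) 1) := fun k => (continuous_dv r k).continuousOn
  have cd := (continuous_ddg γ).continuousOn (s := Icc (-1 : ℝ) 1)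
  have cG := continuousOn_GG γ hp 4 le_rfl
  have ibp := wt_ibp hγ (a := bt γ + 4) (by positivity) (U := fun x => gA γ p x * dv r 4 x)
    (U' := fun x => gA' γ p x * dv r 4 x + gA γ p x * dv r 5 x) (by fun_prop) (by fun_prop)
    fun x hx => (hasDerivAt_gA γ hp (Ioo_subset_Icc_self hx)).mul (hasDerivAt_dv r 4 x)
  have id : (∫ x in (-1 : ℝ)..1, wt γ (bt γ + 4) x * (GG γ p 4 x * dv r 4 x))
      + ∫ x in (-1 : ℝ)..1, wt γ (bt γ + 5) x * (gA γ p x * dv r 5 x) =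
      ∫ x in (-1 : ℝ)..1, wt γ (bt γ + 4) x * (gH γ p x * dv r 4 x) := by
    rw [← sub_eq_zero, ← ibp, ← intervalIntegral.integral_add (iintegrable (by fun_prop))
      (iintegrable (by fun_prop)), ← intervalIntegral.integral_sub (iintegrable (by fun_prop))
      (iintegrable (by fun_prop))]
    apply intervalIntegral.integral_congr
    intro x hx
    rw [uIcc_of_le (by norm_num)] at hx
    have e5 : wt γ (bt γ + 5) x = wt γ (bt γ + 4) x * ddg γ x := by
      have := wt_add_nat hγ (by positivity : 0 ≤ bt γ + 4) 1 hx
      rw [pow_one] at this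
      rw [← this]; congr 1; push_cast; ring
    simp only [e5, gH, GG]
    ring
  rw [id]
  refine (iint_cs w4.continuousOn cH (c0' 4) fun x hx => wt_nonneg hγ _ hx).trans ?_
  have hr : ∫ x in (-1 : ℝ)..1, wt γ (bt γ + 4) x * dv r 4 x ^ 2 ≤ S4 γ r := by
    have := J_nonneg hγ (bt γ) r 0
    unfold S4; change J γ (bt γ + 4) r 4 ≤ _; linarith
  have h0 := J_nonneg hγ (bt γ + 4) r 4
  refine (mul_le_mul (hH p hp h1) hr h0 ?_).trans (le_of_eq (by ring))
  have := S4_nonneg hγ p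
  positivity

theorem kappa_mu {γ : ℝ} (hγ : 3 < γ) : (bt γ + 1) * (-2 * mu γ) = -1 := by
  unfold bt mu
  have : γ - 1 ≠ 0 := by linarith
  have : γ ≠ 0 := by linarith
  field_simp
  ring

theorem abs_rpow_neg_sub_one_le {γ : ℝ} (hγ : 3 < γ) {q : ℝ} (h : |q - 1| ≤ 1 / 2) :
    |q ^ (-γ) - 1| ≤ γ * (1 / 2 : ℝ) ^ (-γ - 1) * |q - 1| := by
  have hq := abs_le.1 h
  have := (convex_Icc (1 / 2 : ℝ) (3 / 2)).norm_image_sub_le_of_norm_hasDerivWithin_le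
    (f := fun q : ℝ => q ^ (-γ)) (f' := fun q : ℝ => -γ * q ^ (-γ - 1))
    (C := γ * (1 / 2 : ℝ) ^ (-γ - 1)) (x := 1) (y := q)
    (fun x hx => (Real.hasDerivAt_rpow_const (Or.inl (by have := hx.1; linarith))).hasDerivWithinAt)
    (fun x hx => by
      have hx0 : 0 < x := by have := hx.1; linarith
      rw [Real.norm_eq_abs, abs_mul, abs_neg, abs_of_pos (by linarith : 0 < γ),
        abs_of_pos (Real.rpow_pos_of_pos hx0 _)]
      apply mul_le_mul_of_nonneg_left _ (by linarith)
      exact Real.rpow_le_rpow_of_nonpos (by norm_num) hx.1 (by linarith))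
    (by constructor <;> norm_num) ⟨by linarith, by linarith⟩
  simpa using this

theorem GG_zero_eq {γ : ℝ} (hγ : 3 < γ) (p : Polynomial ℝ) (x : ℝ) :
    GG γ p 0 x = dv p 0 x + ddg γ x * (En γ p 1 x * dv p 2 x) - x * (qq p x ^ (-γ) - 1) := by
  have := kappa_mu hγ
  simp only [GG, gk]
  have e : En γ p 0 x = qq p x ^ (-γ) := by simp [En]
  rw [e]
  linear_combination (x * qq p x ^ (-γ)) * this

theorem GG_zero_sq_le {γ : ℝ} (hγ : 3 < γ) : ∃ C ≥ (1 : ℝ), ∀ p, NearId p →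
    ∀ x ∈ Icc (-1 : ℝ) 1, GG γ p 0 x ^ 2 ≤ C * S4 γ p := by
  obtain ⟨K, hS⟩ := exists_statBd hγ
  obtain ⟨M, hM, hE⟩ := En_sq_le hγ
  set L := γ * (1 / 2 : ℝ) ^ (-γ - 1)
  have hK := hS.one_le
  have hMK : 0 ≤ M * K + L ^ 2 * K := by positivity
  refine ⟨3 * (K + M * K + L ^ 2 * K), by linarith, fun p hp x hx => ?_⟩
  have h0 := hS.s0 p x hx
  have h1 := hS.s1 p x hx
  have h2 := hS.s2 p x hx
  have hq : |qq p x ^ (-γ) - 1| ≤ L * |dv p 1 x| := by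
    have := abs_rpow_neg_sub_one_le hγ (q := qq p x) (by simpa [qq] using hp x hx)
    rwa [show qq p x - 1 = dv p 1 x by unfold qq; ring] at this
  have hx2 : x ^ 2 ≤ 1 := by nlinarith [hx.1, hx.2]
  have a1 : (ddg γ x * (En γ p 1 x * dv p 2 x)) ^ 2 ≤ M * (K * S4 γ p) := by
    calc _ = En γ p 1 x ^ 2 * (ddg γ x ^ 2 * dv p 2 x ^ 2) := by ring
      _ ≤ _ := by
        have := hE p hp 1 (by norm_num) x hx
        gcongr
  have a2 : (x * (qq p x ^ (-γ) - 1)) ^ 2 ≤ L ^ 2 * (K * S4 γ p) := by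
    have : (qq p x ^ (-γ) - 1) ^ 2 ≤ (L * |dv p 1 x|) ^ 2 := by
      rw [← sq_abs]; gcongr
    rw [mul_pow, sq_abs] at this
    calc _ = x ^ 2 * (qq p x ^ (-γ) - 1) ^ 2 := by ring
      _ ≤ 1 * (L ^ 2 * dv p 1 x ^ 2) := by gcongr
      _ ≤ _ := by rw [one_mul]; gcongr
  rw [GG_zero_eq hγ]
  set A := ddg γ x * (En γ p 1 x * dv p 2 x)
  set B := x * (qq p x ^ (-γ) - 1)
  nlinarith [sq_nonneg (dv p 0 x - A), sq_nonneg (dv p 0 x + B), sq_nonneg (A + B)]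

/-- The nonlinear remainder paired with a test function. -/
theorem low_remainder {γ : ℝ} (hγ : 3 < γ) : ∃ C ≥ (1 : ℝ), ∀ p r, NearId p →
    (∫ x in (-1 : ℝ)..1, wt γ (bt γ) x * (GG γ p 0 x * dv r 0 x)) ^ 2 ≤
      C * S4 γ r * S4 γ p := by
  have hb := bt_pos hγ
  obtain ⟨C, hC, h⟩ := GG_zero_sq_le hγ
  refine ⟨2 * C, by linarith, fun p r hp => ?_⟩
  have w0 : Continuous (wt γ (bt γ)) := continuous_wt γ hb.le
  have cG := continuousOn_GG γ hp 0 (by norm_num)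
  refine (iint_cs w0.continuousOn cG (continuous_dv r 0).continuousOn
    fun x hx => wt_nonneg hγ _ hx).trans ?_
  have h0 := S4_nonneg hγ p
  have h1 : ∫ x in (-1 : ℝ)..1, wt γ (bt γ) x * GG γ p 0 x ^ 2 ≤ 2 * C * S4 γ p := by
    have : ∫ x in (-1 : ℝ)..1, wt γ (bt γ) x * GG γ p 0 x ^ 2 ≤
        ∫ x in (-1 : ℝ)..1, C * S4 γ p := by
      apply iint_mono (by fun_prop) (by fun_prop)
      intro x hx
      calc _ ≤ 1 * (C * S4 γ p) := mul_le_mul (wt_le_one hγ hb.le hx) (h p hp x hx)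
            (sq_nonneg _) zero_le_one
        _ = _ := one_mul _
    refine this.trans (le_of_eq ?_)
    rw [intervalIntegral.integral_const, smul_eq_mul]; ring
  have h2 : ∫ x in (-1 : ℝ)..1, wt γ (bt γ) x * dv r 0 x ^ 2 ≤ S4 γ r := by
    have := J_nonneg hγ (bt γ + 4) r 4
    unfold S4; change J γ (bt γ) r 0 ≤ _; linarith
  calc _ ≤ (2 * C * S4 γ p) * S4 γ r := mul_le_mul h1 h2 (J_nonneg hγ (bt γ) r 0) (by positivity)
    _ = _ := by ring

/-- The weighted inner product of two polynomials. -/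
def ip (γ : ℝ) (p r : Polynomial ℝ) : ℝ :=
  ∫ x in (-1 : ℝ)..1, wt γ (bt γ) x * (dv p 0 x * dv r 0 x)

theorem dv_add (p r : Polynomial ℝ) (k : ℕ) (x : ℝ) : dv (p + r) k x = dv p k x + dv r k x := by
  simp [dv]

theorem dv_smul (c : ℝ) (p : Polynomial ℝ) (k : ℕ) (x : ℝ) : dv (c • p) k x = c * dv p k x := by
  simp [dv]

theorem dv_sum {ι : Type*} (s : Finset ι) (p : ι → Polynomial ℝ) (k : ℕ) (x : ℝ) :
    dv (∑ i ∈ s, p i) k x = ∑ i ∈ s, dv (p i) k x := by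
  simp [dv, Polynomial.iterate_derivative_sum, Polynomial.eval_finsetSum]

theorem ip_comm (γ : ℝ) (p r : Polynomial ℝ) : ip γ p r = ip γ r p := by
  unfold ip; congr 1; ext x; ring

theorem ip_integrable {γ : ℝ} (hγ : 3 < γ) (p r : Polynomial ℝ) :
    IntervalIntegrable (fun x => wt γ (bt γ) x * (dv p 0 x * dv r 0 x)) volume (-1) 1 := by
  have w0 := continuous_wt γ (bt_pos hγ).le
  exact iintegrable (by fun_prop)

theorem ip_add {γ : ℝ} (hγ : 3 < γ) (p q r : Polynomial ℝ) :
    ip γ (p + q) r = ip γ p r + ip γ q r := by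
  unfold ip
  rw [← intervalIntegral.integral_add (ip_integrable hγ _ _) (ip_integrable hγ _ _)]
  congr 1; ext x; rw [dv_add]; ring

theorem ip_smul (γ c : ℝ) (p r : Polynomial ℝ) : ip γ (c • p) r = c * ip γ p r := by
  unfold ip
  rw [← intervalIntegral.integral_const_mul]
  congr 1; ext x; rw [dv_smul]; ring

theorem ip_self (γ : ℝ) (p : Polynomial ℝ) : ip γ p p = J γ (bt γ) p 0 := by
  unfold ip J; congr 1; ext x; ring

theorem eq_zero_of_ip_self {γ : ℝ} (hγ : 3 < γ) {p : Polynomial ℝ} (h : ip γ p p = 0) : p = 0 := by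
  have w0 := continuous_wt γ (bt_pos hγ).le
  have hz : ∀ x ∈ Ioo (-1 : ℝ) 1, p.eval x = 0 := by
    intro x hx
    by_contra hne
    have hpos : 0 < ∫ y in (-1 : ℝ)..1, wt γ (bt γ) y * (dv p 0 y * dv p 0 y) := by
      apply intervalIntegral.integral_pos (by norm_num) (by fun_prop)
      · exact fun y hy => mul_nonneg (wt_nonneg hγ _ (Ioc_subset_Icc_self hy)) (mul_self_nonneg _)
      · exact ⟨x, Ioo_subset_Icc_self hx, mul_pos (wt_pos hγ _ hx) (mul_self_pos.2 hne)⟩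
    exact hpos.ne' h
  exact Polynomial.eq_zero_of_infinite_isRoot p
    ((Ioo_infinite (by norm_num : (-1 : ℝ) < 1)).mono hz)

/-- Orthonormal bases of the polynomials of degree at most `N`. -/
theorem exists_onb {γ : ℝ} (hγ : 3 < γ) (N : ℕ) : ∃ (n : ℕ) (e : Fin n → Polynomial ℝ),
    (∀ i, (e i).natDegree ≤ N) ∧ (∀ i j, ip γ (e i) (e j) = if i = j then 1 else 0) ∧
    ∀ φ : Polynomial ℝ, φ.natDegree ≤ N → φ = ∑ i, ip γ (e i) φ • e i := by
  let V := Polynomial.degreeLT ℝ (N + 1)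
  have : FiniteDimensional ℝ V := Module.Finite.equiv (Polynomial.degreeLTEquiv ℝ (N + 1)).symm
  let core : InnerProductSpace.Core ℝ V :=
    { inner := fun p r => ip γ p r
      conj_inner_symm := fun p r => ip_comm γ _ _
      re_inner_nonneg := fun p => by
        change 0 ≤ ip γ p p
        rw [ip_self]; exact J_nonneg hγ _ _ _
      add_left := fun p q r => ip_add hγ _ _ _
      smul_left := fun p r c => ip_smul γ _ _ _
      definite := fun p h => Subtype.ext (eq_zero_of_ip_self hγ h) }
  let _ : NormedAddCommGroup V := core.toNormedAddCommGroup
  let _ : InnerProductSpace ℝ V := InnerProductSpace.ofCore core.toCore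
  let b := stdOrthonormalBasis ℝ V
  refine ⟨Module.finrank ℝ V, fun i => b i, fun i => ?_, fun i j => ?_, fun φ hφ => ?_⟩
  · have h : (b i : Polynomial ℝ) ∈ Polynomial.degreeLE ℝ N :=
      Polynomial.degreeLT_succ_eq_degreeLE (R := ℝ) ▸ (b i).2
    exact Polynomial.natDegree_le_iff_degree_le.2 (Polynomial.mem_degreeLE.1 h)
  · exact (orthonormal_iff_ite.1 b.orthonormal) i j
  · have hm : φ ∈ V := Polynomial.mem_degreeLT.2
      ((Polynomial.natDegree_le_iff_degree_le.1 hφ).trans_lt (by exact_mod_cast Nat.lt_succ_self N))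
    have := congrArg Subtype.val (b.sum_repr' ⟨φ, hm⟩)
    simp only [Submodule.coe_sum, Submodule.coe_smul] at this
    exact this.symm

/-- The polynomial with coordinates `a` in the family `e`. -/
def pol {n : ℕ} (e : Fin n → Polynomial ℝ) (a : Fin n → ℝ) : Polynomial ℝ := ∑ i, a i • e i

theorem dv_pol {n : ℕ} (e : Fin n → Polynomial ℝ) (a : Fin n → ℝ) (k : ℕ) (x : ℝ) :
    dv (pol e a) k x = ∑ i, a i * dv (e i) k x := by
  simp only [pol, dv_sum, dv_smul]

theorem continuous_dv_pol {n : ℕ} (e : Fin n → Polynomial ℝ) (k : ℕ) :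
    Continuous fun p : (Fin n → ℝ) × ℝ => dv (pol e p.1) k p.2 := by
  simp only [dv_pol]
  refine continuous_finsetSum _ fun i _ => ?_
  have := continuous_dv (e i) k
  fun_prop

theorem pol_sub {n : ℕ} (e : Fin n → Polynomial ℝ) (a b : Fin n → ℝ) (k : ℕ) (x : ℝ) :
    dv (pol e (a - b)) k x = dv (pol e a) k x - dv (pol e b) k x := by
  simp only [dv_pol, ← Finset.sum_sub_distrib, Pi.sub_apply, sub_mul]

theorem exists_abs_dv_pol_le {n : ℕ} (e : Fin n → Polynomial ℝ) (k : ℕ) : ∃ L ≥ (0 : ℝ),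
    ∀ a, ∀ x ∈ Icc (-1 : ℝ) 1, |dv (pol e a) k x| ≤ L * ‖a‖ := by
  have hex : ∀ i, ∃ C ≥ (0 : ℝ), ∀ x ∈ Icc (-1 : ℝ) 1, |dv (e i) k x| ≤ C := fun i => by
    obtain ⟨C, hC⟩ := isCompact_Icc.exists_bound_of_continuousOn
      (continuous_dv (e i) k).continuousOn (s := Icc (-1 : ℝ) 1)
    exact ⟨|C|, abs_nonneg _, fun x hx => (hC x hx).trans (le_abs_self _)⟩
  choose C hC0 hC using hex
  refine ⟨∑ i, C i, Finset.sum_nonneg fun i _ => hC0 i, fun a x hx => ?_⟩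
  rw [dv_pol, Finset.sum_mul]
  refine (Finset.abs_sum_le_sum_abs _ _).trans (Finset.sum_le_sum fun i _ => ?_)
  rw [abs_mul, mul_comm]
  exact mul_le_mul (hC i x hx) (norm_le_pi_norm a i) (abs_nonneg _) (hC0 i)

/-- Truncation to `[1/2, 3/2]`. -/
def cq (q : ℝ) : ℝ := max (1 / 2) (min (3 / 2) q)

theorem cq_mem (q : ℝ) : cq q ∈ Icc (1 / 2 : ℝ) (3 / 2) :=
  ⟨le_max_left _ _, max_le (by norm_num) (min_le_left _ _)⟩

theorem cq_eq {q : ℝ} (h : |q - 1| ≤ 1 / 2) : cq q = q := by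
  have := abs_le.1 h
  rw [cq, min_eq_right (by linarith), max_eq_right (by linarith)]

theorem continuous_cq : Continuous cq := by unfold cq; fun_prop

theorem abs_cq_sub_le (q r : ℝ) : |cq q - cq r| ≤ |q - r| := by
  unfold cq
  rw [max_comm, max_comm (1 / 2) (min (3 / 2) r)]
  refine (abs_max_sub_max_le_abs _ _ _).trans ?_
  rw [min_comm _ q, min_comm _ r]
  simpa using abs_min_sub_min_le_max q (3 / 2) r (3 / 2)

theorem continuous_cq_rpow (a : ℝ) : Continuous fun q => cq q ^ a :=
  continuous_cq.rpow_const fun q => Or.inl (by have := (cq_mem q).1; linarith)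

theorem abs_cq_rpow_sub_le {γ : ℝ} (hγ : 3 < γ) (q r : ℝ) :
    |cq q ^ (-γ) - cq r ^ (-γ)| ≤ γ * (1 / 2 : ℝ) ^ (-γ - 1) * |q - r| := by
  have := (convex_Icc (1 / 2 : ℝ) (3 / 2)).norm_image_sub_le_of_norm_hasDerivWithin_le
    (f := fun q : ℝ => q ^ (-γ)) (f' := fun q : ℝ => -γ * q ^ (-γ - 1))
    (C := γ * (1 / 2 : ℝ) ^ (-γ - 1)) (x := cq r) (y := cq q)
    (fun x hx => (Real.hasDerivAt_rpow_const (Or.inl (by have := hx.1; linarith))).hasDerivWithinAt)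
    (fun x hx => by
      have hx0 : 0 < x := by have := hx.1; linarith
      rw [Real.norm_eq_abs, abs_mul, abs_neg, abs_of_pos (by linarith : 0 < γ),
        abs_of_pos (Real.rpow_pos_of_pos hx0 _)]
      apply mul_le_mul_of_nonneg_left _ (by linarith)
      exact Real.rpow_le_rpow_of_nonpos (by norm_num) hx.1 (by linarith))
    (cq_mem r) (cq_mem q)
  refine this.trans (mul_le_mul_of_nonneg_left (abs_cq_sub_le q r) ?_)
  have : 0 < (1 / 2 : ℝ) ^ (-γ - 1) := Real.rpow_pos_of_pos (by norm_num) _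
  nlinarith

/-- The weak form of the force, with the flow map truncated. -/
def FW (γ : ℝ) (p φ : Polynomial ℝ) : ℝ :=
  ∫ x in (-1 : ℝ)..1, (wt γ (bt γ) x * ((dv p 0 x + x) * dv φ 0 x)
    - wt γ (bt γ + 1) x * (cq (qq p x) ^ (-γ) * dv φ 1 x))

theorem FW_eq {γ : ℝ} (hγ : 3 < γ) {p : Polynomial ℝ} (h : NearId p) (φ : Polynomial ℝ) :
    FW γ p φ = ∫ x in (-1 : ℝ)..1, wt γ (bt γ) x * (GG γ p 0 x * dv φ 0 x) := by
  have hb := bt_pos hγ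
  have w0 : Continuous (wt γ (bt γ)) := continuous_wt γ hb.le
  have w1 : Continuous (wt γ (bt γ + 1)) := continuous_wt γ (by positivity)
  have cG := continuousOn_GG γ h 0 (by norm_num)
  have c0 := continuousOn_En γ h 0
  have c1 := continuousOn_En γ h 1
  have cd := (continuous_ddg γ).continuousOn (s := Icc (-1 : ℝ) 1)
  have c' : ∀ k, ContinuousOn (dv φ k) (Icc (-1) 1) := fun k => (continuous_dv φ k).continuousOn
  have p' : ∀ k, ContinuousOn (dv p k) (Icc (-1) 1) := fun k => (continuous_dv p k).continuousOn
  have ibp := wt_ibp hγ (a := bt γ) hb.le (U := fun x => gk γ p 0 x * dv φ 0 x)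
    (U' := fun x => gk γ p 1 x * dv φ 0 x + gk γ p 0 x * dv φ 1 x)
    (by simp only [gk]; fun_prop) (by simp only [gk]; fun_prop)
    fun x hx => (hasDerivAt_gk0 γ h (Ioo_subset_Icc_self hx)).mul (hasDerivAt_dv φ 0 x)
  rw [← add_zero (FW γ p φ), ← ibp, FW]
  have cc : Continuous fun x => cq (qq p x) ^ (-γ) :=
    (continuous_cq_rpow (-γ)).comp (continuous_const.add (continuous_dv p 1))
  rw [← intervalIntegral.integral_add (iintegrable (by fun_prop))
    (iintegrable (by simp only [gk]; fun_prop))]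
  apply intervalIntegral.integral_congr
  intro x hx
  rw [uIcc_of_le (by norm_num)] at hx
  have e1 : wt γ (bt γ + 1) x = wt γ (bt γ) x * ddg γ x := by
    have := wt_add_nat hγ hb.le 1 hx
    rwa [pow_one, Nat.cast_one] at this
  have e2 : cq (qq p x) ^ (-γ) = En γ p 0 x := by
    rw [cq_eq (by simpa [qq] using h x hx)]; simp [En]
  simp only [e1, e2, GG, gk]
  ring

theorem exists_FW_lipschitz {γ : ℝ} (hγ : 3 < γ) {n : ℕ} (e : Fin n → Polynomial ℝ)
    (φ : Polynomial ℝ) : ∃ L ≥ (0 : ℝ), ∀ a b,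
      |FW γ (pol e a) φ - FW γ (pol e b) φ| ≤ L * ‖a - b‖ := by
  have hb := bt_pos hγ
  have w0 : Continuous (wt γ (bt γ)) := continuous_wt γ hb.le
  have w1 : Continuous (wt γ (bt γ + 1)) := continuous_wt γ (by positivity)
  obtain ⟨L0, hL0, h0⟩ := exists_abs_dv_pol_le e 0
  obtain ⟨L1, hL1, h1⟩ := exists_abs_dv_pol_le e 1
  obtain ⟨C0, hC0⟩ := isCompact_Icc.exists_bound_of_continuousOn
      (continuous_dv φ 0).continuousOn (s := Icc (-1 : ℝ) 1)
  obtain ⟨C1, hC1⟩ := isCompact_Icc.exists_bound_of_continuousOn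
      (continuous_dv φ 1).continuousOn (s := Icc (-1 : ℝ) 1)
  set L := γ * (1 / 2 : ℝ) ^ (-γ - 1)
  have hL : 0 ≤ L := by
    have : 0 < (1 / 2 : ℝ) ^ (-γ - 1) := Real.rpow_pos_of_pos (by norm_num) _
    exact mul_nonneg (by linarith) this.le
  have hC0' := (norm_nonneg _).trans (hC0 0 (by norm_num))
  have hC1' := (norm_nonneg _).trans (hC1 0 (by norm_num))
  refine ⟨2 * (L0 * C0 + L * L1 * C1), by positivity, fun a b => ?_⟩
  have cc : ∀ a, Continuous fun x => cq (qq (pol e a) x) ^ (-γ) := fun a =>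
    (continuous_cq_rpow (-γ)).comp (continuous_const.add (continuous_dv (pol e a) 1))
  have ca := cc a
  have cb := cc b
  unfold FW
  rw [← intervalIntegral.integral_sub (iintegrable (by fun_prop)) (iintegrable (by fun_prop)),
    ← Real.norm_eq_abs]
  refine (intervalIntegral.norm_integral_le_of_norm_le_const
    (C := (L0 * C0 + L * L1 * C1) * ‖a - b‖) fun x hx => ?_).trans (le_of_eq ?_)
  · rw [uIoc_of_le (by norm_num)] at hx
    replace hx := Ioc_subset_Icc_self hx
    have d0 := h0 (a - b) x hx
    have d1 := h1 (a - b) x hx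
    rw [pol_sub] at d0 d1
    have d2 := abs_cq_rpow_sub_le hγ (qq (pol e a) x) (qq (pol e b) x)
    rw [show qq (pol e a) x - qq (pol e b) x = dv (pol e a) 1 x - dv (pol e b) 1 x by
      unfold qq; ring] at d2
    have d3 := d2.trans (mul_le_mul_of_nonneg_left d1 hL)
    have hw0 := wt_le_one hγ hb.le hx
    have hw1 := wt_le_one hγ (by positivity : 0 ≤ bt γ + 1) hx
    have hw0' := wt_nonneg hγ (bt γ) hx
    have hw1' := wt_nonneg hγ (bt γ + 1) hx
    rw [Real.norm_eq_abs]
    set A := dv (pol e a) 0 x - dv (pol e b) 0 x with hA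
    set B := cq (qq (pol e a) x) ^ (-γ) - cq (qq (pol e b) x) ^ (-γ) with hB
    have e0 : wt γ (bt γ) x * ((dv (pol e a) 0 x + x) * dv φ 0 x)
      - wt γ (bt γ + 1) x * (cq (qq (pol e a) x) ^ (-γ) * dv φ 1 x)
      - (wt γ (bt γ) x * ((dv (pol e b) 0 x + x) * dv φ 0 x)
      - wt γ (bt γ + 1) x * (cq (qq (pol e b) x) ^ (-γ) * dv φ 1 x)) =
      wt γ (bt γ) x * (A * dv φ 0 x) - wt γ (bt γ + 1) x * (B * dv φ 1 x) := by
      rw [hA, hB]; ring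
    rw [e0]
    refine (abs_sub _ _).trans ?_
    rw [abs_mul, abs_mul, abs_mul, abs_mul, abs_of_nonneg hw0', abs_of_nonneg hw1']
    have f0 := hC0 x hx
    have f1 := hC1 x hx
    rw [Real.norm_eq_abs] at f0 f1
    calc _ ≤ 1 * ((L0 * ‖a - b‖) * C0) + 1 * ((L * (L1 * ‖a - b‖)) * C1) := by
          gcongr
      _ = _ := by ring
  · norm_num; ring

/-- Truncation of the coordinates to `[-1, 1]`. -/
def cl {n : ℕ} (a : Fin n → ℝ) : Fin n → ℝ := fun i => max (-1) (min 1 (a i))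

theorem cl_eq {n : ℕ} {a : Fin n → ℝ} (h : ∀ i, |a i| ≤ 1) : cl a = a := by
  ext i
  have := abs_le.1 (h i)
  rw [cl, min_eq_right (by linarith), max_eq_right (by linarith)]

theorem norm_cl_le {n : ℕ} (a : Fin n → ℝ) : ‖cl a‖ ≤ 1 := by
  rw [pi_norm_le_iff_of_nonneg zero_le_one]
  intro i
  rw [Real.norm_eq_abs, abs_le]
  exact ⟨le_max_left _ _, max_le (by norm_num) (min_le_left _ _)⟩

theorem norm_cl_sub_le {n : ℕ} (a b : Fin n → ℝ) : ‖cl a - cl b‖ ≤ ‖a - b‖ := by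
  rw [pi_norm_le_iff_of_nonneg (norm_nonneg _)]
  intro i
  refine le_trans ?_ (norm_le_pi_norm (a - b) i)
  rw [Pi.sub_apply, Real.norm_eq_abs, cl, cl, max_comm, max_comm (-1) (min 1 (b i))]
  refine (abs_max_sub_max_le_abs _ _ _).trans ?_
  rw [min_comm _ (a i), min_comm _ (b i)]
  simpa using abs_min_sub_min_le_max (a i) 1 (b i) 1

/-- The truncated Galerkin system. -/
theorem exists_galerkin_ode {γ : ℝ} (hγ : 3 < γ) {n : ℕ} (e : Fin n → Polynomial ℝ)
    {c₁ c₂ : ℝ → ℝ} {T : ℝ} (hT : 0 ≤ T) (h₁ : ContinuousOn c₁ (Icc 0 T))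
    (h₂ : ContinuousOn c₂ (Icc 0 T)) (a₀ b₀ : Fin n → ℝ) :
    ∃ a b : ℝ → Fin n → ℝ, a 0 = a₀ ∧ b 0 = b₀ ∧ ∀ t ∈ Icc 0 T,
      HasDerivWithinAt a (c₁ t • cl (b t)) (Icc 0 T) t ∧
      HasDerivWithinAt b (fun i => c₂ t * FW γ (pol e (cl (a t))) (e i)) (Icc 0 T) t := by
  obtain ⟨M₁, hM₁⟩ := isCompact_Icc.exists_bound_of_continuousOn h₁
  obtain ⟨M₂, hM₂⟩ := isCompact_Icc.exists_bound_of_continuousOn h₂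
  choose L hL0 hL using fun i => exists_FW_lipschitz hγ e (e i)
  set Λ := ∑ i, (L i + |FW γ (pol e 0) (e i)|) with hΛ
  have hle : ∀ i, L i + |FW γ (pol e 0) (e i)| ≤ Λ := fun i =>
    Finset.single_le_sum (f := fun i => L i + |FW γ (pol e 0) (e i)|)
      (fun j _ => add_nonneg (hL0 j) (abs_nonneg _)) (Finset.mem_univ i)
  have hΛ0 : 0 ≤ Λ := Finset.sum_nonneg fun j _ => add_nonneg (hL0 j) (abs_nonneg _)
  have hF : ∀ a i, |FW γ (pol e (cl a)) (e i)| ≤ Λ := fun a i => by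
    have h1 := hL i (cl a) 0
    have h2 := mul_le_mul_of_nonneg_left (norm_cl_le a) (hL0 i)
    rw [sub_zero] at h1
    have h3 := abs_sub_abs_le_abs_sub (FW γ (pol e (cl a)) (e i)) (FW γ (pol e 0) (e i))
    linarith [hle i]
  have hM₁' := (norm_nonneg _).trans (hM₁ 0 ⟨le_rfl, hT⟩)
  have hM₂' := (norm_nonneg _).trans (hM₂ 0 ⟨le_rfl, hT⟩)
  set K : NNReal := ⟨M₁ + M₂ * Λ, by positivity⟩
  have hK : (K : ℝ) = M₁ + M₂ * Λ := rfl
  set V : ℝ → (Fin n → ℝ) × (Fin n → ℝ) → (Fin n → ℝ) × (Fin n → ℝ) := fun t y =>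
    (c₁ t • cl y.2, fun i => c₂ t * FW γ (pol e (cl y.1)) (e i)) with hV
  have hPL : IsPicardLindelof V (⟨0, le_rfl, hT⟩ : Icc (0 : ℝ) T) (a₀, b₀)
      (K * ⟨T, hT⟩) 0 K K := by
    refine ⟨fun t ht => ?_, fun y _ => ?_, fun t ht y _ => ?_, ?_⟩
    · refine LipschitzOnWith.of_dist_le_mul fun y _ y' _ => ?_
      rw [dist_eq_norm, dist_eq_norm, hK]
      have n1 : ‖y.1 - y'.1‖ ≤ ‖y - y'‖ := norm_fst_le (y - y')
      have n2 : ‖y.2 - y'.2‖ ≤ ‖y - y'‖ := norm_snd_le (y - y')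
      have hn := norm_nonneg (y - y')
      refine norm_prod_le_iff.2 ⟨?_, ?_⟩
      · change ‖c₁ t • cl y.2 - c₁ t • cl y'.2‖ ≤ _
        rw [← smul_sub, norm_smul]
        calc _ ≤ M₁ * ‖y - y'‖ := by
              gcongr
              · exact hM₁ t ht
              · exact (norm_cl_sub_le _ _).trans n2
          _ ≤ _ := by
            have : 0 ≤ M₂ * Λ := by positivity
            gcongr; linarith
      · rw [pi_norm_le_iff_of_nonneg (by positivity)]
        intro i
        change ‖c₂ t * FW γ (pol e (cl y.1)) (e i) - c₂ t * FW γ (pol e (cl y'.1)) (e i)‖ ≤ _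
        rw [← mul_sub, norm_mul]
        have hLi : L i ≤ Λ := by linarith [hle i, abs_nonneg (FW γ (pol e 0) (e i))]
        calc _ ≤ M₂ * (Λ * ‖y - y'‖) := by
              gcongr
              · exact hM₂ t ht
              · refine (hL i _ _).trans ?_
                gcongr
                exact (norm_cl_sub_le _ _).trans n1
          _ ≤ _ := by
            rw [← mul_assoc]
            gcongr; linarith
    · simp only [hV]
      fun_prop
    · rw [hK]
      refine norm_prod_le_iff.2 ⟨?_, ?_⟩
      · change ‖c₁ t • cl y.2‖ ≤ _
        rw [norm_smul]
        calc _ ≤ M₁ * 1 := by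
              gcongr
              · exact hM₁ t ht
              · exact norm_cl_le _
          _ ≤ _ := by
            have : 0 ≤ M₂ * Λ := by positivity
            linarith
      · rw [pi_norm_le_iff_of_nonneg (by positivity)]
        intro i
        change ‖c₂ t * FW γ (pol e (cl y.1)) (e i)‖ ≤ _
        rw [norm_mul]
        calc _ ≤ M₂ * Λ := by
              gcongr
              · exact hM₂ t ht
              · exact hF _ _
          _ ≤ _ := by linarith
    · simp only [sub_zero, sub_self, max_eq_left hT, NNReal.coe_zero]
      exact (NNReal.coe_mul K ⟨T, hT⟩).ge
  obtain ⟨y, hy0, hy⟩ := hPL.exists_eq_forall_mem_Icc_hasDerivWithinAt₀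
  refine ⟨fun t => (y t).1, fun t => (y t).2, congrArg Prod.fst hy0, congrArg Prod.snd hy0,
    fun t ht => ⟨(hy t ht).fst, (hy t ht).snd⟩⟩

/-- The top order energy. -/
def E5 (γ : ℝ) (p : Polynomial ℝ) : ℝ :=
  ∫ x in (-1 : ℝ)..1, wt γ (bt γ + 5) x * (cq (qq p x) ^ (-γ - 1) * dv p 5 x ^ 2)

/-- The derivative of `E5` at `p` in the direction `z`. -/
def E5' (γ : ℝ) (p z : Polynomial ℝ) : ℝ :=
  ∫ x in (-1 : ℝ)..1, wt γ (bt γ + 5) x * ((-γ - 1) * cq (qq p x) ^ (-γ - 2) * dv z 1 x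
    * dv p 5 x ^ 2 + 2 * (cq (qq p x) ^ (-γ - 1) * (dv p 5 x * dv z 5 x)))

theorem continuous_cq_qq (p : Polynomial ℝ) (a : ℝ) : Continuous fun x => cq (qq p x) ^ a :=
  (continuous_cq_rpow a).comp (continuous_const.add (continuous_dv p 1))

theorem E5_nonneg {γ : ℝ} (hγ : 3 < γ) (p : Polynomial ℝ) : 0 ≤ E5 γ p :=
  iint_nonneg fun x hx => mul_nonneg (wt_nonneg hγ _ hx) (mul_nonneg
    (Real.rpow_nonneg (by have := (cq_mem (qq p x)).1; linarith) _) (sq_nonneg _))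

theorem J_five_le_E5 {γ : ℝ} (hγ : 3 < γ) : ∃ C ≥ (1 : ℝ), ∀ p, J γ (bt γ + 5) p 5 ≤ C * E5 γ p := by
  have hb := bt_pos hγ
  have w5 : Continuous (wt γ (bt γ + 5)) := continuous_wt γ (by positivity)
  have hpos : 0 < (3 / 2 : ℝ) ^ (-γ - 1) := Real.rpow_pos_of_pos (by norm_num) _
  refine ⟨((3 / 2 : ℝ) ^ (-γ - 1))⁻¹, ?_, fun p => ?_⟩
  · rw [ge_iff_le, one_le_inv₀ hpos]
    exact Real.rpow_le_one_of_one_le_of_nonpos (by norm_num) (by linarith)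
  · have cc := continuous_cq_qq p (-γ - 1)
    rw [inv_mul_eq_div, le_div_iff₀ hpos, mul_comm]
    unfold J E5
    rw [← intervalIntegral.integral_const_mul]
    apply iint_mono (by fun_prop) (by fun_prop)
    intro x hx
    have h := cq_mem (qq p x)
    have : (3 / 2 : ℝ) ^ (-γ - 1) ≤ cq (qq p x) ^ (-γ - 1) :=
      Real.rpow_le_rpow_of_nonpos (by linarith [h.1]) h.2 (by linarith)
    rw [mul_left_comm]
    have := wt_nonneg hγ (bt γ + 5) hx
    gcongr

theorem abs_le_mul_of_sq_le {u K X : ℝ} (hK : 1 ≤ K) (hX : 0 ≤ X) (h : u ^ 2 ≤ K * X ^ 2) :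
    |u| ≤ K * X := by
  apply abs_le_of_sq_le_sq _ (by positivity)
  nlinarith [mul_nonneg (sub_nonneg.2 hK) (by positivity : 0 ≤ K * X ^ 2)]

theorem two_ip_le {γ : ℝ} (hγ : 3 < γ) {a : ℝ} (ha : 0 ≤ a) (p z : Polynomial ℝ) (k : ℕ) :
    2 * ∫ x in (-1 : ℝ)..1, wt γ a x * (dv p k x * dv z k x) ≤ J γ a p k + J γ a z k := by
  have w := continuous_wt γ ha
  unfold J
  rw [← intervalIntegral.integral_add (iintegrable (by fun_prop)) (iintegrable (by fun_prop)),
    ← intervalIntegral.integral_const_mul]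
  apply iint_mono (by fun_prop) (by fun_prop)
  intro x hx
  nlinarith [mul_nonneg (wt_nonneg hγ a hx) (sq_nonneg (dv p k x - dv z k x))]

/-- Cubic part of the derivative of the top order energy. -/
theorem E5'_le {γ : ℝ} (hγ : 3 < γ) : ∃ C ≥ (1 : ℝ), ∀ p z, NearId p → S4 γ z ≤ 1 →
    γ * E5' γ p z ≤ C * E5 γ p
      - 2 * ∫ x in (-1 : ℝ)..1, wt γ (bt γ + 5) x * (gA γ p x * dv z 5 x) := by
  have hb := bt_pos hγ
  obtain ⟨K, hS⟩ := exists_statBd hγ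
  have hK := hS.one_le
  refine ⟨γ * ((γ + 1) * (2 * K)), ?_, fun p z hp hz => ?_⟩
  · exact one_le_mul_of_one_le_of_one_le (by linarith)
      (one_le_mul_of_one_le_of_one_le (by linarith) (by linarith))
  have w5 : Continuous (wt γ (bt γ + 5)) := continuous_wt γ (by positivity)
  have cc1 := continuous_cq_qq p (-γ - 1)
  have cc2 := continuous_cq_qq p (-γ - 2)
  have cA := (continuousOn_gparts γ hp).2.2.1
  have c' : ∀ k, ContinuousOn (dv z k) (Icc (-1) 1) := fun k => (continuous_dv z k).continuousOn
  rw [E5, E5', ← intervalIntegral.integral_const_mul, ← intervalIntegral.integral_const_mul,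
    ← intervalIntegral.integral_const_mul, ← intervalIntegral.integral_sub
      (iintegrable (by fun_prop)) (iintegrable (by fun_prop))]
  apply iint_mono (by fun_prop) (by fun_prop)
  intro x hx
  have hq : cq (qq p x) = qq p x := cq_eq (by simpa [qq] using hp x hx)
  have hq2 := hp.half_le hx
  have hz1 : |dv z 1 x| ≤ K := by
    apply abs_le_of_sq_le_sq _ (by linarith)
    have := hS.s1 z x hx
    have hz0 := S4_nonneg hγ z
    nlinarith
  have eA : gA γ p x = -γ * qq p x ^ (-γ - 1) * dv p 5 x := by simp [gA, En]
  have e2 : qq p x ^ (-γ - 2) ≤ 2 * qq p x ^ (-γ - 1) := by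
    have : qq p x ^ (-γ - 1) = qq p x ^ (-γ - 2) * qq p x := by
      rw [← Real.rpow_add_one (by linarith)]; congr 1; ring
    rw [this]
    nlinarith [Real.rpow_nonneg (by linarith : 0 ≤ qq p x) (-γ - 2)]
  have hw := wt_nonneg hγ (bt γ + 5) hx
  have hn2 := Real.rpow_nonneg (by linarith : 0 ≤ qq p x) (-γ - 2)
  rw [hq, eA]
  have main : (-γ - 1) * qq p x ^ (-γ - 2) * dv z 1 x ≤ (γ + 1) * (2 * K) * qq p x ^ (-γ - 1) := by
    calc (-γ - 1) * qq p x ^ (-γ - 2) * dv z 1 x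
        = (γ + 1) * (qq p x ^ (-γ - 2) * (- dv z 1 x)) := by ring
      _ ≤ (γ + 1) * ((2 * qq p x ^ (-γ - 1)) * K) := by
        have h1 : - dv z 1 x ≤ K := (neg_le_abs _).trans hz1
        exact mul_le_mul_of_nonneg_left ((mul_le_mul_of_nonneg_left h1 hn2).trans
          (mul_le_mul_of_nonneg_right e2 (by linarith))) (by linarith)
      _ = _ := by ring
  have := mul_le_mul_of_nonneg_left main
    (by positivity : 0 ≤ γ * (wt γ (bt γ + 5) x * dv p 5 x ^ 2))
  linarith

/-- The energy identity in static form: all terms in the derivative of the energy are controlled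
by the energy. -/
theorem energy_ineq {γ : ℝ} (hγ : 3 < γ) : ∃ C ≥ (1 : ℝ), ∀ p z σ, NearId p → 0 < σ → σ ≤ 1 →
    S4 γ p + S4 γ z + γ * σ * E5 γ p ≤ 1 →
    2 * ((∫ x in (-1 : ℝ)..1, wt γ (bt γ) x * (dv p 0 x * dv z 0 x))
      + ∫ x in (-1 : ℝ)..1, wt γ (bt γ + 4) x * (dv p 4 x * dv z 4 x))
    + σ * (γ * E5' γ p z - 2 * ((∫ x in (-1 : ℝ)..1, wt γ (bt γ) x * (GG γ p 0 x * dv z 0 x))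
      + ∫ x in (-1 : ℝ)..1, wt γ (bt γ + 4) x * (GG γ p 4 x * dv z 4 x))) ≤
    C * (S4 γ p + S4 γ z + γ * σ * E5 γ p) := by
  have hb := bt_pos hγ
  obtain ⟨C1, hC1, h1⟩ := low_remainder hγ
  obtain ⟨C2, hC2, h2⟩ := top_remainder hγ
  obtain ⟨C3, hC3, h3⟩ := E5'_le hγ
  obtain ⟨C4, hC4, h4⟩ := J_five_le_E5 hγ
  refine ⟨1 + C3 + 2 * C1 + 2 * (C2 * (1 + (1 + C4) ^ 2)), by nlinarith [sq_nonneg (1 + C4)],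
    fun p z σ hp hσ hσ1 hX1 => ?_⟩
  set X := S4 γ p + S4 γ z + γ * σ * E5 γ p with hX
  have n1 := S4_nonneg hγ p
  have n2 := S4_nonneg hγ z
  have n3 := E5_nonneg hγ p
  have n4 : 0 ≤ γ * σ * E5 γ p := by positivity
  have hX0 : 0 ≤ X := by positivity
  have a1 := two_ip_le hγ hb.le p z 0
  have a2 := two_ip_le hγ (by linarith : 0 ≤ bt γ + 4) p z 4
  have a3 : |∫ x in (-1 : ℝ)..1, wt γ (bt γ) x * (GG γ p 0 x * dv z 0 x)| ≤ C1 * X := by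
    apply abs_le_mul_of_sq_le hC1 hX0
    refine (h1 p z hp).trans ?_
    rw [mul_assoc, sq]
    gcongr <;> linarith
  have b4 := h2 p z hp (by linarith)
  set R := (∫ x in (-1 : ℝ)..1, wt γ (bt γ + 4) x * (GG γ p 4 x * dv z 4 x))
      + ∫ x in (-1 : ℝ)..1, wt γ (bt γ + 5) x * (gA γ p x * dv z 5 x) with hR
  have s5 : σ * S5 γ p ≤ (1 + C4) * X := by
    have : σ * J γ (bt γ + 5) p 5 ≤ C4 * X := by
      calc σ * J γ (bt γ + 5) p 5 ≤ σ * (C4 * E5 γ p) := by gcongr; exact h4 p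
        _ = C4 * (1 * σ * E5 γ p) := by ring
        _ ≤ C4 * (γ * σ * E5 γ p) := by gcongr; linarith
        _ ≤ C4 * X := by gcongr; linarith
    unfold S5
    nlinarith
  have s5' := S5_nonneg hγ p
  have a4 : |σ * R| ≤ (C2 * (1 + (1 + C4) ^ 2)) * X := by
    apply abs_le_mul_of_sq_le (one_le_mul_of_one_le_of_one_le hC2
      (by nlinarith [sq_nonneg (1 + C4)])) hX0
    calc (σ * R) ^ 2 = σ ^ 2 * R ^ 2 := by ring
      _ ≤ σ ^ 2 * (C2 * S4 γ z * (S4 γ p + S5 γ p ^ 2)) := by gcongr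
      _ = C2 * (S4 γ z * (σ ^ 2 * S4 γ p + (σ * S5 γ p) ^ 2)) := by ring
      _ ≤ C2 * (X * (1 ^ 2 * X + ((1 + C4) * X) ^ 2)) := by
        gcongr <;> linarith
      _ = C2 * (X ^ 2 * (1 + (1 + C4) ^ 2 * X)) := by ring
      _ ≤ C2 * (X ^ 2 * (1 + (1 + C4) ^ 2 * 1)) := by gcongr
      _ = _ := by ring
  have a5 := mul_le_mul_of_nonneg_left (h3 p z hp (by linarith)) hσ.le
  have a6 : σ * (C3 * E5 γ p) ≤ C3 * X := by
    calc σ * (C3 * E5 γ p) = C3 * (1 * σ * E5 γ p) := by ring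
      _ ≤ C3 * (γ * σ * E5 γ p) := by gcongr; linarith
      _ ≤ C3 * X := by gcongr; linarith
  have a7 : -(σ * ∫ x in (-1 : ℝ)..1, wt γ (bt γ) x * (GG γ p 0 x * dv z 0 x)) ≤ C1 * X := by
    refine (neg_le_abs _).trans ?_
    rw [abs_mul, abs_of_pos hσ]
    exact (mul_le_of_le_one_left (abs_nonneg _) hσ1).trans a3
  have a8 := (neg_le_abs _).trans a4
  have a9 : (J γ (bt γ) p 0 + J γ (bt γ) z 0) + (J γ (bt γ + 4) p 4 + J γ (bt γ + 4) z 4) ≤ X := by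
    rw [hX]; unfold S4; linarith
  rw [hR] at a8
  linarith

/-- A differentiable curve of polynomials on a time interval, together with its velocity. -/
structure PolCurve (p p' : ℝ → Polynomial ℝ) (c d : ℝ) : Prop where
  cont : ∀ k, ContinuousOn (fun y : ℝ × ℝ => dv (p y.1) k y.2) (Icc c d ×ˢ univ)
  cont' : ∀ k, ContinuousOn (fun y : ℝ × ℝ => dv (p' y.1) k y.2) (Icc c d ×ˢ univ)
  deriv : ∀ k, ∀ s ∈ Ioo c d, ∀ x, HasDerivAt (fun s => dv (p s) k x) (dv (p' s) k x) s

theorem polCurve_pol {n : ℕ} (e : Fin n → Polynomial ℝ) {a a' : ℝ → Fin n → ℝ} {c d : ℝ}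
    (h : ContinuousOn a (Icc c d)) (h' : ContinuousOn a' (Icc c d))
    (hd : ∀ s ∈ Ioo c d, HasDerivAt a (a' s) s) :
    PolCurve (fun s => pol e (a s)) (fun s => pol e (a' s)) c d := by
  have key : ∀ {b : ℝ → Fin n → ℝ}, ContinuousOn b (Icc c d) → ∀ k,
      ContinuousOn (fun y : ℝ × ℝ => dv (pol e (b y.1)) k y.2) (Icc c d ×ˢ univ) := by
    intro b hb k
    have h1 : ContinuousOn (fun y : ℝ × ℝ => (b y.1, y.2)) (Icc c d ×ˢ univ) :=
      (hb.comp continuousOn_fst fun y hy => hy.1).prodMk continuousOn_snd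
    exact (continuous_dv_pol e k).comp_continuousOn h1
  refine ⟨key h, key h', fun k s hs x => ?_⟩
  simp only [dv_pol]
  have h1 := hasDerivAt_pi.1 (hd s hs)
  exact HasDerivAt.fun_sum fun i _ => (h1 i).mul_const _

theorem PolCurve.mono {p p' : ℝ → Polynomial ℝ} {c d c' d' : ℝ} (h : PolCurve p p' c d)
    (hc : c ≤ c') (hd : d' ≤ d) : PolCurve p p' c' d' :=
  ⟨fun k => (h.cont k).mono (prod_mono_left (Icc_subset_Icc hc hd)),
    fun k => (h.cont' k).mono (prod_mono_left (Icc_subset_Icc hc hd)),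
    fun k s hs => h.deriv k s (Ioo_subset_Ioo hc hd hs)⟩

theorem continuousOn_iint {f : ℝ → ℝ → ℝ} {c d : ℝ} (hcd : c ≤ d)
    (hf : ContinuousOn (fun y : ℝ × ℝ => f y.1 y.2) (Icc c d ×ˢ univ)) :
    ContinuousOn (fun s => ∫ x in (-1 : ℝ)..1, f s x) (Icc c d) := by
  have h1 : Continuous fun y : ℝ × ℝ => f (projIcc c d hcd y.1) y.2 := by
    have h2 : Continuous fun y : ℝ × ℝ => ((projIcc c d hcd y.1 : ℝ), y.2) := by fun_prop
    exact hf.comp_continuous h2 fun y => ⟨(projIcc c d hcd y.1).2, mem_univ _⟩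
  have h3 := intervalIntegral.continuous_parametric_intervalIntegral_of_continuous'
    (f := fun s x => f (projIcc c d hcd s) x) (μ := volume) h1 (-1) 1
  refine h3.continuousOn.congr fun s hs => ?_
  simp only [projIcc_of_mem hcd hs]

theorem hasDerivAt_iint {f f' : ℝ → ℝ → ℝ} {c d t : ℝ} (ht : t ∈ Ioo c d)
    (hf : ContinuousOn (fun y : ℝ × ℝ => f y.1 y.2) (Icc c d ×ˢ univ))
    (hf' : ContinuousOn (fun y : ℝ × ℝ => f' y.1 y.2) (Icc c d ×ˢ univ))
    (hd : ∀ s ∈ Ioo c d, ∀ x ∈ Icc (-1 : ℝ) 1, HasDerivAt (fun s => f s x) (f' s x) s) :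
    HasDerivAt (fun s => ∫ x in (-1 : ℝ)..1, f s x) (∫ x in (-1 : ℝ)..1, f' t x) t := by
  have sl : ∀ {g : ℝ → ℝ → ℝ}, ContinuousOn (fun y : ℝ × ℝ => g y.1 y.2) (Icc c d ×ˢ univ) →
      ∀ s ∈ Icc c d, Continuous (g s) := fun {g} hg s hs =>
    hg.comp_continuous (f := fun x => (s, x)) (by fun_prop) fun x => ⟨hs, mem_univ _⟩
  obtain ⟨M, hM⟩ := (isCompact_Icc.prod (isCompact_Icc (a := (-1 : ℝ)) (b := 1))).exists_bound_of_continuousOn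
    (hf'.mono (prod_mono_right (subset_univ (Icc (-1 : ℝ) 1))))
  have sub : uIoc (-1 : ℝ) 1 ⊆ Icc (-1) 1 := by
    rw [uIoc_of_le (by norm_num)]; exact Ioc_subset_Icc_self
  refine (intervalIntegral.hasDerivAt_integral_of_dominated_loc_of_deriv_le
    (bound := fun _ => M) (Ioo_mem_nhds ht.1 ht.2) ?_ ?_ ?_ ?_ (by simp) ?_).2
  · filter_upwards [Ioo_mem_nhds ht.1 ht.2] with s hs
    exact (sl hf s (Ioo_subset_Icc_self hs)).aestronglyMeasurable
  · exact (sl hf t (Ioo_subset_Icc_self ht)).intervalIntegrable _ _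
  · exact (sl hf' t (Ioo_subset_Icc_self ht)).aestronglyMeasurable
  · exact ae_of_all _ fun x hx s hs => hM (s, x) ⟨Ioo_subset_Icc_self hs, sub hx⟩
  · exact ae_of_all _ fun x hx s hs => hd s hs x (sub hx)

theorem PolCurve.continuousOn_J {γ : ℝ} {p p' : ℝ → Polynomial ℝ} {c d : ℝ}
    (h : PolCurve p p' c d) (hcd : c ≤ d) {a : ℝ} (ha : 0 ≤ a) (k : ℕ) :
    ContinuousOn (fun s => J γ a (p s) k) (Icc c d) := by
  have w := continuous_wt γ ha
  have := h.cont k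
  exact continuousOn_iint (f := fun s x => wt γ a x * dv (p s) k x ^ 2) hcd (by fun_prop)

theorem PolCurve.hasDerivAt_J {γ : ℝ} {p p' : ℝ → Polynomial ℝ} {c d t : ℝ}
    (h : PolCurve p p' c d) (ht : t ∈ Ioo c d) {a : ℝ} (ha : 0 ≤ a) (k : ℕ) :
    HasDerivAt (fun s => J γ a (p s) k)
      (2 * ∫ x in (-1 : ℝ)..1, wt γ a x * (dv (p t) k x * dv (p' t) k x)) t := by
  have w := continuous_wt γ ha
  have := h.cont k
  have := h.cont' k
  rw [← intervalIntegral.integral_const_mul]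
  refine hasDerivAt_iint (f := fun s x => wt γ a x * dv (p s) k x ^ 2)
    (f' := fun s x => 2 * (wt γ a x * (dv (p s) k x * dv (p' s) k x))) ht
    (by fun_prop) (by fun_prop) fun s hs x hx => ?_
  refine (((h.deriv k s hs x).pow 2).const_mul _).congr_deriv ?_
  simp; ring

theorem PolCurve.hasDerivAt_ip {γ : ℝ} (hγ : 3 < γ) {p p' : ℝ → Polynomial ℝ} {c d t : ℝ}
    (h : PolCurve p p' c d) (ht : t ∈ Ioo c d) (φ : Polynomial ℝ) :
    HasDerivAt (fun s => ip γ (p s) φ) (ip γ (p' t) φ) t := by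
  have w := continuous_wt γ (bt_pos hγ).le
  have := h.cont 0
  have := h.cont' 0
  have := continuous_dv φ 0
  refine hasDerivAt_iint (f := fun s x => wt γ (bt γ) x * (dv (p s) 0 x * dv φ 0 x))
    (f' := fun s x => wt γ (bt γ) x * (dv (p' s) 0 x * dv φ 0 x)) ht
    (by fun_prop) (by fun_prop) fun s hs x hx => ?_
  exact ((h.deriv 0 s hs x).mul_const _).const_mul _

theorem PolCurve.continuousOn_ip {γ : ℝ} (hγ : 3 < γ) {p p' : ℝ → Polynomial ℝ} {c d : ℝ}
    (h : PolCurve p p' c d) (hcd : c ≤ d) (φ : Polynomial ℝ) :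
    ContinuousOn (fun s => ip γ (p s) φ) (Icc c d) := by
  have w := continuous_wt γ (bt_pos hγ).le
  have := h.cont 0
  have := continuous_dv φ 0
  exact continuousOn_iint (f := fun s x => wt γ (bt γ) x * (dv (p s) 0 x * dv φ 0 x)) hcd
    (by fun_prop)

theorem PolCurve.continuousOn_cq {p p' : ℝ → Polynomial ℝ} {c d : ℝ}
    (h : PolCurve p p' c d) (a : ℝ) :
    ContinuousOn (fun y : ℝ × ℝ => cq (qq (p y.1) y.2) ^ a) (Icc c d ×ˢ univ) :=
  (continuous_cq_rpow a).comp_continuousOn (continuousOn_const.add (h.cont 1))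

theorem PolCurve.continuousOn_E5 {γ : ℝ} (hγ : 3 < γ) {p p' : ℝ → Polynomial ℝ} {c d : ℝ}
    (h : PolCurve p p' c d) (hcd : c ≤ d) : ContinuousOn (fun s => E5 γ (p s)) (Icc c d) := by
  have hb := bt_pos hγ
  have w := continuous_wt γ (by positivity : 0 ≤ bt γ + 5)
  have := h.cont 5
  have := h.continuousOn_cq (-γ - 1)
  exact continuousOn_iint (f := fun s x => wt γ (bt γ + 5) x *
    (cq (qq (p s) x) ^ (-γ - 1) * dv (p s) 5 x ^ 2)) hcd (by fun_prop)

theorem PolCurve.hasDerivAt_E5 {γ : ℝ} (hγ : 3 < γ) {p p' : ℝ → Polynomial ℝ} {c d t : ℝ}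
    (h : PolCurve p p' c d) (ht : t ∈ Ioo c d) (hn : ∀ s ∈ Ioo c d, NearId (p s)) :
    HasDerivAt (fun s => E5 γ (p s)) (E5' γ (p t) (p' t)) t := by
  have hb := bt_pos hγ
  have w := continuous_wt γ (by positivity : 0 ≤ bt γ + 5)
  have c5 := h.cont 5
  have c5' := h.cont' 5
  have c1' := h.cont' 1
  have c1 := h.continuousOn_cq (-γ - 1)
  have c2 := h.continuousOn_cq (-γ - 2)
  unfold E5 E5'
  refine hasDerivAt_iint
    (f := fun s x => wt γ (bt γ + 5) x * (cq (qq (p s) x) ^ (-γ - 1) * dv (p s) 5 x ^ 2))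
    (f' := fun s x => wt γ (bt γ + 5) x * ((-γ - 1) * cq (qq (p s) x) ^ (-γ - 2) * dv (p' s) 1 x
      * dv (p s) 5 x ^ 2 + 2 * (cq (qq (p s) x) ^ (-γ - 1) * (dv (p s) 5 x * dv (p' s) 5 x)))) ht
    ?_ ?_ fun s hs x hx => ?_
  · exact (w.comp continuous_snd).continuousOn.mul (c1.mul (c5.pow 2))
  · exact (w.comp continuous_snd).continuousOn.mul ((((continuousOn_const.mul c2).mul c1').mul
      (c5.pow 2)).add (continuousOn_const.mul (c1.mul (c5.mul c5'))))
  have e : ∀ r ∈ Ioo c d, cq (qq (p r) x) = qq (p r) x := fun r hr =>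
    cq_eq (by simpa [qq] using hn r hr x hx)
  have hq := (hn s hs).half_le hx
  have d1 : HasDerivAt (fun r => qq (p r) x) (dv (p' s) 1 x) s := (h.deriv 1 s hs x).const_add 1
  have d2 : HasDerivAt (fun r => cq (qq (p r) x) ^ (-γ - 1))
      (dv (p' s) 1 x * (-γ - 1) * qq (p s) x ^ (-γ - 1 - 1)) s :=
    (d1.rpow_const (Or.inl (by linarith))).congr_of_eventuallyEq
      (by filter_upwards [Ioo_mem_nhds hs.1 hs.2] with r hr using by rw [e r hr])
  refine ((d2.mul ((h.deriv 5 s hs x).pow 2)).const_mul _).congr_deriv ?_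
  rw [e s hs]
  simp only [Nat.cast_ofNat, Pi.pow_apply, Nat.add_one_sub_one, pow_one]
  rw [show -γ - 1 - 1 = -γ - 2 by ring]
  ring

/-- Continuity argument for a differential inequality valid below a threshold. -/
theorem bootstrap {Y θ θ' : ℝ → ℝ} {T C Θ δ : ℝ} (hC : 0 ≤ C)
    (hY : ContinuousOn Y (Icc 0 T)) (hθ : ContinuousOn θ (Icc 0 T)) (h0 : 0 ≤ Y 0)
    (hθ0 : θ 0 = 0) (hΘ : ∀ t ∈ Icc 0 T, θ t ≤ Θ)
    (hθ' : ∀ t ∈ Ioo 0 T, HasDerivAt θ (θ' t) t)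
    (hY' : ∀ t ∈ Ioo 0 T, Y t < δ → ∃ y, HasDerivAt Y y t ∧ y ≤ C * θ' t * Y t)
    (hδ : Real.exp (C * Θ) * Y 0 < δ) : ∀ t ∈ Icc 0 T, Y t ≤ Real.exp (C * Θ) * Y 0 := by
  have step : ∀ t ∈ Icc 0 T, (∀ s ∈ Ioo 0 t, Y s < δ) → Y t ≤ Real.exp (C * Θ) * Y 0 := by
    intro t ht hlt
    have hsub : Icc 0 t ⊆ Icc 0 T := Icc_subset_Icc_right ht.2
    have hd : ∀ s ∈ Ioo 0 t, ∃ y, HasDerivAt (fun s => Real.exp (-(C * θ s)) * Y s) y s ∧ y ≤ 0 := by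
      intro s hs
      have hsT : s ∈ Ioo 0 T := ⟨hs.1, hs.2.trans_le ht.2⟩
      obtain ⟨y, hy, hle⟩ := hY' s hsT (hlt s hs)
      refine ⟨_, (((hθ' s hsT).const_mul C).neg.exp).mul hy, ?_⟩
      have := (Real.exp_pos (-(C * θ s))).le
      have h1 := mul_le_mul_of_nonneg_left hle this
      simp only [Pi.neg_apply]
      linarith
    have hanti : AntitoneOn (fun s => Real.exp (-(C * θ s)) * Y s) (Icc 0 t) := by
      apply antitoneOn_of_deriv_nonpos (convex_Icc 0 t)
      · have h1 := hθ.mono hsub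
        have h2 := hY.mono hsub
        fun_prop
      · rw [interior_Icc]
        intro s hs
        obtain ⟨y, hy, -⟩ := hd s hs
        exact hy.differentiableAt.differentiableWithinAt
      · rw [interior_Icc]
        intro s hs
        obtain ⟨y, hy, h⟩ := hd s hs
        rwa [hy.deriv]
    have h1 := hanti ⟨le_rfl, ht.1⟩ ⟨ht.1, le_rfl⟩ ht.1
    simp only [hθ0, mul_zero, neg_zero, Real.exp_zero, one_mul] at h1
    have h2 : Y t ≤ Real.exp (C * θ t) * Y 0 := by
      have := mul_le_mul_of_nonneg_left h1 (Real.exp_pos (C * θ t)).le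
      rwa [← mul_assoc, ← Real.exp_add, add_neg_cancel, Real.exp_zero, one_mul] at this
    refine h2.trans ?_
    gcongr
    exact hΘ t ht
  have hall : ∀ t ∈ Icc 0 T, Y t < δ := by
    by_contra! hne
    obtain ⟨t₁, ht₁, hY₁⟩ := hne
    set S := {s ∈ Icc 0 T | δ ≤ Y s} with hS
    have hScl : IsClosed S := hY.preimage_isClosed_of_isClosed isClosed_Icc isClosed_Ici
    have hSc : IsCompact S := isCompact_Icc.of_isClosed_subset hScl fun s hs => hs.1
    obtain ⟨m, hm⟩ := hSc.exists_isLeast ⟨t₁, ht₁, hY₁⟩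
    have h1 := step m hm.1.1 fun s hs => by
      by_contra! h
      exact absurd (hm.2 ⟨⟨hs.1.le, hs.2.le.trans hm.1.1.2⟩, h⟩) (not_le.2 hs.2)
    linarith [hm.1.2]
  exact fun t ht => step t ht fun s hs => hall s ⟨hs.1.le, hs.2.le.trans ht.2⟩

/-- The weighted pairing of the force with a test polynomial. -/
def frc (γ : ℝ) (p φ : Polynomial ℝ) : ℝ :=
  ∫ x in (-1 : ℝ)..1, wt γ (bt γ) x * (GG γ p 0 x * dv φ 0 x)

theorem ip_pol {γ : ℝ} (hγ : 3 < γ) {n : ℕ} (e : Fin n → Polynomial ℝ) (a : Fin n → ℝ)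
    (φ : Polynomial ℝ) : ip γ (pol e a) φ = ∑ i, a i * ip γ (e i) φ := by
  have w0 := continuous_wt γ (bt_pos hγ).le
  unfold ip
  simp only [dv_pol, ← intervalIntegral.integral_const_mul]
  rw [← intervalIntegral.integral_finsetSum fun i _ =>
    iintegrable (by have := continuous_dv (e i) 0; have := continuous_dv φ 0; fun_prop)]
  congr 1; ext x
  rw [Finset.sum_mul, Finset.mul_sum]
  exact Finset.sum_congr rfl fun i _ => by ring

theorem frc_pol {γ : ℝ} (hγ : 3 < γ) {p : Polynomial ℝ} (h : NearId p) {n : ℕ}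
    (e : Fin n → Polynomial ℝ) (a : Fin n → ℝ) :
    frc γ p (∑ i, a i • e i) = ∑ i, a i * frc γ p (e i) := by
  have w0 := continuous_wt γ (bt_pos hγ).le
  have cG := continuousOn_GG γ h 0 (by norm_num)
  unfold frc
  simp only [dv_sum, dv_smul, ← intervalIntegral.integral_const_mul]
  rw [← intervalIntegral.integral_finsetSum fun i _ =>
    iintegrable (by have := continuous_dv (e i) 0; fun_prop)]
  congr 1; ext x
  rw [Finset.mul_sum, Finset.mul_sum]
  exact Finset.sum_congr rfl fun i _ => by ring

theorem natDegree_pol_le {n N : ℕ} {e : Fin n → Polynomial ℝ} (he : ∀ i, (e i).natDegree ≤ N)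
    (a : Fin n → ℝ) : (pol e a).natDegree ≤ N :=
  Polynomial.natDegree_sum_le_of_forall_le _ _ fun i _ =>
    (Polynomial.natDegree_smul_le _ _).trans (he i)

theorem abs_coeff_le {γ : ℝ} (hγ : 3 < γ) {n : ℕ} {e : Fin n → Polynomial ℝ}
    (he : ∀ i j, ip γ (e i) (e j) = if i = j then 1 else 0) (a : Fin n → ℝ)
    (h : S4 γ (pol e a) ≤ 1) (i : Fin n) : |a i| ≤ 1 := by
  have h1 : J γ (bt γ) (pol e a) 0 = ∑ i, a i ^ 2 := by
    rw [← ip_self, ip_pol hγ]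
    refine Finset.sum_congr rfl fun i _ => ?_
    rw [ip_comm, ip_pol hγ]
    simp only [he, mul_ite, mul_one, mul_zero, Finset.sum_ite_eq', Finset.mem_univ, if_true]
    ring
  have h2 : a i ^ 2 ≤ ∑ i, a i ^ 2 :=
    Finset.single_le_sum (f := fun i => a i ^ 2) (fun j _ => sq_nonneg _) (Finset.mem_univ i)
  have h3 := J_nonneg hγ (bt γ + 4) (pol e a) 4
  apply abs_le_of_sq_le_sq _ zero_le_one
  unfold S4 at h
  linarith

theorem E5'_smul (γ c : ℝ) (p z : Polynomial ℝ) : E5' γ p (c • z) = c * E5' γ p z := by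
  unfold E5'
  rw [← intervalIntegral.integral_const_mul]
  congr 1; ext x; simp only [dv_smul]; ring

theorem iint_smul_right (γ a c : ℝ) (p z : Polynomial ℝ) (k : ℕ) :
    ∫ x in (-1 : ℝ)..1, wt γ a x * (dv p k x * dv (c • z) k x) =
      c * ∫ x in (-1 : ℝ)..1, wt γ a x * (dv p k x * dv z k x) := by
  rw [← intervalIntegral.integral_const_mul]
  congr 1; ext x; simp only [dv_smul]; ring

theorem J_zero (γ a : ℝ) (k : ℕ) : J γ a 0 k = 0 := by
  simp [J, dv]

theorem E5_zero (γ : ℝ) : E5 γ 0 = 0 := by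
  simp [E5, dv]

/-- A Galerkin approximation of degree `N` on `[0, T]`, with its uniform bounds. -/
structure Galerkin (γ C : ℝ) (N : ℕ) (T : ℝ) (c σ : ℝ → ℝ) (u : Polynomial ℝ)
    (f z z' : ℝ → Polynomial ℝ) : Prop where
  deg_f : ∀ t, (f t).natDegree ≤ N
  deg_z : ∀ t, (z t).natDegree ≤ N
  f_zero : f 0 = 0
  z_zero : z 0 = u
  curve_f : PolCurve f (fun t => c t • z t) 0 T
  curve_z : PolCurve z z' 0 T
  near : ∀ t ∈ Icc 0 T, NearId (f t)
  bound : ∀ t ∈ Icc 0 T, S4 γ (f t) + S4 γ (z t) ≤ C * S4 γ u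
  bound_top : ∀ t ∈ Icc 0 T, σ t * J γ (bt γ + 5) (f t) 5 ≤ C * S4 γ u
  weak : ∀ t ∈ Icc 0 T, ∀ φ : Polynomial ℝ, φ.natDegree ≤ N →
    ip γ (z' t) φ = -(σ t * c t) * frc γ (f t) φ

theorem exists_galerkin {γ : ℝ} (hγ : 3 < γ) {Θ : ℝ} (hΘ0 : 0 ≤ Θ) :
    ∃ δ > (0 : ℝ), ∃ C ≥ (1 : ℝ), ∀ (N : ℕ) (T : ℝ) (c σ σ' θ : ℝ → ℝ) (u : Polynomial ℝ),
      4 ≤ N → 0 ≤ T → ContinuousOn c (Icc 0 T) → ContinuousOn σ (Icc 0 T) →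
      ContinuousOn θ (Icc 0 T) → (∀ t ∈ Icc 0 T, 0 < c t) → (∀ t ∈ Icc 0 T, 0 < σ t ∧ σ t ≤ 1) →
      (∀ t ∈ Ioo 0 T, HasDerivAt σ (σ' t) t ∧ σ' t ≤ 0) →
      (∀ t ∈ Ioo 0 T, HasDerivAt θ (c t) t) → θ 0 = 0 → (∀ t ∈ Icc 0 T, θ t ≤ Θ) →
      u.natDegree ≤ N → S4 γ u ≤ δ → ∃ f z z', Galerkin γ C N T c σ u f z z' := by
  have hb := bt_pos hγ
  obtain ⟨K, hS⟩ := exists_statBd hγ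
  have hK := hS.one_le
  obtain ⟨C1, hC1, hE⟩ := energy_ineq hγ
  obtain ⟨C2, hC2, hJ5⟩ := J_five_le_E5 hγ
  set A := Real.exp (C1 * Θ) with hA
  have hA1 : 1 ≤ A := Real.one_le_exp (by positivity)
  set δ₁ := 1 / (4 * K) with hδ₁
  have hδ₁0 : 0 < δ₁ := by positivity
  have hKδ : K * δ₁ = 1 / 4 := by rw [hδ₁]; field_simp
  have hδ₁1 : δ₁ ≤ 1 := by nlinarith
  refine ⟨δ₁ / (2 * A), by positivity, C2 * A, one_le_mul_of_one_le_of_one_le hC2 hA1, ?_⟩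
  intro N T c σ σ' θ u hN hT hc hσ hθ hc0 hσ0 hσ' hθ' hθ0 hθΘ hu hus
  obtain ⟨n, e, hdeg, horth, hexp⟩ := exists_onb hγ N
  obtain ⟨a, b, ha0, hb0, hode⟩ := exists_galerkin_ode hγ e hT hc (hσ.mul hc).neg 0
    (fun i => ip γ (e i) u)
  have ca : ContinuousOn a (Icc 0 T) := fun t ht => (hode t ht).1.continuousWithinAt
  have cb : ContinuousOn b (Icc 0 T) := fun t ht => (hode t ht).2.continuousWithinAt
  have ccl : Continuous (cl (n := n)) := by unfold cl; fun_prop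
  have cFW : ∀ i, Continuous fun y => FW γ (pol e y) (e i) := fun i => by
    obtain ⟨L, hL0, hL⟩ := exists_FW_lipschitz hγ e (e i)
    refine (LipschitzWith.of_dist_le_mul (K := ⟨L, hL0⟩) fun y y' => ?_).continuous
    rw [Real.dist_eq, dist_eq_norm]
    exact hL y y'
  set z' : ℝ → Fin n → ℝ := fun t i => (-(σ * c)) t * FW γ (pol e (cl (a t))) (e i) with hz'
  have cz' : ContinuousOn z' (Icc 0 T) := continuousOn_pi.2 fun i =>
    (hσ.mul hc).neg.mul (((cFW i).comp ccl).comp_continuousOn ca)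
  have crvf : PolCurve (fun t => pol e (a t)) (fun t => pol e (c t • cl (b t))) 0 T :=
    polCurve_pol e ca (hc.smul (ccl.comp_continuousOn cb)) fun s hs =>
      (hode s (Ioo_subset_Icc_self hs)).1.hasDerivAt (Icc_mem_nhds hs.1 hs.2)
  have crvz : PolCurve (fun t => pol e (b t)) (fun t => pol e (z' t)) 0 T :=
    polCurve_pol e cb cz' fun s hs =>
      (hode s (Ioo_subset_Icc_self hs)).2.hasDerivAt (Icc_mem_nhds hs.1 hs.2)
  set Y : ℝ → ℝ := fun t => S4 γ (pol e (a t)) + S4 γ (pol e (b t))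
    + γ * σ t * E5 γ (pol e (a t)) with hY
  have nE : ∀ t ∈ Icc 0 T, 0 ≤ γ * σ t * E5 γ (pol e (a t)) := fun t ht =>
    mul_nonneg (mul_nonneg (by linarith) (hσ0 t ht).1.le) (E5_nonneg hγ _)
  have nS : ∀ p, 0 ≤ S4 γ p := S4_nonneg hγ
  have cY : ContinuousOn Y (Icc 0 T) := by
    have h1 := crvf.continuousOn_J hT hb.le 0 (γ := γ)
    have h2 := crvf.continuousOn_J hT (by linarith : 0 ≤ bt γ + 4) 4 (γ := γ)
    have h3 := crvz.continuousOn_J hT hb.le 0 (γ := γ)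
    have h4 := crvz.continuousOn_J hT (by linarith : 0 ≤ bt γ + 4) 4 (γ := γ)
    have h5 := crvf.continuousOn_E5 hγ hT
    exact ((h1.add h2).add (h3.add h4)).add ((continuousOn_const.mul hσ).mul h5)
  have near_of : ∀ t ∈ Icc 0 T, Y t ≤ δ₁ → NearId (pol e (a t)) := fun t ht h x hx => by
    have h1 := hS.s1 (pol e (a t)) x hx
    have h2 : S4 γ (pol e (a t)) ≤ δ₁ := by
      have := nE t ht; have := nS (pol e (b t)); simp only [hY] at h; linarith
    have h3 : K * S4 γ (pol e (a t)) ≤ K * δ₁ := by gcongr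
    apply abs_le_of_sq_le_sq _ (by norm_num)
    linarith
  have cla : ∀ t ∈ Icc 0 T, Y t ≤ δ₁ → cl (a t) = a t := fun t ht h =>
    cl_eq (abs_coeff_le hγ horth _ (by
      have := nE t ht; have := nS (pol e (b t)); simp only [hY] at h; linarith))
  have clb : ∀ t ∈ Icc 0 T, Y t ≤ δ₁ → cl (b t) = b t := fun t ht h =>
    cl_eq (abs_coeff_le hγ horth _ (by
      have := nE t ht; have := nS (pol e (a t)); simp only [hY] at h; linarith))
  have psm : ∀ t ∈ Icc 0 T, Y t ≤ δ₁ → pol e (c t • cl (b t)) = c t • pol e (b t) :=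
    fun t ht h => by
      rw [clb t ht h]; simp only [pol, Finset.smul_sum, Pi.smul_apply, smul_eq_mul, mul_smul]
  have weak : ∀ t ∈ Icc 0 T, Y t ≤ δ₁ → ∀ φ : Polynomial ℝ, φ.natDegree ≤ N →
      ip γ (pol e (z' t)) φ = -(σ t * c t) * frc γ (pol e (a t)) φ := by
    intro t ht h φ hφ
    have hn := near_of t ht h
    rw [ip_pol hγ]
    conv_rhs => rw [hexp φ hφ]
    rw [frc_pol hγ hn, Finset.mul_sum]
    refine Finset.sum_congr rfl fun i _ => ?_
    simp only [hz', cla t ht h, FW_eq hγ hn, frc, Pi.neg_apply, Pi.mul_apply]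
    ring
  have hf0 : pol e (a 0) = 0 := by simp [pol, ha0]
  have hz0 : pol e (b 0) = u := by rw [hb0]; exact (hexp u hu).symm
  have hY0 : Y 0 = S4 γ u := by
    simp only [hY, hf0, hz0, E5_zero]; simp [S4, J_zero]
  have hAu : A * S4 γ u < δ₁ := by
    calc A * S4 γ u ≤ A * (δ₁ / (2 * A)) := by gcongr
      _ = δ₁ / 2 := by field_simp
      _ < δ₁ := by linarith
  have hmain : ∀ t ∈ Icc 0 T, Y t ≤ A * S4 γ u := by
    rw [← hY0] at hAu ⊢
    refine bootstrap (by linarith) cY hθ (by rw [hY0]; exact nS u) hθ0 hθΘ hθ' ?_ hAu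
    intro t ht hYt
    have ht' := Ioo_subset_Icc_self ht
    obtain ⟨ε, hε, hball⟩ := Metric.mem_nhds_iff.1 (Filter.inter_mem (Ioo_mem_nhds ht.1 ht.2)
      ((cY.continuousAt (Icc_mem_nhds ht.1 ht.2)).eventually_lt_const hYt))
    rw [Real.ball_eq_Ioo] at hball
    have tm : t ∈ Ioo (max 0 (t - ε)) (min T (t + ε)) :=
      ⟨max_lt ht.1 (by linarith), lt_min ht.2 (by linarith)⟩
    have dE := (crvf.mono (le_max_left 0 (t - ε)) (min_le_left T (t + ε))).hasDerivAt_E5 hγ tm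
      fun s hs => by
        have := hball ⟨(le_max_right _ _).trans_lt hs.1, hs.2.trans_le (min_le_right _ _)⟩
        exact near_of s (Ioo_subset_Icc_self this.1) (le_of_lt this.2)
    have d1 := crvf.hasDerivAt_J ht hb.le 0 (γ := γ)
    have d2 := crvf.hasDerivAt_J ht (by linarith : 0 ≤ bt γ + 4) 4 (γ := γ)
    have d3 := crvz.hasDerivAt_J ht hb.le 0 (γ := γ)
    have d4 := crvz.hasDerivAt_J ht (by linarith : 0 ≤ bt γ + 4) 4 (γ := γ)
    have hn := near_of t ht' hYt.le
    have hps := psm t ht' hYt.le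
    have hw := weak t ht' hYt.le
    rw [hps] at dE d1 d2
    rw [iint_smul_right] at d1 d2
    rw [E5'_smul] at dE
    have w0 : ∫ x in (-1 : ℝ)..1, wt γ (bt γ) x * (dv (pol e (b t)) 0 x * dv (pol e (z' t)) 0 x) =
        -(σ t * c t) * ∫ x in (-1 : ℝ)..1, wt γ (bt γ) x *
          (GG γ (pol e (a t)) 0 x * dv (pol e (b t)) 0 x) := by
      have := hw _ (natDegree_pol_le hdeg (b t))
      rw [ip_comm] at this
      exact this
    have w4 : ∫ x in (-1 : ℝ)..1, wt γ (bt γ + 4) x *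
          (dv (pol e (b t)) 4 x * dv (pol e (z' t)) 4 x) =
        -(σ t * c t) * ∫ x in (-1 : ℝ)..1, wt γ (bt γ + 4) x *
          (GG γ (pol e (a t)) 4 x * dv (pol e (b t)) 4 x) := by
      have hw' : ∀ φ : Polynomial ℝ, φ.natDegree ≤ N → ∫ x in (-1 : ℝ)..1, wt γ (bt γ) x *
          (dv (pol e (z' t)) 0 x * dv φ 0 x) = -(σ t * c t) * ∫ x in (-1 : ℝ)..1,
          wt γ (bt γ) x * (GG γ (pol e (a t)) 0 x * dv φ 0 x) := fun φ hφ => hw φ hφ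
      rw [← weak_top hγ hn hN (natDegree_pol_le hdeg (b t)) hw']
      simp only [mul_comm (dv (pol e (b t)) 4 _)]
    rw [w0] at d3
    rw [w4] at d4
    have dSf := d1.fun_add d2
    have dSz := d3.fun_add d4
    have dG := ((hσ' t ht).1.const_mul γ).fun_mul dE
    refine ⟨_, (dSf.fun_add dSz).fun_add dG, ?_⟩
    have hs := hσ0 t ht'
    have hX := hE (pol e (a t)) (pol e (b t)) (σ t) hn hs.1 hs.2
      (by simp only [hY] at hYt; linarith)
    have hX' := mul_le_mul_of_nonneg_left hX (hc0 t ht').le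
    have hneg : γ * σ' t * E5 γ (pol e (a t)) ≤ 0 :=
      mul_nonpos_of_nonpos_of_nonneg (mul_nonpos_of_nonneg_of_nonpos (by linarith) (hσ' t ht).2)
        (E5_nonneg hγ _)
    simp only [hY]
    linarith
  have hsmall : ∀ t ∈ Icc 0 T, Y t ≤ δ₁ := fun t ht => (hmain t ht).trans hAu.le
  have hAC : A * S4 γ u ≤ C2 * A * S4 γ u := by
    have := nS u
    rw [mul_assoc]
    exact le_mul_of_one_le_left (by positivity) hC2
  refine ⟨fun t => pol e (a t), fun t => pol e (b t), fun t => pol e (z' t), ?_⟩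
  exact
  { deg_f := fun t => natDegree_pol_le hdeg _
    deg_z := fun t => natDegree_pol_le hdeg _
    f_zero := hf0
    z_zero := hz0
    curve_f := by
      refine ⟨crvf.cont, fun k => (crvf.cont' k).congr fun y hy => ?_, fun k s hs x => ?_⟩
      · simp only [psm y.1 hy.1 (hsmall y.1 hy.1)]
      · have := Ioo_subset_Icc_self hs
        rw [← psm s this (hsmall s this)]
        exact crvf.deriv k s hs x
    curve_z := crvz
    near := fun t ht => near_of t ht (hsmall t ht)
    bound := fun t ht => by
      have h1 := hmain t ht
      have h2 := nE t ht
      simp only [hY] at h1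
      linarith
    bound_top := fun t ht => by
      have h1 := hmain t ht
      have h2 := hJ5 (pol e (a t))
      have h3 := nS (pol e (a t))
      have h4 := nS (pol e (b t))
      have hs := (hσ0 t ht).1
      have h5 := E5_nonneg hγ (pol e (a t))
      simp only [hY] at h1
      calc σ t * J γ (bt γ + 5) (pol e (a t)) 5 ≤ σ t * (C2 * E5 γ (pol e (a t))) := by gcongr
        _ = C2 * (1 * σ t * E5 γ (pol e (a t))) := by ring
        _ ≤ C2 * (γ * σ t * E5 γ (pol e (a t))) := by gcongr; linarith
        _ ≤ C2 * (A * S4 γ u) := mul_le_mul_of_nonneg_left (by linarith) (by linarith)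
        _ = _ := by ring
    weak := fun t ht => weak t ht (hsmall t ht) }

/-- The properties of the background expansion that are used in the argument. -/
structure Expansion (γ : ℝ) (α α' : ℝ → ℝ) : Prop where
  one_le : ∀ t ∈ Ici (0 : ℝ), 1 ≤ α t
  deriv : ∀ t ∈ Ici (0 : ℝ), HasDerivWithinAt α (α' t) (Ici 0) t
  deriv_nonneg : ∀ t ∈ Ici (0 : ℝ), 0 ≤ α' t
  zero : α 0 = 1
  exists_primitive : ∃ (θ : ℝ → ℝ) (Θ : ℝ), 0 ≤ Θ ∧ ContinuousOn θ (Ici 0) ∧ θ 0 = 0 ∧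
    (∀ t ∈ Ici (0 : ℝ), θ t ≤ Θ) ∧ ∀ t > (0 : ℝ), HasDerivAt θ (α t ^ (-2 : ℝ)) t

theorem antitoneOn_of_hasDerivAt {f f' : ℝ → ℝ} {D : Set ℝ} (hD : Convex ℝ D)
    (hf : ContinuousOn f D) (h : ∀ t ∈ interior D, HasDerivAt f (f' t) t)
    (hn : ∀ t ∈ interior D, f' t ≤ 0) : AntitoneOn f D :=
  antitoneOn_of_deriv_nonpos hD hf
    (fun t ht => (h t ht).differentiableAt.differentiableWithinAt)
    fun t ht => by rw [(h t ht).deriv]; exact hn t ht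

theorem expansion_of_ode {γ : ℝ} {α α' : ℝ → ℝ}
    (hαpos : ∀ t ∈ Ici (0 : ℝ), 0 < α t)
    (hα : ∀ t ∈ Ici (0 : ℝ), HasDerivWithinAt α (α' t) (Ici 0) t)
    (hα' : ∀ t ∈ Ici (0 : ℝ), HasDerivWithinAt α' (α t ^ (-γ)) (Ici 0) t)
    (hα0 : α 0 = 1) (hα'0 : 0 ≤ α' 0) : Expansion γ α α' := by
  have cα : ContinuousOn α (Ici 0) := fun t ht => (hα t ht).continuousWithinAt
  have cα' : ContinuousOn α' (Ici 0) := fun t ht => (hα' t ht).continuousWithinAt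
  have dα : ∀ t > (0 : ℝ), HasDerivAt α (α' t) t := fun t ht =>
    (hα t ht.le).hasDerivAt (Ici_mem_nhds ht)
  have dα' : ∀ t > (0 : ℝ), HasDerivAt α' (α t ^ (-γ)) t := fun t ht =>
    (hα' t ht.le).hasDerivAt (Ici_mem_nhds ht)
  have mono' : StrictMonoOn α' (Ici 0) := by
    apply strictMonoOn_of_deriv_pos (convex_Ici 0) cα'
    rw [interior_Ici]
    intro t ht
    rw [(dα' t ht).deriv]
    exact Real.rpow_pos_of_pos (hαpos t (mem_Ioi.1 ht).le) _
  have nn : ∀ t ∈ Ici (0 : ℝ), 0 ≤ α' t := fun t ht =>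
    hα'0.trans (mono'.monotoneOn (mem_Ici.2 le_rfl) ht ht)
  have mono : MonotoneOn α (Ici 0) := by
    apply monotoneOn_of_deriv_nonneg (convex_Ici 0) cα
    · rw [interior_Ici]
      exact fun t ht => (dα t ht).differentiableAt.differentiableWithinAt
    · rw [interior_Ici]
      intro t ht
      rw [(dα t ht).deriv]
      exact nn t (mem_Ioi.1 ht).le
  have one : ∀ t ∈ Ici (0 : ℝ), 1 ≤ α t := fun t ht => hα0 ▸ mono (mem_Ici.2 le_rfl) ht ht
  refine ⟨one, hα, nn, hα0, ?_⟩
  set m := α' 1 with hm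
  have hm0 : 0 < m := hα'0.trans_lt (mono' (mem_Ici.2 le_rfl) (mem_Ici.2 zero_le_one) one_pos)
  have cmax : Continuous fun s : ℝ => α (max s 0) :=
    cα.comp_continuous (by fun_prop) fun s => mem_Ici.2 (le_max_right _ _)
  have cb : Continuous fun s : ℝ => α (max s 0) ^ (-2 : ℝ) :=
    cmax.rpow_const fun s => Or.inl (hαpos _ (mem_Ici.2 (le_max_right s 0))).ne'
  set θ : ℝ → ℝ := fun t => ∫ s in (0 : ℝ)..t, α (max s 0) ^ (-2 : ℝ) with hθ
  have dθ : ∀ t, HasDerivAt θ (α (max t 0) ^ (-2 : ℝ)) t := fun t =>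
    intervalIntegral.integral_hasDerivAt_right (cb.intervalIntegrable _ _)
      cb.aestronglyMeasurable.stronglyMeasurableAtFilter cb.continuousAt
  have cθ : Continuous θ := continuous_iff_continuousAt.2 fun t => (dθ t).continuousAt
  have θ0 : θ 0 = 0 := intervalIntegral.integral_same
  have dθ' : ∀ t > (0 : ℝ), HasDerivAt θ (α t ^ (-2 : ℝ)) t := fun t ht => by
    have := dθ t
    rwa [max_eq_left ht.le] at this
  have b1 : ∀ t ∈ Icc (0 : ℝ) 1, θ t ≤ 1 := by
    intro t ht
    have h1 : AntitoneOn (fun t => θ t - t) (Icc 0 1) := by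
      apply antitoneOn_of_hasDerivAt (convex_Icc 0 1) (by fun_prop)
        (fun t _ => (dθ t).sub (hasDerivAt_id t))
      rw [interior_Icc]
      intro t ht
      have := Real.rpow_le_one_of_one_le_of_nonpos (one (max t 0) (mem_Ici.2 (le_max_right t 0)))
        (by norm_num : (-2 : ℝ) ≤ 0)
      linarith
    have := h1 ⟨le_rfl, zero_le_one⟩ ht ht.1
    simp only [θ0, sub_zero] at this
    linarith [ht.2]
  have b2 : ∀ t ∈ Ici (1 : ℝ), θ t ≤ 1 + m⁻¹ := by
    intro t ht
    have hsub : Ici (1 : ℝ) ⊆ Ici 0 := Ici_subset_Ici.2 zero_le_one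
    have h1 : AntitoneOn (fun t => θ t - m⁻¹ * (α t)⁻¹ * (-1)) (Ici 1) := by
      apply antitoneOn_of_hasDerivAt (convex_Ici 1)
        (f' := fun t => α t ^ (-2 : ℝ) - m⁻¹ * (-α' t / α t ^ 2) * (-1))
      · have h2 : ContinuousOn (fun t => (α t)⁻¹) (Ici 1) :=
          (cα.mono hsub).inv₀ fun t ht => (hαpos t (hsub ht)).ne'
        fun_prop
      · rw [interior_Ici]
        intro t ht
        have ht0 : (0 : ℝ) < t := one_pos.trans ht
        exact (dθ' t ht0).fun_sub ((((dα t ht0).fun_inv (hαpos t ht0.le).ne').const_mul _).mul_const _)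
      · rw [interior_Ici]
        intro t ht
        have ht0 : (0 : ℝ) < t := one_pos.trans ht
        have hp := hαpos t ht0.le
        have e : α t ^ (-2 : ℝ) = (α t ^ 2)⁻¹ := by
          rw [Real.rpow_neg hp.le]; norm_cast
        have h3 : m ≤ α' t := mono'.monotoneOn (mem_Ici.2 zero_le_one) ht0.le (mem_Ioi.1 ht).le
        have h4 : 1 ≤ m⁻¹ * α' t := by
          rw [inv_mul_eq_div, one_le_div hm0]; exact h3
        have h5 : 0 < (α t ^ 2)⁻¹ := by positivity
        have h6 := mul_le_mul_of_nonneg_right h4 h5.le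
        rw [e, neg_div, div_eq_mul_inv]
        linarith
    have h2 := h1 (mem_Ici.2 le_rfl) ht ht
    have h3 := b1 1 ⟨zero_le_one, le_rfl⟩
    have h4 : (α 1)⁻¹ ≤ 1 := inv_le_one_of_one_le₀ (one 1 (mem_Ici.2 zero_le_one))
    have h5 : 0 < (α t)⁻¹ := inv_pos.2 (hαpos t (hsub ht))
    have h6 : 0 < m⁻¹ := inv_pos.2 hm0
    simp only at h2
    nlinarith [mul_le_mul_of_nonneg_left h4 h6.le, mul_pos h6 h5]
  refine ⟨θ, 1 + m⁻¹, by positivity, cθ.continuousOn, θ0, fun t ht => ?_, dθ'⟩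
  rcases le_total t 1 with h | h
  · exact (b1 t ⟨ht, h⟩).trans (by linarith [inv_pos.2 hm0])
  · exact b2 t h

theorem Expansion.continuousOn {γ : ℝ} {α α' : ℝ → ℝ} (h : Expansion γ α α') (a : ℝ) :
    ContinuousOn (fun t => α t ^ a) (Ici 0) :=
  ContinuousOn.rpow_const (fun t ht => (h.deriv t ht).continuousWithinAt)
    fun t ht => Or.inl (by linarith [h.one_le t ht])

theorem Expansion.hasDerivAt_rpow {γ : ℝ} {α α' : ℝ → ℝ} (h : Expansion γ α α') (a : ℝ) {t : ℝ}
    (ht : 0 < t) : HasDerivAt (fun t => α t ^ a) (α' t * a * α t ^ (a - 1)) t :=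
  ((h.deriv t ht.le).hasDerivAt (Ici_mem_nhds ht)).rpow_const
    (Or.inl (by linarith [h.one_le t ht.le]))

/-- Galerkin approximations of small data exist on arbitrary time intervals, with bounds
independent of the interval and the degree. -/
theorem Expansion.exists_galerkin {γ : ℝ} (hγ : 3 < γ) {α α' : ℝ → ℝ} (h : Expansion γ α α') :
    ∃ δ > (0 : ℝ), ∃ C ≥ (1 : ℝ), ∀ (N : ℕ) (T : ℝ) (u : Polynomial ℝ), 4 ≤ N → 0 ≤ T →
      u.natDegree ≤ N → S4 γ u ≤ δ → ∃ f z z',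
        Galerkin γ C N T (fun t => α t ^ (-2 : ℝ)) (fun t => α t ^ (3 - γ)) u f z z' := by
  obtain ⟨θ, Θ, hΘ0, cθ, θ0, hΘ, dθ⟩ := h.exists_primitive
  obtain ⟨δ, hδ, C, hC, hG⟩ := _root_.exists_galerkin hγ hΘ0
  refine ⟨δ, hδ, C, hC, fun N T u hN hT hu hs => ?_⟩
  have sub : Icc 0 T ⊆ Ici 0 := Icc_subset_Ici_self
  have pos : ∀ t ∈ Icc 0 T, 0 < α t := fun t ht => by linarith [h.one_le t ht.1]
  refine hG N T _ _ (fun t => α' t * (3 - γ) * α t ^ (3 - γ - 1)) θ u hN hT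
    ((h.continuousOn _).mono sub) ((h.continuousOn _).mono sub) (cθ.mono sub)
    (fun t ht => Real.rpow_pos_of_pos (pos t ht) _)
    (fun t ht => ⟨Real.rpow_pos_of_pos (pos t ht) _,
      Real.rpow_le_one_of_one_le_of_nonpos (h.one_le t ht.1) (by linarith)⟩)
    (fun t ht => ⟨h.hasDerivAt_rpow _ ht.1, ?_⟩) (fun t ht => dθ t ht.1) θ0
    (fun t ht => hΘ t ht.1) hu hs
  have h1 := h.deriv_nonneg t ht.1.le
  have h2 := Real.rpow_pos_of_pos (pos t (Ioo_subset_Icc_self ht)) (3 - γ - 1)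
  exact mul_nonpos_of_nonpos_of_nonneg (mul_nonpos_of_nonneg_of_nonpos h1 (by linarith)) h2.le

theorem exists_antiderivative (q : Polynomial ℝ) : ∃ p : Polynomial ℝ, Polynomial.derivative p = q := by
  induction q using Polynomial.induction_on' with
  | add p q hp hq =>
    obtain ⟨P, rfl⟩ := hp
    obtain ⟨Q, rfl⟩ := hq
    exact ⟨P + Q, Polynomial.derivative_add⟩
  | monomial n a =>
    refine ⟨Polynomial.monomial (n + 1) (a / (n + 1)), ?_⟩
    rw [Polynomial.derivative_monomial]
    congr 1
    push_cast
    field_simp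

/-- Simultaneous uniform approximation of a function and its derivatives by polynomials. -/
theorem exists_poly_near (k : ℕ) : ∀ {h : ℝ → ℝ}, ContDiffOn ℝ k h (Icc (-1) 1) → ∀ ε > (0 : ℝ),
    ∃ p : Polynomial ℝ, ∀ j ≤ k, ∀ x ∈ Icc (-1 : ℝ) 1,
      |dv p j x - iteratedDerivWithin j h (Icc (-1) 1) x| ≤ ε := by
  induction k with
  | zero =>
    intro h hh ε hε
    obtain ⟨p, hp⟩ := exists_polynomial_near_of_continuousOn (-1) 1 h hh.continuousOn ε hε
    refine ⟨p, fun j hj x hx => ?_⟩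
    obtain rfl : j = 0 := by omega
    simpa [dv] using (hp x hx).le
  | succ k ih =>
    intro h hh ε hε
    have hu : UniqueDiffOn ℝ (Icc (-1 : ℝ) 1) := uniqueDiffOn_Icc (by norm_num)
    obtain ⟨q, hq⟩ := ih (hh.derivWithin (m := k) hu (by norm_cast)) (ε / 2) (by positivity)
    obtain ⟨P, hP⟩ := exists_antiderivative q
    set p := P + Polynomial.C (h (-1) - P.eval (-1)) with hp
    have hpq : Polynomial.derivative p = q := by simp [hp, hP]
    have hpd : ∀ j x, dv p (j + 1) x = dv q j x := fun j x => by
      simp only [dv, Function.iterate_succ, Function.comp, hpq]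
    refine ⟨p, fun j hj x hx => ?_⟩
    cases j with
    | succ j =>
      rw [hpd, iteratedDerivWithin_succ']
      exact (hq j (by omega) x hx).trans (by linarith)
    | zero =>
      have hd : ∀ y ∈ Icc (-1 : ℝ) 1, HasDerivWithinAt (fun y => dv p 0 y - h y)
          (dv p 1 y - derivWithin h (Icc (-1) 1) y) (Icc (-1) 1) y := fun y hy =>
        (hasDerivAt_dv p 0 y).hasDerivWithinAt.fun_sub
          ((hh.differentiableOn (by simp)) y hy).hasDerivWithinAt
      have hle := (convex_Icc (-1 : ℝ) 1).norm_image_sub_le_of_norm_hasDerivWithin_le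
        (C := ε / 2) hd (fun y hy => by
          have := hq 0 (by omega) y hy
          rw [hpd]
          simpa [Real.norm_eq_abs] using this) (⟨le_rfl, by norm_num⟩ : (-1 : ℝ) ∈ Icc (-1 : ℝ) 1) hx
      have h0 : dv p 0 (-1) - h (-1) = 0 := by simp [dv, hp]
      rw [h0, sub_zero, Real.norm_eq_abs, Real.norm_eq_abs] at hle
      have : |x - -1| ≤ 2 := abs_le.2 ⟨by linarith [hx.1], by linarith [hx.2]⟩
      rw [iteratedDerivWithin_zero]
      nlinarith

theorem setIntegral_Ω₀ (f : ℝ → ℝ) : ∫ x in Ω₀, f x = ∫ x in (-1 : ℝ)..1, f x := by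
  rw [intervalIntegral.integral_of_le (by norm_num), integral_Ioc_eq_integral_Ioo, Ω₀]

theorem iteratedDerivWithin_Icc_eq (j : ℕ) (h : ℝ → ℝ) {x : ℝ} (hx : x ∈ Ioo (-1 : ℝ) 1) :
    iteratedDerivWithin j h (Icc (-1) 1) x = iteratedDeriv j h x := by
  rw [iteratedDerivWithin, iteratedDeriv, ← iteratedFDerivWithin_univ]
  congr 1
  apply iteratedFDerivWithin_congr_set
  filter_upwards [Ioo_mem_nhds hx.1 hx.2] with y hy
  exact propext ⟨fun _ => trivial, fun _ => Ioo_subset_Icc_self hy⟩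

theorem ddg_rpow_eq {γ : ℝ} (hγ : 3 < γ) (b : ℕ) (x : ℝ) :
    ddg γ x ^ ((1 + (b : ℝ) * (γ - 1)) / (γ - 1)) = wt γ (bt γ + b) x := by
  rw [wt, bt]
  congr 1
  have : γ - 1 ≠ 0 := by linarith
  field_simp

theorem J_le_of_near {γ : ℝ} (hγ : 3 < γ) {a : ℝ} (ha : 0 ≤ a) {g : ℝ → ℝ} {M e : ℝ} (j : ℕ)
    (cg : ContinuousOn g (Icc (-1) 1)) (hM : ∀ x ∈ Icc (-1 : ℝ) 1, |g x| ≤ M) (he : 0 ≤ e)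
    (he1 : e ≤ 1) {p : Polynomial ℝ} (hp : ∀ x ∈ Icc (-1 : ℝ) 1, |dv p j x - g x| ≤ e) :
    J γ a p j ≤ (∫ x in (-1 : ℝ)..1, wt γ a x * g x ^ 2) + 2 * (e * (2 * M + 1)) := by
  have w := continuous_wt γ ha
  have c' := (continuous_dv p j).continuousOn (s := Icc (-1 : ℝ) 1)
  have : 2 * (e * (2 * M + 1)) = ∫ x in (-1 : ℝ)..1, e * (2 * M + 1) := by
    rw [intervalIntegral.integral_const, smul_eq_mul]; ring
  rw [this, ← intervalIntegral.integral_add (iintegrable (by fun_prop)) (iintegrable (by fun_prop))]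
  apply iint_mono (by fun_prop) (by fun_prop)
  intro x hx
  have h1 := hp x hx
  have h2 := hM x hx
  have h3 := wt_nonneg hγ a hx
  have h4 := wt_le_one hγ ha hx
  set r := dv p j x - g x with hr
  have e1 : dv p j x ^ 2 - g x ^ 2 = r * r + 2 * (g x * r) := by rw [hr]; ring
  have e2 : r * r ≤ e * 1 := by
    rw [← abs_mul_abs_self]
    exact mul_le_mul h1 (h1.trans he1) (abs_nonneg _) he
  have e3 : g x * r ≤ M * e := (le_abs_self _).trans (by
    rw [abs_mul]; exact mul_le_mul h2 h1 (abs_nonneg _) ((abs_nonneg _).trans h2))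
  have e4 : dv p j x ^ 2 - g x ^ 2 ≤ e * (2 * M + 1) := by linarith
  have hM0 : 0 ≤ M := (abs_nonneg _).trans h2
  have e5 : wt γ a x * (dv p j x ^ 2 - g x ^ 2) ≤ 1 * (e * (2 * M + 1)) := by
    have : 0 ≤ e * (2 * M + 1) := by positivity
    exact (mul_le_mul_of_nonneg_left e4 h3).trans (mul_le_mul_of_nonneg_right h4 this)
  linarith

/-- Polynomial approximation of the initial data, in the energy space. -/
theorem exists_initial_approx {γ : ℝ} (hγ : 3 < γ) {u₀ : ℝ → ℝ} {ε : ℝ}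
    (hu : ∀ n : ℕ, ContDiffOn ℝ n u₀ (Icc (-1) 1))
    (hs : (∑ b ∈ Finset.range 5,
      ∫ x in Ω₀, ddg γ x ^ ((1 + (b : ℝ) * (γ - 1)) / (γ - 1)) * (iteratedDeriv b u₀ x) ^ 2) < ε) :
    ∃ p : ℕ → Polynomial ℝ, (∀ n, S4 γ (p n) ≤ ε) ∧
      ∀ x ∈ Icc (-1 : ℝ) 1, Tendsto (fun n => dv (p n) 0 x) atTop (nhds (u₀ x)) := by
  have hb := bt_pos hγ
  have hud : UniqueDiffOn ℝ (Icc (-1 : ℝ) 1) := uniqueDiffOn_Icc (by norm_num)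
  set g : ℕ → ℝ → ℝ := fun j => iteratedDerivWithin j u₀ (Icc (-1) 1) with hg
  have cg : ∀ j ≤ 4, ContinuousOn (g j) (Icc (-1) 1) := fun j hj =>
    (hu 4).continuousOn_iteratedDerivWithin (by exact_mod_cast hj) hud
  have hI : ∀ b : ℕ, ∫ x in Ω₀, ddg γ x ^ ((1 + (b : ℝ) * (γ - 1)) / (γ - 1)) *
      (iteratedDeriv b u₀ x) ^ 2 = ∫ x in (-1 : ℝ)..1, wt γ (bt γ + b) x * g b x ^ 2 := by
    intro b
    rw [← setIntegral_Ω₀]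
    refine setIntegral_congr_fun measurableSet_Ioo fun x hx => ?_
    simp only [hg, ddg_rpow_eq hγ, iteratedDerivWithin_Icc_eq b u₀ hx]
  have hnn : ∀ b : ℕ, 0 ≤ ∫ x in (-1 : ℝ)..1, wt γ (bt γ + b) x * g b x ^ 2 := fun b =>
    iint_nonneg fun x hx => mul_nonneg (wt_nonneg hγ _ hx) (sq_nonneg _)
  simp only [hI, Finset.sum_range_succ, Finset.sum_range_zero] at hs
  have n1 := hnn 1
  have n2 := hnn 2
  have n3 := hnn 3
  push_cast at hs n1 n2 n3
  set I0 := ∫ x in (-1 : ℝ)..1, wt γ (bt γ + 0) x * g 0 x ^ 2 with hI0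
  set I4 := ∫ x in (-1 : ℝ)..1, wt γ (bt γ + 4) x * g 4 x ^ 2 with hI4
  have hsum : I0 + I4 < ε := by linarith
  obtain ⟨M0, hM0⟩ := isCompact_Icc.exists_bound_of_continuousOn (cg 0 (by norm_num))
  obtain ⟨M4, hM4⟩ := isCompact_Icc.exists_bound_of_continuousOn (cg 4 le_rfl)
  have hM0' := (norm_nonneg _).trans (hM0 0 (by norm_num))
  have hM4' := (norm_nonneg _).trans (hM4 0 (by norm_num))
  set A := 2 * (2 * M0 + 1) + 2 * (2 * M4 + 1) with hA
  have hA0 : 0 < A := by positivity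
  set e : ℕ → ℝ := fun n => min (min 1 ((ε - (I0 + I4)) / A)) (1 / ((n : ℝ) + 1)) with he
  have he0 : ∀ n, 0 < e n := fun n =>
    lt_min (lt_min one_pos (div_pos (by linarith) hA0)) (by positivity)
  choose p hp using fun n => exists_poly_near 4 (hu 4) (e n) (he0 n)
  refine ⟨p, fun n => ?_, fun x hx => ?_⟩
  · have h1 := J_le_of_near hγ (by linarith : 0 ≤ bt γ + 0) 0 (cg 0 (by norm_num)) hM0 (he0 n).le
      ((min_le_left _ _).trans (min_le_left _ _)) (hp n 0 (by norm_num))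
    have h4 := J_le_of_near hγ (by linarith : 0 ≤ bt γ + 4) 4 (cg 4 le_rfl) hM4 (he0 n).le
      ((min_le_left _ _).trans (min_le_left _ _)) (hp n 4 le_rfl)
    have h5 : e n * A ≤ ε - (I0 + I4) := by
      rw [← le_div_iff₀ hA0]
      exact (min_le_left _ _).trans (min_le_right _ _)
    rw [add_zero] at h1
    rw [hA] at h5
    rw [hI0, add_zero] at h5
    unfold S4
    linarith
  · rw [tendsto_iff_dist_tendsto_zero]
    refine squeeze_zero (fun n => dist_nonneg) (fun n => ?_) tendsto_one_div_add_atTop_nhds_zero_nat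
    have := hp n 0 (by norm_num) x hx
    rw [iteratedDerivWithin_zero] at this
    exact this.trans (min_le_right _ _)

/-- Cauchy–Schwarz form of the fundamental theorem of calculus. -/
theorem sub_sq_le_integral {u u' : ℝ → ℝ} (hu : ∀ x, HasDerivAt u (u' x) x) (hc : Continuous u')
    {x y : ℝ} (hxy : x ≤ y) : (u y - u x) ^ 2 ≤ (y - x) * ∫ s in x..y, u' s ^ 2 := by
  have ii : ∀ {f : ℝ → ℝ}, Continuous f → IntervalIntegrable f volume x y :=
    fun hf => hf.intervalIntegrable _ _
  have h1 : ∫ s in x..y, u' s = u y - u x :=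
    intervalIntegral.integral_eq_sub_of_hasDerivAt (fun s _ => hu s) (ii hc)
  rcases hxy.eq_or_lt with rfl | hlt
  · simp
  set A := (u y - u x) / (y - x)
  have hA : A * (y - x) = u y - u x := div_mul_cancel₀ _ (by linarith)
  have h2 : 0 ≤ ∫ s in x..y, (u' s - A) ^ 2 :=
    intervalIntegral.integral_nonneg hxy fun s _ => sq_nonneg _
  have h3 : ∫ s in x..y, (u' s - A) ^ 2 =
      (∫ s in x..y, u' s ^ 2) - 2 * A * (u y - u x) + A ^ 2 * (y - x) := by
    have : ∀ s, (u' s - A) ^ 2 = u' s ^ 2 - 2 * A * u' s + A ^ 2 := fun s => by ring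
    simp only [this]
    rw [intervalIntegral.integral_add (ii (by fun_prop)) (ii (by fun_prop)),
      intervalIntegral.integral_sub (ii (by fun_prop)) (ii (by fun_prop)),
      intervalIntegral.integral_const_mul, h1, intervalIntegral.integral_const, smul_eq_mul]
    ring
  have h4 := mul_nonneg (by linarith : 0 ≤ y - x) (h3 ▸ h2)
  nlinarith

/-- Pointwise limit of the `j`-th derivatives along an ultrafilter. -/
def lm (U : Ultrafilter ℕ) (Q : ℕ → Polynomial ℝ) (j : ℕ) (x : ℝ) : ℝ :=
  limUnder (U : Filter ℕ) fun n => dv (Q n) j x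

theorem tendsto_limUnder_of_bounded (U : Ultrafilter ℕ) {a : ℕ → ℝ} {M : ℝ}
    (h : ∀ n, |a n| ≤ M) : Tendsto a U (nhds (limUnder (U : Filter ℕ) a)) := by
  obtain ⟨x, _, hx⟩ := (isCompact_Icc (a := -M) (b := M)).ultrafilter_le_nhds (U.map a)
    (le_principal_iff.2 (Ultrafilter.mem_map.2 (univ_mem' fun n => abs_le.1 (h n))))
  exact tendsto_nhds_limUnder ⟨x, hx⟩

/-- Convergence of countably many sequences along an ultrafilter can be realised along a common
honest sequence of indices. -/
theorem exists_common_seq (U : Ultrafilter ℕ) {ι : Type*} [Countable ι] (a : ι → ℕ → ℝ) (l : ι → ℝ)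
    (h : ∀ i, Tendsto (a i) U (nhds (l i))) :
    ∃ k : ℕ → ℕ, ∀ i, Tendsto (fun n => a i (k n)) atTop (nhds (l i)) := by
  obtain ⟨g, hg⟩ := exists_injective_nat ι
  have hfin : ∀ m : ℕ, {i | g i ≤ m}.Finite := fun m =>
    Finite.of_injOn (f := g) (t := Iic m) (fun i hi => hi) hg.injOn (finite_Iic m)
  have : ∀ m : ℕ, ∃ n, ∀ i, g i ≤ m → dist (a i n) (l i) < 1 / ((m : ℝ) + 1) := fun m => by
    have : ∀ᶠ n in (U : Filter ℕ), ∀ i ∈ {i | g i ≤ m}, dist (a i n) (l i) < 1 / ((m : ℝ) + 1) :=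
      (eventually_all_finite (hfin m)).2 fun i _ => (Metric.tendsto_nhds.1 (h i)) _ (by positivity)
    exact this.exists
  choose k hk using this
  refine ⟨k, fun i => ?_⟩
  rw [tendsto_iff_dist_tendsto_zero]
  refine squeeze_zero' (Eventually.of_forall fun n => dist_nonneg) ?_
    tendsto_one_div_add_atTop_nhds_zero_nat
  filter_upwards [eventually_ge_atTop (g i)] with n hn
  exact (hk n i hn).le

/-- Bounds on a sequence of polynomials that make the derivatives up to order `m` converge locally
uniformly. -/
structure LimBd (γ : ℝ) (m : ℕ) (Q : ℕ → Polynomial ℝ) : Prop where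
  pt : ∀ j ≤ m, ∀ x ∈ Ioo (-1 : ℝ) 1, ∃ M, ∀ n, |dv (Q n) j x| ≤ M
  en : ∀ j ≤ m, ∃ a ≥ (0 : ℝ), ∃ K, ∀ n, J γ a (Q n) (j + 1) ≤ K

theorem wt_lower {γ : ℝ} (hγ : 3 < γ) {a r x : ℝ} (ha : 0 ≤ a) (hr : r < 1)
    (hx : x ∈ Icc (-r) r) : wt γ a r ≤ wt γ a x := by
  have hr0 : 0 ≤ r := by linarith [hx.1, hx.2]
  unfold wt
  apply Real.rpow_le_rpow (ddg_pos hγ ⟨by linarith, hr⟩).le _ ha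
  rw [ddg_eq, ddg_eq]
  have := mu_gt hγ
  have : x ^ 2 ≤ r ^ 2 := sq_le_sq' hx.1 hx.2
  nlinarith

/-- Local Hölder continuity from a weighted energy bound. -/
theorem abs_dv_sub_le {γ : ℝ} (hγ : 3 < γ) {a r : ℝ} (ha : 0 ≤ a) (hr : r < 1)
    (p : Polynomial ℝ) (j : ℕ) {x y : ℝ} (hx : x ∈ Icc (-r) r) (hy : y ∈ Icc (-r) r) :
    |dv p j x - dv p j y| ≤ √(J γ a p (j + 1) / wt γ a r) * √|x - y| := by
  wlog hxy : y ≤ x generalizing x y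
  · rw [abs_sub_comm, abs_sub_comm x]
    exact this hy hx (not_le.1 hxy).le
  have hr0 : 0 ≤ r := by linarith [hx.1, hx.2]
  have hw := wt_pos hγ a (x := r) ⟨by linarith, hr⟩
  have w := continuous_wt γ ha
  have c := continuous_dv p (j + 1)
  rw [← Real.sqrt_mul' _ (abs_nonneg _)]
  apply Real.abs_le_sqrt
  refine (sub_sq_le_integral (hasDerivAt_dv p j) c hxy).trans ?_
  rw [abs_of_nonneg (by linarith), mul_comm]
  apply mul_le_mul_of_nonneg_right _ (by linarith)
  rw [le_div_iff₀ hw, mul_comm, ← intervalIntegral.integral_const_mul]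
  unfold J
  calc ∫ s in y..x, wt γ a r * dv p (j + 1) s ^ 2 ≤ ∫ s in y..x, wt γ a s * dv p (j + 1) s ^ 2 := by
        apply intervalIntegral.integral_mono_on hxy
          (Continuous.intervalIntegrable (by fun_prop) _ _)
          (Continuous.intervalIntegrable (by fun_prop) _ _)
        intro s hs
        exact mul_le_mul_of_nonneg_right
          (wt_lower hγ ha hr ⟨hy.1.trans hs.1, hs.2.trans hx.2⟩) (sq_nonneg _)
    _ ≤ _ := by
        apply intervalIntegral.integral_mono_interval (by linarith [hy.1]) hxy (by linarith [hx.2])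
        · refine (ae_restrict_iff' measurableSet_Ioc).2 (ae_of_all _ fun s hs => ?_)
          exact mul_nonneg (wt_nonneg hγ _ (Ioc_subset_Icc_self hs)) (sq_nonneg _)
        · exact Continuous.intervalIntegrable (by fun_prop) _ _

theorem LimBd.holder {γ : ℝ} (hγ : 3 < γ) {m : ℕ} {Q : ℕ → Polynomial ℝ} (h : LimBd γ m Q)
    {j : ℕ} (hj : j ≤ m) {r : ℝ} (hr0 : 0 ≤ r) (hr : r < 1) : ∃ L, ∀ n, ∀ x ∈ Icc (-r) r, ∀ y ∈ Icc (-r) r,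
      |dv (Q n) j x - dv (Q n) j y| ≤ L * √|x - y| := by
  obtain ⟨a, ha, K, hK⟩ := h.en j hj
  refine ⟨√(K / wt γ a r), fun n x hx y hy => (abs_dv_sub_le hγ ha hr _ _ hx hy).trans ?_⟩
  have hw := wt_pos hγ a (x := r) ⟨by linarith, hr⟩
  gcongr
  exact hK n

theorem LimBd.tendsto {γ : ℝ} {m : ℕ} {Q : ℕ → Polynomial ℝ} (h : LimBd γ m Q)
    (U : Ultrafilter ℕ) {j : ℕ} (hj : j ≤ m) {x : ℝ} (hx : x ∈ Ioo (-1 : ℝ) 1) :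
    Tendsto (fun n => dv (Q n) j x) U (nhds (lm U Q j x)) := by
  obtain ⟨M, hM⟩ := h.pt j hj x hx
  exact tendsto_limUnder_of_bounded U hM

theorem exists_mem_Icc {x : ℝ} (hx : x ∈ Ioo (-1 : ℝ) 1) :
    ∃ r, 0 ≤ r ∧ r < 1 ∧ Icc (-r) r ∈ nhds x := by
  have hx' : |x| < 1 := abs_lt.2 hx
  refine ⟨(|x| + 1) / 2, by positivity, by linarith, Icc_mem_nhds ?_ ?_⟩
  · linarith [neg_abs_le x]
  · linarith [le_abs_self x]

theorem LimBd.holder_lm {γ : ℝ} (hγ : 3 < γ) {m : ℕ} {Q : ℕ → Polynomial ℝ} (h : LimBd γ m Q)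
    (U : Ultrafilter ℕ) {j : ℕ} (hj : j ≤ m) {r : ℝ} (hr0 : 0 ≤ r) (hr : r < 1) :
    ∃ L, ∀ x ∈ Icc (-r) r, ∀ y ∈ Icc (-r) r, |lm U Q j x - lm U Q j y| ≤ L * √|x - y| := by
  obtain ⟨L, hL⟩ := h.holder hγ hj hr0 hr
  refine ⟨L, fun x hx y hy => ?_⟩
  have hx' : x ∈ Ioo (-1 : ℝ) 1 := ⟨by linarith [hx.1], by linarith [hx.2]⟩
  have hy' : y ∈ Ioo (-1 : ℝ) 1 := ⟨by linarith [hy.1], by linarith [hy.2]⟩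
  exact le_of_tendsto ((h.tendsto U hj hx').sub (h.tendsto U hj hy')).abs
    (Eventually.of_forall fun n => hL n x hx y hy)

theorem continuousAt_of_sqrt_le {g : ℝ → ℝ} {L x : ℝ} {s : Set ℝ} (hs : s ∈ nhds x)
    (hg : ∀ y ∈ s, |g y - g x| ≤ L * √|y - x|) : ContinuousAt g x := by
  rw [ContinuousAt, tendsto_iff_dist_tendsto_zero]
  have h0 : Tendsto (fun y => L * √|y - x|) (nhds x) (nhds 0) := by
    have : ContinuousAt (fun y => L * √|y - x|) x := by fun_prop
    simpa using this.tendsto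
  refine squeeze_zero' (Eventually.of_forall fun n => dist_nonneg) ?_ h0
  filter_upwards [hs] with y hy
  exact hg y hy

theorem LimBd.continuousOn_lm {γ : ℝ} (hγ : 3 < γ) {m : ℕ} {Q : ℕ → Polynomial ℝ}
    (h : LimBd γ m Q) (U : Ultrafilter ℕ) {j : ℕ} (hj : j ≤ m) :
    ContinuousOn (lm U Q j) (Ioo (-1) 1) := fun x hx => by
  obtain ⟨r, hr0, hr, hn⟩ := exists_mem_Icc hx
  obtain ⟨L, hL⟩ := h.holder_lm hγ U hj hr0 hr
  exact (continuousAt_of_sqrt_le hn fun y hy => hL y hy x (mem_of_mem_nhds hn)).continuousWithinAt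

/-- The limits are differentiable, with the limits of the derivatives as derivatives. -/
theorem LimBd.hasDerivAt_lm {γ : ℝ} (hγ : 3 < γ) {m : ℕ} {Q : ℕ → Polynomial ℝ}
    (h : LimBd γ m Q) (U : Ultrafilter ℕ) {j : ℕ} (hj : j < m) {x : ℝ} (hx : x ∈ Ioo (-1 : ℝ) 1) :
    HasDerivAt (lm U Q j) (lm U Q (j + 1) x) x := by
  obtain ⟨r, hr0, hr, hn⟩ := exists_mem_Icc hx
  obtain ⟨L, hL⟩ := h.holder hγ (Nat.succ_le_of_lt hj) hr0 hr
  have hxr := mem_of_mem_nhds hn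
  have hsub : ∀ y ∈ Icc (-r) r, y ∈ Ioo (-1 : ℝ) 1 := fun y hy =>
    ⟨by linarith [hy.1], by linarith [hy.2]⟩
  have hL0 : ∀ n, ∀ y ∈ Icc (-r) r,
      |dv (Q n) j y - dv (Q n) j x - (y - x) * dv (Q n) (j + 1) x| ≤ |L| * √|y - x| * |y - x| := by
    intro n y hy
    have := Convex.norm_image_sub_le_of_norm_hasDerivWithin_le (s := uIcc x y)
      (f := fun s => dv (Q n) j s - s * dv (Q n) (j + 1) x)
      (f' := fun s => dv (Q n) (j + 1) s - dv (Q n) (j + 1) x) (C := |L| * √|y - x|) (x := x) (y := y)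
      (fun s _ => (((hasDerivAt_dv (Q n) j s).sub
        ((hasDerivAt_id s).mul_const _)).congr_deriv (by simp)).hasDerivWithinAt)
      (fun s hs => ?_) (convex_uIcc x y) left_mem_uIcc right_mem_uIcc
    · rw [Real.norm_eq_abs, Real.norm_eq_abs] at this
      refine le_trans (le_of_eq ?_) this
      congr 1
      ring
    · have hsr : s ∈ Icc (-r) r := (convex_Icc (-r) r).ordConnected.uIcc_subset hxr hy hs
      refine (hL n s hsr x hxr).trans ?_
      gcongr ?_ * √?_
      · exact le_abs_self L
      · exact abs_sub_left_of_mem_uIcc hs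
  have hlim : ∀ y ∈ Icc (-r) r,
      |lm U Q j y - lm U Q j x - (y - x) * lm U Q (j + 1) x| ≤ |L| * √|y - x| * |y - x| :=
    fun y hy => le_of_tendsto (((h.tendsto U hj.le (hsub y hy)).sub (h.tendsto U hj.le hx)).sub
      ((h.tendsto U hj hx).const_mul (y - x))).abs (Eventually.of_forall fun n => hL0 n y hy)
  rw [hasDerivAt_iff_isLittleO, Asymptotics.isLittleO_iff]
  intro c hc
  have h0 : Tendsto (fun y => |L| * √|y - x|) (nhds x) (nhds 0) := by
    have : ContinuousAt (fun y => |L| * √|y - x|) x := by fun_prop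
    simpa using this.tendsto
  filter_upwards [hn, h0.eventually (ge_mem_nhds hc)] with y hy hy2
  rw [smul_eq_mul]
  exact (hlim y hy).trans (mul_le_mul_of_nonneg_right hy2 (abs_nonneg _))

theorem LimBd.iteratedDeriv_lm {γ : ℝ} (hγ : 3 < γ) {m : ℕ} {Q : ℕ → Polynomial ℝ}
    (h : LimBd γ m Q) (U : Ultrafilter ℕ) {j : ℕ} (hj : j ≤ m) :
    EqOn (iteratedDeriv j (lm U Q 0)) (lm U Q j) (Ioo (-1) 1) := by
  induction j with
  | zero => intro x _; rw [iteratedDeriv_zero]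
  | succ j ih =>
    intro x hx
    rw [iteratedDeriv_succ, ((ih (by lia)).eventuallyEq_of_mem (isOpen_Ioo.mem_nhds hx)).deriv_eq]
    exact (h.hasDerivAt_lm hγ U hj hx).deriv

/-- The convergence can be realised along an honest sequence of indices, together with that of
countably many further sequences. -/
theorem LimBd.exists_seq {γ : ℝ} (hγ : 3 < γ) {m : ℕ} {Q : ℕ → Polynomial ℝ} (h : LimBd γ m Q)
    (U : Ultrafilter ℕ) {ι : Type*} [Countable ι] (a : ι → ℕ → ℝ) (l : ι → ℝ)
    (ha : ∀ i, Tendsto (a i) U (nhds (l i))) :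
    ∃ k : ℕ → ℕ, (∀ i, Tendsto (fun n => a i (k n)) atTop (nhds (l i))) ∧
      ∀ j ≤ m, ∀ x ∈ Ioo (-1 : ℝ) 1,
        Tendsto (fun n => dv (Q (k n)) j x) atTop (nhds (lm U Q j x)) := by
  obtain ⟨k, hk⟩ := exists_common_seq U
    (ι := ι ⊕ (Fin (m + 1) × {x : ℚ // (x : ℝ) ∈ Ioo (-1 : ℝ) 1}))
    (Sum.elim a fun i n => dv (Q n) i.1 (i.2 : ℚ)) (Sum.elim l fun i => lm U Q i.1 (i.2 : ℚ))
    (by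
      rintro (i | i)
      · exact ha i
      · exact h.tendsto U (Nat.lt_succ_iff.1 i.1.2) i.2.2)
  refine ⟨k, fun i => hk (Sum.inl i), fun j hj x hx => ?_⟩
  obtain ⟨r, hr0, hr, hn⟩ := exists_mem_Icc hx
  obtain ⟨L, hL⟩ := h.holder hγ hj hr0 hr
  obtain ⟨L', hL'⟩ := h.holder_lm hγ U hj hr0 hr
  have hxr := mem_of_mem_nhds hn
  rw [Metric.tendsto_nhds]
  intro ε hε
  have h0 : Tendsto (fun y => (|L| + |L'|) * √|y - x|) (nhds x) (nhds 0) := by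
    have : ContinuousAt (fun y => (|L| + |L'|) * √|y - x|) x := by fun_prop
    simpa using this.tendsto
  obtain ⟨q, hq, hqr, hq1⟩ : ∃ q : ℚ, (|L| + |L'|) * √|(q : ℝ) - x| < ε / 2 ∧ (q : ℝ) ∈ Icc (-r) r ∧
      (q : ℝ) ∈ Ioo (-1 : ℝ) 1 := by
    have hmem := Filter.inter_mem (h0.eventually (gt_mem_nhds (half_pos hε)))
      (Filter.inter_mem hn (Ioo_mem_nhds hx.1 hx.2))
    obtain ⟨q, hq⟩ := Rat.denseRange_cast.exists_mem_open isOpen_interior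
      ⟨x, mem_interior_iff_mem_nhds.2 hmem⟩
    have hy := interior_subset hq
    exact ⟨q, hy.1, hy.2.1, hy.2.2⟩
  filter_upwards [Metric.tendsto_nhds.1 (hk (Sum.inr (⟨j, Nat.lt_succ_of_le hj⟩, ⟨q, hq1⟩))) _
    (half_pos hε)] with n hn'
  simp only [Sum.elim_inr, Real.dist_eq] at hn' ⊢
  have h1 := hL (k n) q hqr x hxr
  have h2 := hL' q hqr x hxr
  have h3 := le_abs_self L
  have h4 := le_abs_self L'
  have h5 := Real.sqrt_nonneg |(q : ℝ) - x|
  have h6 : L * √|(q : ℝ) - x| + L' * √|(q : ℝ) - x| ≤ (|L| + |L'|) * √|(q : ℝ) - x| := by nlinarith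
  rw [abs_le] at h1 h2
  rw [abs_lt] at hn' ⊢
  constructor <;> linarith [h1.1, h1.2, h2.1, h2.2, hn'.1, hn'.2]

theorem integral_swap_of_continuous {F : ℝ → ℝ → ℝ} (hF : Continuous (Function.uncurry F))
    {a b c d : ℝ} (hab : a ≤ b) (hcd : c ≤ d) :
    ∫ x in a..b, (∫ s in c..d, F x s) = ∫ s in c..d, (∫ x in a..b, F x s) := by
  simp only [intervalIntegral.integral_of_le hab, intervalIntegral.integral_of_le hcd]
  apply integral_integral_swap
  rw [Measure.prod_restrict]
  exact (hF.continuousOn.integrableOn_compact (isCompact_Icc.prod isCompact_Icc)).mono_set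
    (prod_mono Ioc_subset_Icc_self Ioc_subset_Icc_self)

/-- Fatou's lemma for a convergent sequence. -/
theorem lintegral_le_of_tendsto {X : Type*} [MeasurableSpace X] {μ : Measure X}
    {F : ℕ → X → ENNReal} {G : X → ENNReal} {K : ENNReal} (hF : ∀ n, AEMeasurable (F n) μ)
    (hK : ∀ n, ∫⁻ x, F n x ∂μ ≤ K)
    (hG : ∀ᵐ x ∂μ, Tendsto (fun n => F n x) atTop (nhds (G x))) : ∫⁻ x, G x ∂μ ≤ K := by
  calc ∫⁻ x, G x ∂μ = ∫⁻ x, liminf (fun n => F n x) atTop ∂μ :=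
        lintegral_congr_ae (hG.mono fun x hx => hx.liminf_eq.symm)
    _ ≤ liminf (fun n => ∫⁻ x, F n x ∂μ) atTop := lintegral_liminf_le' hF
    _ ≤ K := by
        refine liminf_le_of_le (by isBoundedDefault) fun b hb => ?_
        obtain ⟨n, hn⟩ := hb.exists
        exact hn.trans (hK n)

theorem integral_le_of_lintegral_le {X : Type*} [MeasurableSpace X] {μ : Measure X} {G : X → ℝ}
    {K : ℝ} (h0 : 0 ≤ᵐ[μ] G) (hK : 0 ≤ K) (h : ∫⁻ x, ENNReal.ofReal (G x) ∂μ ≤ ENNReal.ofReal K) :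
    ∫ x, G x ∂μ ≤ K := by
  by_cases hi : Integrable G μ
  · rw [integral_eq_lintegral_of_nonneg_ae h0 hi.aestronglyMeasurable]
    exact ENNReal.toReal_le_of_le_ofReal hK h
  · rwa [integral_undef hi]

theorem lintegral_Ω₀_eq {f : ℝ → ℝ} (hf : ContinuousOn f (Icc (-1) 1))
    (h0 : ∀ x ∈ Icc (-1 : ℝ) 1, 0 ≤ f x) :
    ∫⁻ x in Ω₀, ENNReal.ofReal (f x) = ENNReal.ofReal (∫ x in (-1 : ℝ)..1, f x) := by
  rw [← setIntegral_Ω₀, ofReal_integral_eq_lintegral_ofReal]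
  · exact (hf.integrableOn_compact isCompact_Icc).mono_set Ioo_subset_Icc_self
  · exact (ae_restrict_iff' measurableSet_Ioo).2
      (ae_of_all _ fun x hx => h0 x (Ioo_subset_Icc_self hx))

theorem LimBd.integral_lm_le {γ : ℝ} (hγ : 3 < γ) {m : ℕ} {Q : ℕ → Polynomial ℝ}
    (h : LimBd γ m Q) (U : Ultrafilter ℕ) {j : ℕ} (hj : j ≤ m) {a K : ℝ} (ha : 0 ≤ a)
    (hK : ∀ n, J γ a (Q n) j ≤ K) : ∫ x in Ω₀, wt γ a x * iteratedDeriv j (lm U Q 0) x ^ 2 ≤ K := by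
  obtain ⟨k, -, hk⟩ := h.exists_seq hγ U (ι := Empty) (fun i => i.elim) (fun i => i.elim)
    (fun i => i.elim)
  have w := continuous_wt γ ha
  rw [setIntegral_congr_fun (s := Ω₀) measurableSet_Ioo fun x hx => by
    simp only [h.iteratedDeriv_lm hγ U hj hx]; rfl]
  apply integral_le_of_lintegral_le
  · exact (ae_restrict_iff' measurableSet_Ioo).2 (ae_of_all _ fun x hx =>
      mul_nonneg (wt_nonneg hγ _ (Ioo_subset_Icc_self hx)) (sq_nonneg _))
  · exact (J_nonneg hγ _ _ _).trans (hK 0)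
  · refine lintegral_le_of_tendsto
      (F := fun n x => ENNReal.ofReal (wt γ a x * dv (Q (k n)) j x ^ 2)) (fun n => ?_) (fun n => ?_) ?_
    · have := continuous_dv (Q (k n)) j
      exact (Continuous.measurable (by fun_prop :
        Continuous fun x => wt γ a x * dv (Q (k n)) j x ^ 2)).ennreal_ofReal.aemeasurable
    · have := continuous_dv (Q (k n)) j
      rw [lintegral_Ω₀_eq (by fun_prop)
        fun x hx => mul_nonneg (wt_nonneg hγ _ hx) (sq_nonneg _)]
      exact ENNReal.ofReal_le_ofReal (hK (k n))
    · refine (ae_restrict_iff' measurableSet_Ioo).2 (ae_of_all _ fun x hx => ?_)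
      exact ENNReal.tendsto_ofReal (((hk j hj x hx).pow 2).const_mul _)

/-- Difference quotients along the scaling `x ↦ l x`, `l < 1`, are controlled by the derivative. -/
theorem lintegral_scaling_le {γ : ℝ} (hγ : 3 < γ) {a : ℝ} (ha : 0 ≤ a) {u u' : ℝ → ℝ}
    (hu : ∀ x, HasDerivAt u (u' x) x) (hc : Continuous u') {l : ℝ} (hl : l ∈ Ioo (0 : ℝ) 1) :
    ∫⁻ x in Ω₀, ENNReal.ofReal (wt γ a x * ((u (l * x) - u x) / ((l - 1) * x)) ^ 2) ≤
      ENNReal.ofReal ((∫ x in (-1 : ℝ)..1, wt γ a x * u' x ^ 2) / l) := by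
  have w := continuous_wt γ ha
  have hl1 : 0 < 1 - l := by linarith [hl.2]
  set g : ℝ → ℝ := fun x => ∫ s in l..1, wt γ a x * u' (s * x) ^ 2 with hg
  have cF : Continuous (Function.uncurry fun x s => wt γ a x * u' (s * x) ^ 2) := by
    unfold Function.uncurry; fun_prop
  have cg : Continuous g := intervalIntegral.continuous_parametric_intervalIntegral_of_continuous' cF _ _
  have h1 : ∀ x ∈ Ω₀, wt γ a x * ((u (l * x) - u x) / ((l - 1) * x)) ^ 2 ≤ (1 - l)⁻¹ * g x := by
    intro x hx
    have hw := wt_nonneg hγ a (Ioo_subset_Icc_self hx)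
    have h2 := sub_sq_le_integral (u := fun s => u (s * x)) (u' := fun s => u' (s * x) * x)
      (fun s => (hu (s * x)).comp s ((hasDerivAt_id s).mul_const x |>.congr_deriv (one_mul x)))
      (by fun_prop) hl.2.le
    simp only [mul_pow, one_mul] at h2
    rw [intervalIntegral.integral_mul_const] at h2
    simp only [hg, intervalIntegral.integral_const_mul]
    set I := ∫ s in l..1, u' (s * x) ^ 2
    have hI : 0 ≤ I := intervalIntegral.integral_nonneg hl.2.le fun s _ => sq_nonneg _
    rw [show (1 - l)⁻¹ * (wt γ a x * I) = wt γ a x * ((1 - l)⁻¹ * I) by ring]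
    apply mul_le_mul_of_nonneg_left _ hw
    rcases eq_or_ne x 0 with rfl | hx0
    · exact le_trans (by simp) (mul_nonneg (inv_nonneg.2 hl1.le) hI)
    have hne : (l - 1) * x ≠ 0 := mul_ne_zero (by linarith) hx0
    rw [div_pow, div_le_iff₀ ((sq_nonneg _).lt_of_ne' (pow_ne_zero 2 hne))]
    have e : (1 - l)⁻¹ * I * ((l - 1) * x) ^ 2 = (1 - l) * (I * x ^ 2) := by field_simp; ring
    rw [e]
    linarith
  have h0 : ∀ x ∈ Icc (-1 : ℝ) 1, 0 ≤ g x := fun x hx =>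
    intervalIntegral.integral_nonneg hl.2.le fun s _ =>
      mul_nonneg (wt_nonneg hγ _ hx) (sq_nonneg _)
  calc _ ≤ ∫⁻ x in Ω₀, ENNReal.ofReal ((1 - l)⁻¹ * g x) :=
        setLIntegral_mono' measurableSet_Ioo fun x hx => ENNReal.ofReal_le_ofReal (h1 x hx)
    _ = ENNReal.ofReal ((1 - l)⁻¹ * ∫ x in (-1 : ℝ)..1, g x) := by
        rw [lintegral_Ω₀_eq (by fun_prop) fun x hx => mul_nonneg (by positivity) (h0 x hx),
          intervalIntegral.integral_const_mul]
    _ ≤ _ := ENNReal.ofReal_le_ofReal ?_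
  rw [hg, integral_swap_of_continuous cF (by norm_num) hl.2.le, inv_mul_le_iff₀ hl1]
  set I := ∫ x in (-1 : ℝ)..1, wt γ a x * u' x ^ 2
  have hI : 0 ≤ I := iint_nonneg fun x hx => mul_nonneg (wt_nonneg hγ _ hx) (sq_nonneg _)
  have : (1 - l) * (I / l) = ∫ _ in l..1, I / l := by
    rw [intervalIntegral.integral_const, smul_eq_mul]
  rw [this]
  apply intervalIntegral.integral_mono_on hl.2.le
  · exact (intervalIntegral.continuous_parametric_intervalIntegral_of_continuous'
      (f := fun s x => wt γ a x * u' (s * x) ^ 2)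
      (by unfold Function.uncurry; fun_prop) _ _).intervalIntegrable _ _
  · exact intervalIntegrable_const
  intro s hs
  have hs0 : 0 < s := hl.1.trans_le hs.1
  calc ∫ x in (-1 : ℝ)..1, wt γ a x * u' (s * x) ^ 2
      ≤ ∫ x in (-1 : ℝ)..1, wt γ a (s * x) * u' (s * x) ^ 2 := by
        apply iint_mono (by fun_prop) (by fun_prop)
        intro x hx
        apply mul_le_mul_of_nonneg_right _ (sq_nonneg _)
        unfold wt
        apply Real.rpow_le_rpow (ddg_nonneg hγ hx) _ ha
        rw [ddg_eq, ddg_eq, mul_pow]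
        have := mu_gt hγ
        have h5 : s ^ 2 ≤ 1 := pow_le_one₀ hs0.le hs.2
        nlinarith [mul_le_mul_of_nonneg_right h5 (sq_nonneg x)]
    _ = s⁻¹ * ∫ x in -s..s, wt γ a x * u' x ^ 2 := by
        rw [intervalIntegral.integral_comp_mul_left (fun y => wt γ a y * u' y ^ 2) hs0.ne']
        simp
    _ ≤ s⁻¹ * I := by
        apply mul_le_mul_of_nonneg_left _ (by positivity)
        apply intervalIntegral.integral_mono_interval (by linarith [hs.2]) (by linarith) hs.2
        · refine (ae_restrict_iff' measurableSet_Ioc).2 (ae_of_all _ fun s hs => ?_)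
          exact mul_nonneg (wt_nonneg hγ _ (Ioc_subset_Icc_self hs)) (sq_nonneg _)
        · exact Continuous.intervalIntegrable (by fun_prop) _ _
    _ ≤ I / l := by
        rw [div_eq_mul_inv, mul_comm]
        exact mul_le_mul_of_nonneg_left (inv_anti₀ hl.1 hs.1) hI

theorem mul_mem_Ω₀ {l x : ℝ} (hl : l ∈ Ioo (0 : ℝ) 1) (hx : x ∈ Ω₀) : l * x ∈ Ioo (-1 : ℝ) 1 := by
  have h1 : |x| < 1 := abs_lt.2 hx
  refine abs_lt.1 ?_
  rw [abs_mul, abs_of_pos hl.1]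
  nlinarith [hl.1, hl.2, abs_nonneg x]

/-- The energy bound passes to the (almost everywhere) derivative of top order. -/
theorem LimBd.integral_top_le {γ : ℝ} (hγ : 3 < γ) {m : ℕ} {Q : ℕ → Polynomial ℝ}
    (h : LimBd γ m Q) (U : Ultrafilter ℕ) {a K : ℝ} (ha : 0 ≤ a)
    (hK : ∀ n, J γ a (Q n) (m + 1) ≤ K) :
    ∫ x in Ω₀, wt γ a x * iteratedDeriv (m + 1) (lm U Q 0) x ^ 2 ≤ K := by
  obtain ⟨k, -, hk⟩ := h.exists_seq hγ U (ι := Empty) (fun i => i.elim) (fun i => i.elim)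
    (fun i => i.elim)
  have w := continuous_wt γ ha
  set g := lm U Q m
  have cg : ContinuousOn g (Ioo (-1) 1) := h.continuousOn_lm hγ U le_rfl
  have hK0 : 0 ≤ K := (J_nonneg hγ _ _ _).trans (hK 0)
  rw [setIntegral_congr_fun (g := fun x => wt γ a x * deriv g x ^ 2) (s := Ω₀) measurableSet_Ioo fun x hx => by
    simp only [iteratedDeriv_succ,
      ((h.iteratedDeriv_lm hγ U le_rfl).eventuallyEq_of_mem (isOpen_Ioo.mem_nhds hx)).deriv_eq]; rfl]
  have cq : ∀ l ∈ Ioo (0 : ℝ) 1, AEMeasurable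
      (fun x => ENNReal.ofReal (wt γ a x * ((g (l * x) - g x) / ((l - 1) * x)) ^ 2))
      (volume.restrict Ω₀) := fun l hl => by
    apply AEMeasurable.ennreal_ofReal
    have m1 : AEMeasurable g (volume.restrict Ω₀) := cg.aemeasurable measurableSet_Ioo
    have m2 : AEMeasurable (fun x => g (l * x)) (volume.restrict Ω₀) :=
      (cg.comp (by fun_prop : ContinuousOn (fun x : ℝ => l * x) Ω₀)
        fun x hx => mul_mem_Ω₀ hl hx).aemeasurable measurableSet_Ioo
    have m3 : AEMeasurable (fun x : ℝ => (l - 1) * x) (volume.restrict Ω₀) := by fun_prop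
    have m4 : AEMeasurable (wt γ a) (volume.restrict Ω₀) := w.aemeasurable
    exact m4.mul (((m2.sub m1).div m3).pow_const 2)
  have step : ∀ l ∈ Ioo (0 : ℝ) 1,
      ∫⁻ x in Ω₀, ENNReal.ofReal (wt γ a x * ((g (l * x) - g x) / ((l - 1) * x)) ^ 2) ≤
        ENNReal.ofReal (K / l) := fun l hl => by
    refine lintegral_le_of_tendsto (F := fun n x => ENNReal.ofReal
      (wt γ a x * ((dv (Q (k n)) m (l * x) - dv (Q (k n)) m x) / ((l - 1) * x)) ^ 2))
      (fun n => ?_) (fun n => ?_) ?_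
    · have := (continuous_dv (Q (k n)) m).measurable
      have := w.measurable
      exact Measurable.aemeasurable (by fun_prop)
    · refine (lintegral_scaling_le hγ ha (hasDerivAt_dv (Q (k n)) m) (continuous_dv _ _) hl).trans
        (ENNReal.ofReal_le_ofReal ?_)
      exact div_le_div_of_nonneg_right (hK (k n)) hl.1.le
    · refine (ae_restrict_iff' measurableSet_Ioo).2 (ae_of_all _ fun x hx => ?_)
      exact ENNReal.tendsto_ofReal ((((hk m le_rfl _ (mul_mem_Ω₀ hl hx)).sub
        (hk m le_rfl x hx)).div_const _).pow 2 |>.const_mul _)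
  set S := {x | DifferentiableAt ℝ g x}
  have mS : MeasurableSet S := measurableSet_of_differentiableAt ℝ g
  set l : ℕ → ℝ := fun i => 1 - 1 / ((i : ℝ) + 1 + 1) with hl
  have hl0 : ∀ i, l i ∈ Ioo (0 : ℝ) 1 := fun i => by
    have : (0 : ℝ) < (i : ℝ) + 1 + 1 := by positivity
    refine ⟨?_, ?_⟩
    · rw [hl]; simp only [sub_pos]; rw [div_lt_one this]; linarith [(Nat.cast_nonneg i : (0 : ℝ) ≤ i)]
    · rw [hl]; simp only; linarith [one_div_pos.2 this]
  have hl1 : Tendsto l atTop (nhds 1) := by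
    have := (tendsto_one_div_add_atTop_nhds_zero_nat (𝕜 := ℝ)).comp (tendsto_add_atTop_nat 1)
    simpa [hl, Function.comp_def] using this.const_sub 1
  have hbd : ∀ e > (0 : ℝ), ∫⁻ x in Ω₀, ENNReal.ofReal (wt γ a x * deriv g x ^ 2) ≤
      ENNReal.ofReal (K + e) := by
    intro e he
    have h1 : Tendsto (fun i => K / l i) atTop (nhds (K / 1)) := tendsto_const_nhds.div hl1 one_ne_zero
    rw [div_one] at h1
    obtain ⟨i0, hi0⟩ := eventually_atTop.1 (h1.eventually (ge_mem_nhds (by linarith : K < K + e)))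
    refine lintegral_le_of_tendsto (F := fun i => S.indicator fun x => ENNReal.ofReal
      (wt γ a x * ((g (l (i + i0) * x) - g x) / ((l (i + i0) - 1) * x)) ^ 2))
      (fun i => (cq _ (hl0 _)).indicator mS) (fun i => ?_) ?_
    · refine (lintegral_mono fun x => indicator_le_self _ _ _).trans
        ((step _ (hl0 _)).trans (ENNReal.ofReal_le_ofReal (hi0 _ (by lia))))
    · have hne : ∀ᵐ x ∂(volume.restrict Ω₀), x ≠ 0 := ae_restrict_of_ae (by simp [ae_iff])
      filter_upwards [hne] with x hx0
      by_cases hxS : x ∈ S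
      · simp only [indicator_of_mem hxS]
        refine ENNReal.tendsto_ofReal (Tendsto.const_mul _ (Tendsto.pow ?_ 2))
        have hd := (hasDerivAt_iff_tendsto_slope.1 (DifferentiableAt.hasDerivAt hxS))
        have ht : Tendsto (fun i => l (i + i0) * x) atTop (nhdsWithin x {x}ᶜ) := by
          refine tendsto_nhdsWithin_iff.2 ⟨?_, Eventually.of_forall fun i => ?_⟩
          · simpa using (hl1.comp (tendsto_add_atTop_nat i0)).mul_const x
          · have := (hl0 (i + i0)).2.ne
            simpa [hx0] using this
        refine (hd.comp ht).congr fun i => ?_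
        simp only [Function.comp, slope_def_field]
        congr 1
        ring
      · simp only [indicator_of_notMem hxS]
        rw [deriv_zero_of_not_differentiableAt hxS]
        simp
  refine le_of_forall_pos_le_add fun e he => ?_
  apply integral_le_of_lintegral_le _ (by linarith) (hbd e he)
  exact (ae_restrict_iff' measurableSet_Ioo).2 (ae_of_all _ fun x hx =>
      mul_nonneg (wt_nonneg hγ _ (Ioo_subset_Icc_self hx)) (sq_nonneg _))

/-- The kernel `r ^ (β - 2)`, cut off at `c`. -/
def cutKernel (b c : ℝ) : ℝ → ENNReal := (Ioi c).indicator fun r => ENNReal.ofReal (r ^ (b - 2))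

theorem lintegral_cutKernel_le {b c : ℝ} (hb : b < 1) (hc : 0 < c) :
    ∫⁻ r, cutKernel b c r ≤ ENNReal.ofReal (c ^ (b - 1) / (1 - b)) := by
  unfold cutKernel
  rw [lintegral_indicator measurableSet_Ioi, ← ofReal_integral_eq_lintegral_ofReal
    (integrableOn_Ioi_rpow_of_lt (by linarith) hc)
    ((ae_restrict_iff' measurableSet_Ioi).2 (ae_of_all _ fun x hx =>
      Real.rpow_nonneg (hc.le.trans (mem_Ioi.1 hx).le) _)), integral_Ioi_rpow_of_lt (by linarith) hc]
  apply le_of_eq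
  rw [show b - 2 + 1 = b - 1 by ring, neg_div, ← div_neg]
  congr 2
  ring

theorem lintegral_rpow_sub_one_le {b c : ℝ} (hb : 0 < b) (hb1 : b < 1) (hc : 0 ≤ c) :
    ∫⁻ r, (Ioo 0 c).indicator (fun r => ENNReal.ofReal (r ^ (b - 1) / (1 - b))) r ≤
      ENNReal.ofReal (c ^ b / (b * (1 - b))) := by
  have hi : IntervalIntegrable (fun r : ℝ => r ^ (b - 1) / (1 - b)) volume 0 c :=
    (intervalIntegral.intervalIntegrable_rpow' (by linarith)).div_const _
  rw [lintegral_indicator measurableSet_Ioo, ← ofReal_integral_eq_lintegral_ofReal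
    (((intervalIntegrable_iff_integrableOn_Ioo_of_le hc).1 hi))
    ((ae_restrict_iff' measurableSet_Ioo).2 (ae_of_all _ fun x hx =>
      div_nonneg (Real.rpow_nonneg hx.1.le _) (by linarith))),
    ← integral_Ioc_eq_integral_Ioo, ← intervalIntegral.integral_of_le hc,
    intervalIntegral.integral_div, integral_rpow (Or.inl (by linarith))]
  apply le_of_eq
  rw [sub_add_cancel, Real.zero_rpow hb.ne', sub_zero, div_div]

/-- The kernel `|x - y| ^ (β - 2)` restricted to pairs separated by `s`. -/
def sepKernel (b x y s : ℝ) : ENNReal :=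
  if x < s ∧ s < y then ENNReal.ofReal ((y - x) ^ (b - 2)) else 0

theorem measurable_sepKernel {X : Type*} [MeasurableSpace X] (b : ℝ) {f g h : X → ℝ}
    (hf : Measurable f) (hg : Measurable g) (hh : Measurable h) :
    Measurable fun p => sepKernel b (f p) (g p) (h p) :=
  Measurable.ite ((measurableSet_lt hf hh).inter (measurableSet_lt hh hg)) (by fun_prop)
    measurable_const

theorem lintegral_sepKernel_le_left {b : ℝ} (hb : 0 < b) (hb1 : b < 1) {s : ℝ} (hs : s ∈ Ω₀) :
    ∫⁻ x in Ω₀, ∫⁻ y in Ω₀, sepKernel b x y s ≤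
      ENNReal.ofReal ((s + 1) ^ b / (b * (1 - b))) := by
  refine le_trans ?_ (lintegral_rpow_sub_one_le hb hb1 (by linarith [hs.1] : 0 ≤ s + 1))
  rw [← lintegral_sub_left_eq_self (μ := volume) ((Ioo 0 (s + 1)).indicator _) s]
  refine le_trans (setLIntegral_mono' measurableSet_Ioo fun x hx => ?_) (setLIntegral_le_lintegral _ _)
  by_cases hxs : x < s
  · rw [indicator_of_mem (show s - x ∈ Ioo 0 (s + 1) from ⟨by linarith, by linarith [hx.1]⟩)]
    refine le_trans ?_ (lintegral_cutKernel_le hb1 (by linarith : 0 < s - x))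
    rw [← lintegral_sub_right_eq_self (cutKernel b (s - x)) x]
    refine (setLIntegral_le_lintegral _ _).trans (lintegral_mono fun y => ?_)
    by_cases hy : s < y
    · rw [cutKernel, indicator_of_mem (by rw [mem_Ioi]; linarith), sepKernel, if_pos ⟨hxs, hy⟩]
    · rw [sepKernel, if_neg (by tauto)]
      exact zero_le
  · have : ∀ y, sepKernel b x y s = 0 := fun y => by rw [sepKernel, if_neg (by tauto)]
    simp [this]

theorem lintegral_sepKernel_le_right {b : ℝ} (hb : 0 < b) (hb1 : b < 1) {s : ℝ} (hs : s ∈ Ω₀) :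
    ∫⁻ x in Ω₀, ∫⁻ y in Ω₀, sepKernel b x y s ≤
      ENNReal.ofReal ((1 - s) ^ b / (b * (1 - b))) := by
  rw [lintegral_lintegral_swap (f := fun x y => sepKernel b x y s)
    (measurable_sepKernel b measurable_fst measurable_snd measurable_const).aemeasurable]
  refine le_trans ?_ (lintegral_rpow_sub_one_le hb hb1 (by linarith [hs.2] : 0 ≤ 1 - s))
  rw [← lintegral_sub_right_eq_self (μ := volume) ((Ioo 0 (1 - s)).indicator _) s]
  refine le_trans (setLIntegral_mono' measurableSet_Ioo fun y hy => ?_) (setLIntegral_le_lintegral _ _)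
  by_cases hys : s < y
  · rw [indicator_of_mem (show y - s ∈ Ioo 0 (1 - s) from ⟨by linarith, by linarith [hy.2]⟩)]
    refine le_trans ?_ (lintegral_cutKernel_le hb1 (by linarith : 0 < y - s))
    rw [← lintegral_sub_left_eq_self (cutKernel b (y - s)) y]
    refine (setLIntegral_le_lintegral _ _).trans (lintegral_mono fun x => ?_)
    by_cases hx : x < s
    · rw [cutKernel, indicator_of_mem (by rw [mem_Ioi]; linarith), sepKernel, if_pos ⟨hx, hys⟩]
    · rw [sepKernel, if_neg (by tauto)]
      exact zero_le
  · have : ∀ x, sepKernel b x y s = 0 := fun x => by rw [sepKernel, if_neg (by tauto)]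
    simp [this]

theorem lintegral_sepKernel_le {γ : ℝ} (hγ : 3 < γ) : ∃ C > (0 : ℝ), ∀ s ∈ Ω₀,
    ∫⁻ x in Ω₀, ∫⁻ y in Ω₀, sepKernel (bt γ) x y s ≤ ENNReal.ofReal (C * wt γ (bt γ) s) := by
  have hb := bt_pos hγ
  have hb1 := bt_lt_half hγ
  have hm := mu_gt hγ
  refine ⟨(1 / mu γ) ^ bt γ / (bt γ * (1 - bt γ)),
    div_pos (Real.rpow_pos_of_pos (by positivity) _) (mul_pos hb (by linarith)), fun s hs => ?_⟩
  have hd := ddg_pos hγ hs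
  have e : (1 / mu γ) ^ bt γ / (bt γ * (1 - bt γ)) * wt γ (bt γ) s =
      (1 - s ^ 2) ^ bt γ / (bt γ * (1 - bt γ)) := by
    have : (1 - s ^ 2) = 1 / mu γ * ddg γ s := by
      rw [ddg_eq]; field_simp
    rw [this, Real.mul_rpow (by positivity) hd.le, wt]
    ring
  rw [e]
  have hden : 0 < bt γ * (1 - bt γ) := mul_pos hb (by linarith)
  rcases le_total s 0 with h | h
  · refine (lintegral_sepKernel_le_left hb (by linarith) hs).trans (ENNReal.ofReal_le_ofReal ?_)
    apply div_le_div_of_nonneg_right _ hden.le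
    exact Real.rpow_le_rpow (by linarith [hs.1]) (by nlinarith [hs.1, hs.2]) hb.le
  · refine (lintegral_sepKernel_le_right hb (by linarith) hs).trans (ENNReal.ofReal_le_ofReal ?_)
    apply div_le_div_of_nonneg_right _ hden.le
    exact Real.rpow_le_rpow (by linarith [hs.2]) (by nlinarith [hs.1, hs.2]) hb.le

theorem ofReal_sub_sq_div_le {u u' : ℝ → ℝ} (hu : ∀ x, HasDerivAt u (u' x) x) (hc : Continuous u')
    (b : ℝ) {x y : ℝ} (hx : x ∈ Ω₀) (hy : y ∈ Ω₀) (hxy : x < y) :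
    ENNReal.ofReal ((u x - u y) ^ 2 / |x - y| ^ (3 - b)) ≤
      ∫⁻ s in Ω₀, sepKernel b x y s * ENNReal.ofReal (u' s ^ 2) := by
  have h0 : 0 < y - x := by linarith
  have h1 : (u x - u y) ^ 2 / |x - y| ^ (3 - b) ≤ (y - x) ^ (b - 2) * ∫ s in x..y, u' s ^ 2 := by
    rw [abs_sub_comm, abs_of_pos h0, div_le_iff₀ (Real.rpow_pos_of_pos h0 _),
      show (u x - u y) ^ 2 = (u y - u x) ^ 2 by ring]
    refine (sub_sq_le_integral hu hc hxy.le).trans (le_of_eq ?_)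
    rw [mul_right_comm, ← Real.rpow_add h0, show b - 2 + (3 - b) = 1 by ring, Real.rpow_one]
  refine (ENNReal.ofReal_le_ofReal h1).trans ?_
  rw [ENNReal.ofReal_mul (Real.rpow_nonneg h0.le _), intervalIntegral.integral_of_le hxy.le,
    integral_Ioc_eq_integral_Ioo, ofReal_integral_eq_lintegral_ofReal
      ((Continuous.integrableOn_Icc (by fun_prop)).mono_set Ioo_subset_Icc_self)
      (ae_of_all _ fun s => sq_nonneg _),
    ← lintegral_const_mul _ (by fun_prop), ← lintegral_indicator measurableSet_Ioo,
    ← lintegral_indicator (s := Ω₀) measurableSet_Ioo]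
  refine lintegral_mono fun s => ?_
  by_cases hs : s ∈ Ioo x y
  · have hs' : s ∈ Ioo (-1 : ℝ) 1 := ⟨hx.1.trans hs.1, hs.2.trans hy.2⟩
    rw [indicator_of_mem hs, Ω₀, indicator_of_mem hs', sepKernel, if_pos (show x < s ∧ s < y from hs)]
  · rw [indicator_of_notMem hs]
    exact zero_le

/-- Fractional Sobolev regularity of order `1 - β / 2` from the weight `d ^ β` on the derivative. -/
theorem lintegral_gagliardo_le {γ : ℝ} (hγ : 3 < γ) : ∃ C > (0 : ℝ), ∀ u u' : ℝ → ℝ,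
    (∀ x, HasDerivAt u (u' x) x) → Continuous u' →
    ∫⁻ x in Ω₀, ∫⁻ y in Ω₀, ENNReal.ofReal ((u x - u y) ^ 2 / |x - y| ^ (3 - bt γ)) ≤
      ENNReal.ofReal (C * ∫ x in (-1 : ℝ)..1, wt γ (bt γ) x * u' x ^ 2) := by
  obtain ⟨C, hC, hk⟩ := lintegral_sepKernel_le hγ
  have hb := bt_pos hγ
  have w := continuous_wt γ hb.le
  refine ⟨2 * C, by positivity, fun u u' hu hc => ?_⟩
  set H : ℝ → ℝ → ENNReal := fun x y =>
    ∫⁻ s in Ω₀, sepKernel (bt γ) x y s * ENNReal.ofReal (u' s ^ 2) with hH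
  have m3 : Measurable fun p : (ℝ × ℝ) × ℝ =>
      sepKernel (bt γ) p.1.1 p.1.2 p.2 * ENNReal.ofReal (u' p.2 ^ 2) := by
    apply Measurable.mul
    · exact measurable_sepKernel (bt γ) (by fun_prop) (by fun_prop) (by fun_prop)
    · fun_prop
  have mH : Measurable (Function.uncurry H) := m3.lintegral_prod_right'
  have hHC : ∫⁻ x in Ω₀, ∫⁻ y in Ω₀, H x y ≤
      ENNReal.ofReal (C * ∫ x in (-1 : ℝ)..1, wt γ (bt γ) x * u' x ^ 2) := by
    calc ∫⁻ x in Ω₀, ∫⁻ y in Ω₀, H x y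
        = ∫⁻ p, H p.1 p.2 ∂((volume.restrict Ω₀).prod (volume.restrict Ω₀)) :=
          (lintegral_prod _ mH.aemeasurable).symm
      _ = ∫⁻ s in Ω₀, ∫⁻ p, sepKernel (bt γ) p.1 p.2 s * ENNReal.ofReal (u' s ^ 2)
            ∂((volume.restrict Ω₀).prod (volume.restrict Ω₀)) :=
          lintegral_lintegral_swap m3.aemeasurable
      _ ≤ ∫⁻ s in Ω₀, ENNReal.ofReal (C * (wt γ (bt γ) s * u' s ^ 2)) := by
          refine setLIntegral_mono' measurableSet_Ioo fun s hs => ?_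
          have ms : Measurable fun p : ℝ × ℝ => sepKernel (bt γ) p.1 p.2 s :=
            measurable_sepKernel (bt γ) measurable_fst measurable_snd measurable_const
          rw [lintegral_mul_const _ ms, lintegral_prod _ ms.aemeasurable, ← mul_assoc,
            ENNReal.ofReal_mul' (sq_nonneg _)]
          exact mul_le_mul_left (hk s hs) _
      _ = _ := by
          rw [lintegral_Ω₀_eq (by fun_prop) fun x hx => mul_nonneg hC.le
            (mul_nonneg (wt_nonneg hγ _ hx) (sq_nonneg _)), intervalIntegral.integral_const_mul]
  have hF : ∀ x ∈ Ω₀, ∀ y ∈ Ω₀,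
      ENNReal.ofReal ((u x - u y) ^ 2 / |x - y| ^ (3 - bt γ)) ≤ H x y + H y x := by
    intro x hx y hy
    rcases lt_trichotomy x y with h | h | h
    · exact (ofReal_sub_sq_div_le hu hc _ hx hy h).trans le_self_add
    · simp [h]
    · rw [abs_sub_comm, show (u x - u y) ^ 2 = (u y - u x) ^ 2 by ring]
      exact (ofReal_sub_sq_div_le hu hc _ hy hx h).trans le_add_self
  calc _ ≤ ∫⁻ x in Ω₀, ∫⁻ y in Ω₀, (H x y + H y x) :=
        setLIntegral_mono' measurableSet_Ioo fun x hx =>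
          setLIntegral_mono' measurableSet_Ioo fun y hy => hF x hx y hy
    _ = (∫⁻ x in Ω₀, ∫⁻ y in Ω₀, H x y) + ∫⁻ x in Ω₀, ∫⁻ y in Ω₀, H y x := by
        refine Eq.trans (lintegral_congr fun x => ?_) (lintegral_add_left
          (mH.lintegral_prod_right' (ν := volume.restrict Ω₀)) fun x => ∫⁻ y in Ω₀, H y x)
        exact lintegral_add_left (mH.comp measurable_prodMk_left) _
    _ = (∫⁻ x in Ω₀, ∫⁻ y in Ω₀, H x y) + ∫⁻ x in Ω₀, ∫⁻ y in Ω₀, H x y := by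
        congr 1
        exact lintegral_lintegral_swap (mH.comp measurable_swap).aemeasurable
    _ ≤ _ := add_le_add hHC hHC
    _ = _ := by
        have : 0 ≤ ∫ x in (-1 : ℝ)..1, wt γ (bt γ) x * u' x ^ 2 :=
          iint_nonneg fun x hx => mul_nonneg (wt_nonneg hγ _ hx) (sq_nonneg _)
        rw [← ENNReal.ofReal_add (by positivity) (by positivity)]
        congr 1
        ring

theorem dv_dP_mul_zero (γ : ℝ) (p : Polynomial ℝ) (x : ℝ) :
    dv (dP γ * p) 0 x = ddg γ x * dv p 0 x := by
  simp [dv, dP, ddg_eq]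

theorem dv_dP_mul_one (γ : ℝ) (p : Polynomial ℝ) (x : ℝ) :
    dv (dP γ * p) 1 x = ddg γ x * dv p 1 x + -2 * mu γ * x * dv p 0 x := by
  have h1 := hasDerivAt_dv (dP γ * p) 0 x
  rw [funext (dv_dP_mul_zero γ p)] at h1
  rw [h1.unique ((hasDerivAt_ddg γ x).fun_mul (hasDerivAt_dv p 0 x))]
  ring

theorem dv_dP_mul (γ : ℝ) (p : Polynomial ℝ) (j : ℕ) (x : ℝ) :
    dv (dP γ * p) (j + 2) x = ddg γ x * dv p (j + 2) x +
      (j + 2) * (-2 * mu γ * x) * dv p (j + 1) x - (j + 2) * (j + 1) * mu γ * dv p j x := by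
  have hx : ∀ x : ℝ, HasDerivAt (fun x : ℝ => -2 * mu γ * x) (-2 * mu γ) x := fun x => by
    simpa using (hasDerivAt_id x).const_mul (-2 * mu γ)
  induction j generalizing x with
  | zero =>
    have h1 := hasDerivAt_dv (dP γ * p) 1 x
    rw [funext (dv_dP_mul_one γ p)] at h1
    rw [h1.unique (((hasDerivAt_ddg γ x).fun_mul (hasDerivAt_dv p 1 x)).fun_add
      ((hx x).fun_mul (hasDerivAt_dv p 0 x)))]
    push_cast
    ring
  | succ j ih =>
    have h1 := hasDerivAt_dv (dP γ * p) (j + 2) x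
    rw [funext ih] at h1
    rw [h1.unique ((((hasDerivAt_ddg γ x).fun_mul (hasDerivAt_dv p (j + 2) x)).fun_add
      (((hx x).const_mul ((j : ℝ) + 2)).fun_mul (hasDerivAt_dv p (j + 1) x))).fun_sub
      ((hasDerivAt_dv p j x).const_mul (((j : ℝ) + 2) * (j + 1) * mu γ)))]
    push_cast
    ring

theorem sq_sum_le {k : ℝ} {c x : Fin 5 → ℝ} (hc : ∀ i, |c i| ≤ k) :
    (∑ i, c i * x i) ^ 2 ≤ 5 * k ^ 2 * ∑ i, x i ^ 2 := by
  have h := sq_sum_le_card_mul_sum_sq (s := Finset.univ) (f := fun i => c i * x i)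
  have h2 : ∑ i, (c i * x i) ^ 2 ≤ k ^ 2 * ∑ i, x i ^ 2 := by
    rw [Finset.mul_sum]
    refine Finset.sum_le_sum fun i _ => ?_
    rw [mul_pow]
    exact mul_le_mul_of_nonneg_right (sq_le_sq' (abs_le.1 (hc i)).1 (abs_le.1 (hc i)).2)
      (sq_nonneg _)
  simp only [Finset.card_univ, Fintype.card_fin] at h
  push_cast at h
  linarith

theorem dv_weighted_sq_le {γ : ℝ} (hγ : 3 < γ) {b j : ℕ} (hb : b ≤ 2) (hj : j ≤ 1 + b)
    (p : Polynomial ℝ) {x : ℝ} (hx : x ∈ Icc (-1 : ℝ) 1) :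
    dv (dP γ ^ b * p) j x ^ 2 ≤ 4500 * (dv p 0 x ^ 2 + dv p 1 x ^ 2 +
      ddg γ x ^ 2 * dv p 2 x ^ 2 + ddg γ x ^ 4 * dv p 3 x ^ 2) := by
  have key : ∀ c0 c1 c2 c3 : ℝ, |c0| ≤ 30 → |c1| ≤ 30 → |c2| ≤ 30 → |c3| ≤ 30 →
      dv (dP γ ^ b * p) j x = c0 * dv p 0 x + c1 * dv p 1 x + c2 * (ddg γ x * dv p 2 x) +
        c3 * (ddg γ x ^ 2 * dv p 3 x) → dv (dP γ ^ b * p) j x ^ 2 ≤ 4500 * (dv p 0 x ^ 2 +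
      dv p 1 x ^ 2 + ddg γ x ^ 2 * dv p 2 x ^ 2 + ddg γ x ^ 4 * dv p 3 x ^ 2) := by
    intro c0 c1 c2 c3 h0 h1 h2 h3 h
    have := sq_sum_le (k := 30) (c := ![c0, c1, c2, c3, 0])
      (x := ![dv p 0 x, dv p 1 x, ddg γ x * dv p 2 x, ddg γ x ^ 2 * dv p 3 x, 0])
      (by intro i; fin_cases i <;> simp [*])
    simp only [Fin.sum_univ_five, Matrix.cons_val] at this
    rw [h]
    nlinarith
  have m0 := mu_gt hγ
  have m1 := mu_lt hγ
  have d0 := ddg_nonneg hγ hx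
  have d1 : ddg γ x ≤ 1 := ddg_le hγ
  have e1 : |x| ≤ 1 := abs_le.2 hx
  have de : |mu γ * x| ≤ 1 / 2 := by
    rw [abs_mul, abs_of_pos (by linarith)]; nlinarith [abs_nonneg x]
  have dm : |mu γ| ≤ 1 / 2 := by rw [abs_of_pos (by linarith)]; linarith
  have dd : |ddg γ x| ≤ 1 := by rw [abs_of_nonneg d0]; exact d1
  have q1 : ∀ a b : ℝ, |a| ≤ 1 → |b| ≤ 1 → |a * b| ≤ 1 := fun a b ha hb => by
    rw [abs_mul]; exact mul_le_one₀ ha (abs_nonneg _) hb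
  have dd2 := q1 _ _ dd dd
  have ee := q1 _ _ (de.trans (by norm_num)) (de.trans (by norm_num))
  have dme := q1 _ _ dd (de.trans (by norm_num))
  have dmm := q1 _ _ dd (dm.trans (by norm_num))
  rw [abs_le] at de dm dd dd2 ee dme dmm
  interval_cases b <;> interval_cases j
  · exact key 1 0 0 0 (by norm_num) (by norm_num) (by norm_num) (by norm_num) (by simp)
  · exact key 0 1 0 0 (by norm_num) (by norm_num) (by norm_num) (by norm_num) (by simp)
  · exact key (ddg γ x) 0 0 0 (by rw [abs_le]; constructor <;> linarith) (by norm_num) (by norm_num)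
      (by norm_num) (by rw [pow_one, dv_dP_mul_zero]; ring)
  · exact key (-2 * (mu γ * x)) (ddg γ x) 0 0 (by rw [abs_le]; constructor <;> linarith)
      (by rw [abs_le]; constructor <;> linarith) (by norm_num)
      (by norm_num) (by rw [pow_one, dv_dP_mul_one]; ring)
  · exact key (-2 * mu γ) (-4 * (mu γ * x)) 1 0 (by rw [abs_le]; constructor <;> linarith)
      (by rw [abs_le]; constructor <;> linarith) (by norm_num)
      (by norm_num) (by rw [pow_one, dv_dP_mul γ p 0]; push_cast; ring)
  · exact key (ddg γ x * ddg γ x) 0 0 0 (by rw [abs_le]; constructor <;> linarith) (by norm_num)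
      (by norm_num) (by norm_num) (by rw [pow_two, mul_assoc]; simp only [dv_dP_mul_zero]; ring)
  · exact key (-4 * (ddg γ x * (mu γ * x))) (ddg γ x * ddg γ x) 0 0
      (by rw [abs_le]; constructor <;> linarith) (by rw [abs_le]; constructor <;> linarith)
      (by norm_num) (by norm_num)
      (by rw [pow_two, mul_assoc]; simp only [dv_dP_mul_zero, dv_dP_mul_one]; ring)
  · exact key (8 * (mu γ * x * (mu γ * x)) - 4 * (ddg γ x * mu γ)) (-8 * (ddg γ x * (mu γ * x)))
      (ddg γ x) 0
      (by rw [abs_le]; constructor <;> linarith) (by rw [abs_le]; constructor <;> linarith)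
      (by rw [abs_le]; constructor <;> linarith) (by norm_num)
      (by rw [pow_two, mul_assoc, dv_dP_mul γ _ 0]
          simp only [zero_add, dv_dP_mul_zero, dv_dP_mul_one, dv_dP_mul γ p 0]; push_cast; ring)
  · have mme := q1 (mu γ) (mu γ * x) (abs_le.2 ⟨by linarith, by linarith⟩)
      (abs_le.2 ⟨by linarith, by linarith⟩)
    rw [abs_le] at mme
    exact key (24 * (mu γ * (mu γ * x))) (24 * (mu γ * x * (mu γ * x)) - 12 * (ddg γ x * mu γ))
      (-12 * (mu γ * x)) 1
      (by rw [abs_le]; constructor <;> linarith)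
      (by rw [abs_le]; constructor <;> nlinarith)
      (by rw [abs_le]; constructor <;> linarith) (by norm_num)
      (by rw [pow_two, mul_assoc, dv_dP_mul γ _ 1, dv_dP_mul γ p 1, dv_dP_mul γ p 0, dv_dP_mul_one]
          push_cast; ring)

theorem dv_weighted_top_sq_le {γ : ℝ} (hγ : 3 < γ) {b : ℕ} (hb : b ≤ 2)
    (p : Polynomial ℝ) {x : ℝ} (hx : x ∈ Icc (-1 : ℝ) 1) :
    dv (dP γ ^ b * p) (2 + b) x ^ 2 ≤ 4500 * (dv p 0 x ^ 2 + dv p 1 x ^ 2 + dv p 2 x ^ 2 +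
      ddg γ x ^ 2 * dv p 3 x ^ 2 + ddg γ x ^ 4 * dv p 4 x ^ 2) := by
  have key : ∀ c0 c1 c2 c3 c4 : ℝ, |c0| ≤ 30 → |c1| ≤ 30 → |c2| ≤ 30 → |c3| ≤ 30 → |c4| ≤ 30 →
      dv (dP γ ^ b * p) (2 + b) x = c0 * dv p 0 x + c1 * dv p 1 x + c2 * dv p 2 x +
        c3 * (ddg γ x * dv p 3 x) + c4 * (ddg γ x ^ 2 * dv p 4 x) →
      dv (dP γ ^ b * p) (2 + b) x ^ 2 ≤ 4500 * (dv p 0 x ^ 2 + dv p 1 x ^ 2 + dv p 2 x ^ 2 +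
      ddg γ x ^ 2 * dv p 3 x ^ 2 + ddg γ x ^ 4 * dv p 4 x ^ 2) := by
    intro c0 c1 c2 c3 c4 h0 h1 h2 h3 h4 h
    have := sq_sum_le (k := 30) (c := ![c0, c1, c2, c3, c4])
      (x := ![dv p 0 x, dv p 1 x, dv p 2 x, ddg γ x * dv p 3 x, ddg γ x ^ 2 * dv p 4 x])
      (by intro i; fin_cases i <;> simp [*])
    simp only [Fin.sum_univ_five, Matrix.cons_val] at this
    rw [h]
    nlinarith
  have m0 := mu_gt hγ
  have m1 := mu_lt hγ
  have d0 := ddg_nonneg hγ hx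
  have d1 : ddg γ x ≤ 1 := ddg_le hγ
  have e1 : |x| ≤ 1 := abs_le.2 hx
  have de : |mu γ * x| ≤ 1 / 2 := by
    rw [abs_mul, abs_of_pos (by linarith)]; nlinarith [abs_nonneg x]
  have dm : |mu γ| ≤ 1 / 2 := by rw [abs_of_pos (by linarith)]; linarith
  have dd : |ddg γ x| ≤ 1 := by rw [abs_of_nonneg d0]; exact d1
  have q1 : ∀ a b s : ℝ, |a| ≤ s → |b| ≤ 1 / 2 → |a * b| ≤ s * (1 / 2) := fun a b s ha hb => by
    rw [abs_mul]; exact mul_le_mul ha hb (abs_nonneg _) ((abs_nonneg _).trans ha)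
  have mm := q1 _ _ _ dm dm
  have ee := q1 _ _ _ de de
  have mme := q1 _ _ _ dm de
  have dmm := q1 _ _ _ dd dm
  rw [abs_le] at de dm dd ee dmm mm mme
  interval_cases b
  · exact key 0 0 1 0 0 (by norm_num) (by norm_num) (by norm_num) (by norm_num) (by norm_num)
      (by simp)
  · exact key 0 (-6 * mu γ) (-6 * (mu γ * x)) 1 0 (by norm_num)
      (by rw [abs_le]; constructor <;> linarith) (by rw [abs_le]; constructor <;> linarith)
      (by norm_num) (by norm_num) (by rw [pow_one, dv_dP_mul γ p 1]; push_cast; ring)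
  · exact key (24 * (mu γ * mu γ)) (96 * (mu γ * (mu γ * x)))
      (48 * (mu γ * x * (mu γ * x)) - 24 * (ddg γ x * mu γ)) (-16 * (mu γ * x)) 1
      (by rw [abs_le]; constructor <;> linarith) (by rw [abs_le]; constructor <;> linarith)
      (by rw [abs_le]; constructor <;> nlinarith) (by rw [abs_le]; constructor <;> linarith)
      (by norm_num)
      (by rw [pow_two, mul_assoc, dv_dP_mul γ _ 2, dv_dP_mul γ p 2, dv_dP_mul γ p 1,
            dv_dP_mul γ p 0]
          push_cast; ring)

theorem iint_wt_le {γ : ℝ} (hγ : 3 < γ) {a K : ℝ} (ha : 0 ≤ a) {g : ℝ → ℝ} (hg : Continuous g)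
    (hK : ∀ x ∈ Icc (-1 : ℝ) 1, g x ≤ K) (hK0 : 0 ≤ K) :
    ∫ x in (-1 : ℝ)..1, wt γ a x * g x ≤ 2 * K := by
  have w := continuous_wt γ ha
  have : ∫ x in (-1 : ℝ)..1, wt γ a x * g x ≤ ∫ _ in (-1 : ℝ)..1, K :=
    iint_mono (by fun_prop) (by fun_prop) fun x hx =>
      (mul_le_mul_of_nonneg_left (hK x hx) (wt_nonneg hγ a hx)).trans
        (mul_le_of_le_one_left hK0 (wt_le_one hγ ha hx))
  rw [intervalIntegral.integral_const, smul_eq_mul] at this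
  linarith

theorem exists_weighted_bound {γ : ℝ} (hγ : 3 < γ) : ∃ C ≥ (1 : ℝ), ∀ p b, b ≤ 2 →
    (∀ j ≤ 1 + b, ∀ x ∈ Icc (-1 : ℝ) 1, dv (dP γ ^ b * p) j x ^ 2 ≤ C * S4 γ p) ∧
      ∀ j ≤ 1 + b, J γ (bt γ) (dP γ ^ b * p) (j + 1) ≤ C * S4 γ p := by
  obtain ⟨C, h⟩ := exists_statBd hγ
  have hC := h.one_le
  have hb := bt_pos hγ
  have pt : ∀ p b, b ≤ 2 → ∀ j ≤ 1 + b, ∀ x ∈ Icc (-1 : ℝ) 1,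
      dv (dP γ ^ b * p) j x ^ 2 ≤ 18000 * C * S4 γ p := fun p b hb2 j hj x hx => by
    have := dv_weighted_sq_le hγ hb2 hj p hx
    linarith [h.s0 p x hx, h.s1 p x hx, h.s2 p x hx, h.s3 p x hx]
  have top : ∀ p b, b ≤ 2 → J γ (bt γ) (dP γ ^ b * p) (2 + b) ≤ 36000 * C * S4 γ p := by
    intro p b hb2
    have w := continuous_wt γ hb.le
    have w2 := continuous_wt γ (by linarith : 0 ≤ bt γ + 2)
    have w4 := continuous_wt γ (by linarith : 0 ≤ bt γ + 4)
    have c := continuous_dv p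
    have c' := continuous_dv (dP γ ^ b * p)
    have h1 : J γ (bt γ) (dP γ ^ b * p) (2 + b) ≤ ∫ x in (-1 : ℝ)..1, 4500 *
        (wt γ (bt γ) x * (dv p 0 x ^ 2) + wt γ (bt γ) x * (dv p 1 x ^ 2) +
          wt γ (bt γ) x * (dv p 2 x ^ 2) + wt γ (bt γ + 2) x * (dv p 3 x ^ 2) +
          wt γ (bt γ + 4) x * (dv p 4 x ^ 2)) := by
      refine iint_mono (by fun_prop) (by fun_prop) fun x hx => ?_
      have e2 := wt_add_nat hγ hb.le 2 hx
      have e4 := wt_add_nat hγ hb.le 4 hx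
      push_cast at e2 e4
      rw [e2, e4]
      have := mul_le_mul_of_nonneg_left (dv_weighted_top_sq_le hγ hb2 p hx)
        (wt_nonneg hγ (bt γ) hx)
      linarith
    have i (a : ℝ) (k : ℕ) (hw : Continuous (wt γ a)) :
        IntervalIntegrable (fun x => wt γ a x * dv p k x ^ 2) volume (-1) 1 :=
      Continuous.intervalIntegrable (by fun_prop) _ _
    rw [intervalIntegral.integral_const_mul, intervalIntegral.integral_add
      ((((i _ 0 w).add (i _ 1 w)).add (i _ 2 w)).add (i _ 3 w2)) (i _ 4 w4),
      intervalIntegral.integral_add (((i _ 0 w).add (i _ 1 w)).add (i _ 2 w)) (i _ 3 w2),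
      intervalIntegral.integral_add ((i _ 0 w).add (i _ 1 w)) (i _ 2 w),
      intervalIntegral.integral_add (i _ 0 w) (i _ 1 w)] at h1
    have j1 := h.j1 p
    have j2 := h.j2 p
    have j3 := h.j3 p
    have j04 : J γ (bt γ) p 0 + J γ (bt γ + 4) p 4 = S4 γ p := rfl
    unfold J at *
    have hS := S4_nonneg hγ p
    have := mul_le_mul_of_nonneg_right hC hS
    linarith
  have hS := S4_nonneg hγ
  refine ⟨36000 * C, by linarith, fun p b hb2 => ⟨fun j hj x hx => ?_, fun j hj => ?_⟩⟩
  · have := mul_nonneg (by linarith : 0 ≤ C) (hS p)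
    linarith [pt p b hb2 j hj x hx]
  · rcases hj.lt_or_eq with hj | rfl
    · have c := continuous_dv (dP γ ^ b * p)
      have := iint_wt_le hγ (K := 18000 * C * S4 γ p) hb.le (g := fun x => dv (dP γ ^ b * p) (j + 1) x ^ 2)
        (by fun_prop) (fun x hx => pt p b hb2 (j + 1) (by omega) x hx)
        (mul_nonneg (by linarith) (hS p))
      unfold J
      linarith
    · rw [show 1 + b + 1 = 2 + b by ring]
      exact top p b hb2

theorem limBd_of_sq_le {γ : ℝ} {m : ℕ} {Q : ℕ → Polynomial ℝ}
    (h1 : ∀ j ≤ m, ∀ x ∈ Ioo (-1 : ℝ) 1, ∃ M, ∀ n, dv (Q n) j x ^ 2 ≤ M)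
    (h2 : ∀ j ≤ m, ∃ a ≥ (0 : ℝ), ∃ K, ∀ n, J γ a (Q n) (j + 1) ≤ K) : LimBd γ m Q where
  pt j hj x hx := by
    obtain ⟨M, hM⟩ := h1 j hj x hx
    exact ⟨√M, fun n => Real.abs_le_sqrt (hM n)⟩
  en := h2

theorem limBd_weighted {γ : ℝ} (hγ : 3 < γ) {Q : ℕ → Polynomial ℝ} {K : ℝ}
    (hQ : ∀ n, S4 γ (Q n) ≤ K) {b : ℕ} (hb : b ≤ 2) : LimBd γ (1 + b) fun n => dP γ ^ b * Q n := by
  obtain ⟨C, hC, h⟩ := exists_weighted_bound hγ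
  refine limBd_of_sq_le (fun j hj x hx => ⟨C * K, fun n => ?_⟩)
    (fun j hj => ⟨bt γ, (bt_pos hγ).le, C * K, fun n => ?_⟩)
  · exact ((h (Q n) b hb).1 j hj x (Ioo_subset_Icc_self hx)).trans
      (mul_le_mul_of_nonneg_left (hQ n) (by linarith))
  · exact ((h (Q n) b hb).2 j hj).trans (mul_le_mul_of_nonneg_left (hQ n) (by linarith))

theorem le_div_of_pow_mul_le {γ : ℝ} (hγ : 3 < γ) {x y K : ℝ} (hx : x ∈ Ioo (-1 : ℝ) 1) (n : ℕ)
    (h : ddg γ x ^ n * y ≤ K) : y ≤ K / ddg γ x ^ n := by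
  rw [le_div_iff₀ (pow_pos (ddg_pos hγ hx) n)]
  linarith

theorem limBd_three {γ : ℝ} (hγ : 3 < γ) {Q : ℕ → Polynomial ℝ} {K : ℝ}
    (hQ : ∀ n, S4 γ (Q n) ≤ K) : LimBd γ 3 Q := by
  obtain ⟨C, h⟩ := exists_statBd hγ
  have hC := h.one_le
  have hb := bt_pos hγ
  have k : ∀ n, C * S4 γ (Q n) ≤ C * K := fun n => mul_le_mul_of_nonneg_left (hQ n) (by linarith)
  refine limBd_of_sq_le (fun j hj x hx => ?_) (fun j hj => ?_)
  · have hx' := Ioo_subset_Icc_self hx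
    interval_cases j
    · exact ⟨C * K, fun n => (h.s0 _ x hx').trans (k n)⟩
    · exact ⟨C * K, fun n => (h.s1 _ x hx').trans (k n)⟩
    · exact ⟨_, fun n => le_div_of_pow_mul_le hγ hx 2 ((h.s2 _ x hx').trans (k n))⟩
    · exact ⟨_, fun n => le_div_of_pow_mul_le hγ hx 4 ((h.s3 _ x hx').trans (k n))⟩
  · interval_cases j
    · exact ⟨bt γ, hb.le, C * K, fun n => (h.j1 _).trans (k n)⟩
    · exact ⟨bt γ, hb.le, C * K, fun n => (h.j2 _).trans (k n)⟩
    · exact ⟨bt γ + 2, by linarith, C * K, fun n => (h.j3 _).trans (k n)⟩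
    · refine ⟨bt γ + 4, by linarith, K, fun n => le_trans ?_ (hQ n)⟩
      have := J_nonneg hγ (bt γ) (Q n) 0
      unfold S4
      linarith

theorem limBd_four {γ : ℝ} (hγ : 3 < γ) {Q : ℕ → Polynomial ℝ} {K K' : ℝ}
    (hQ : ∀ n, S4 γ (Q n) ≤ K) (hQ' : ∀ n, J γ (bt γ + 5) (Q n) 5 ≤ K') : LimBd γ 4 Q := by
  obtain ⟨C, h⟩ := exists_statBd hγ
  have hC := h.one_le
  have h3 := limBd_three hγ hQ
  refine ⟨fun j hj x hx => ?_, fun j hj => ?_⟩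
  · rcases hj.lt_or_eq with hj | rfl
    · exact h3.pt j (by omega) x hx
    · refine ⟨√(C * (K + K') / ddg γ x ^ 6), fun n => Real.abs_le_sqrt
        (le_div_of_pow_mul_le hγ hx 6 ((h.u4 _ x (Ioo_subset_Icc_self hx)).trans ?_))⟩
      exact mul_le_mul_of_nonneg_left (add_le_add (hQ n) (hQ' n)) (by linarith)
  · rcases hj.lt_or_eq with hj | rfl
    · exact h3.en j (by omega)
    · exact ⟨bt γ + 5, by linarith [bt_pos hγ], K', hQ'⟩

theorem liminf_le_of_forall_le {f : ℕ → ENNReal} {K : ENNReal} (h : ∀ n, f n ≤ K) :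
    liminf f atTop ≤ K :=
  (liminf_le_liminf (Eventually.of_forall h)).trans (by simp)

theorem lintegral_lintegral_le_of_tendsto {X Y : Type*} [MeasurableSpace X] [MeasurableSpace Y]
    {μ : Measure X} {ν : Measure Y} [SFinite ν] {F : ℕ → X → Y → ENNReal} {G : X → Y → ENNReal}
    {K : ENNReal} (hF : ∀ n, Measurable (Function.uncurry (F n)))
    (hK : ∀ n, ∫⁻ x, ∫⁻ y, F n x y ∂ν ∂μ ≤ K)
    (hG : ∀ᵐ x ∂μ, ∀ᵐ y ∂ν, Tendsto (fun n => F n x y) atTop (nhds (G x y))) :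
    ∫⁻ x, ∫⁻ y, G x y ∂ν ∂μ ≤ K := by
  calc ∫⁻ x, ∫⁻ y, G x y ∂ν ∂μ ≤ ∫⁻ x, liminf (fun n => ∫⁻ y, F n x y ∂ν) atTop ∂μ := by
        refine lintegral_mono_ae (hG.mono fun x hx => ?_)
        rw [lintegral_congr_ae (hx.mono fun y hy => hy.liminf_eq.symm)]
        exact lintegral_liminf_le fun n => (hF n).comp measurable_prodMk_left
    _ ≤ liminf (fun n => ∫⁻ x, ∫⁻ y, F n x y ∂ν ∂μ) atTop :=
        lintegral_liminf_le fun n => (hF n).lintegral_prod_right'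
    _ ≤ K := liminf_le_of_forall_le hK

theorem ofReal_integral_le_lintegral {X : Type*} [MeasurableSpace X] {μ : Measure X} {G : X → ℝ}
    (h0 : 0 ≤ᵐ[μ] G) : ENNReal.ofReal (∫ x, G x ∂μ) ≤ ∫⁻ x, ENNReal.ofReal (G x) ∂μ := by
  by_cases hi : Integrable G μ
  · rw [ofReal_integral_eq_lintegral_ofReal hi h0]
  · simp [integral_undef hi]

theorem LimBd.sq_lm_le {γ : ℝ} {m : ℕ} {Q : ℕ → Polynomial ℝ} (h : LimBd γ m Q)
    (U : Ultrafilter ℕ) {j : ℕ} (hj : j ≤ m) {x K : ℝ} (hx : x ∈ Ioo (-1 : ℝ) 1)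
    (hK : ∀ n, dv (Q n) j x ^ 2 ≤ K) : lm U Q j x ^ 2 ≤ K :=
  le_of_tendsto ((h.tendsto U hj hx).pow 2) (Eventually.of_forall hK)

theorem LimBd.gagliardo_le {γ : ℝ} (hγ : 3 < γ) : ∃ C ≥ (1 : ℝ), ∀ (m : ℕ) (Q : ℕ → Polynomial ℝ),
    LimBd γ m Q → ∀ (U : Ultrafilter ℕ) (K : ℝ), 0 ≤ K → (∀ n, J γ (bt γ) (Q n) (m + 1) ≤ K) →
    ∫ x in Ω₀, ∫ y in Ω₀, (lm U Q m x - lm U Q m y) ^ 2 / |x - y| ^ (3 - bt γ) ≤ C * K := by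
  obtain ⟨C, hC, hg⟩ := lintegral_gagliardo_le hγ
  refine ⟨C + 1, by linarith, fun m Q h U K hK0 hK => ?_⟩
  obtain ⟨k, -, hk⟩ := h.exists_seq hγ U (ι := Empty) (fun i => i.elim) (fun i => i.elim)
    (fun i => i.elim)
  have hnn : ∀ x y : ℝ, 0 ≤ (lm U Q m x - lm U Q m y) ^ 2 / |x - y| ^ (3 - bt γ) := fun x y => by
    positivity
  apply integral_le_of_lintegral_le
  · exact ae_of_all _ fun x => integral_nonneg fun y => hnn x y
  · positivity
  refine (lintegral_mono fun x => ofReal_integral_le_lintegral (ae_of_all _ fun y => hnn x y)).trans ?_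
  refine lintegral_lintegral_le_of_tendsto (F := fun n x y => ENNReal.ofReal
    ((dv (Q (k n)) m x - dv (Q (k n)) m y) ^ 2 / |x - y| ^ (3 - bt γ))) (fun n => ?_)
    (fun n => ?_) ?_
  · have c := continuous_dv (Q (k n)) m
    exact Measurable.ennreal_ofReal (by fun_prop)
  · refine (hg _ _ (hasDerivAt_dv (Q (k n)) m) (continuous_dv _ _)).trans
      (ENNReal.ofReal_le_ofReal ?_)
    have h1 := mul_le_mul_of_nonneg_left (hK (k n)) hC.le
    unfold J at h1
    linarith
  · refine (ae_restrict_iff' measurableSet_Ioo).2 (ae_of_all _ fun x hx => ?_)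
    refine (ae_restrict_iff' measurableSet_Ioo).2 (ae_of_all _ fun y hy => ?_)
    exact ENNReal.tendsto_ofReal ((((hk m le_rfl x hx).sub (hk m le_rfl y hy)).pow 2).div_const _)

theorem dv_pow_mul_zero (γ : ℝ) (p : Polynomial ℝ) (b : ℕ) (x : ℝ) :
    dv (dP γ ^ b * p) 0 x = ddg γ x ^ b * dv p 0 x := by
  induction b with
  | zero => simp
  | succ b ih => rw [pow_succ', mul_assoc, dv_dP_mul_zero, ih]; ring

theorem sobSq_weighted_le {γ : ℝ} (hγ : 3 < γ) : ∃ C ≥ (1 : ℝ),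
    ∀ (U : Ultrafilter ℕ) (Q : ℕ → Polynomial ℝ) (K : ℝ), (∀ n, S4 γ (Q n) ≤ K) → ∀ b ≤ 2,
      SobSq ((4 * γ - 5) / (2 * γ - 2) + (b : ℕ)) (fun y => ddg γ y ^ b * lm U Q 0 y) ≤ C * K := by
  obtain ⟨C, hC, hw⟩ := exists_weighted_bound hγ
  obtain ⟨C', hC', hg⟩ := LimBd.gagliardo_le hγ
  have hb0 := bt_pos hγ
  have hb1 := bt_lt_half hγ
  refine ⟨8 * C + C' * C, by nlinarith, fun U Q K hQ b hb => ?_⟩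
  have hK : 0 ≤ K := (S4_nonneg hγ _).trans (hQ 0)
  have h := limBd_weighted hγ hQ hb
  have h3 := limBd_three hγ hQ
  set R : ℕ → Polynomial ℝ := fun n => dP γ ^ b * Q n with hR
  have eF : EqOn (fun y => ddg γ y ^ b * lm U Q 0 y) (lm U R 0) (Ioo (-1) 1) := fun x hx => by
    refine tendsto_nhds_unique ?_ (h.tendsto U (Nat.zero_le _) hx)
    simp only [hR, dv_pow_mul_zero]
    exact (h3.tendsto U (Nat.zero_le _) hx).const_mul _
  have eD : ∀ j ≤ 1 + b, EqOn (iteratedDeriv j fun y => ddg γ y ^ b * lm U Q 0 y) (lm U R j)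
      (Ioo (-1) 1) := fun j hj x hx => by
    rw [(eF.eventuallyEq_of_mem (isOpen_Ioo.mem_nhds hx)).iteratedDeriv_eq j,
      h.iteratedDeriv_lm hγ U hj hx]
  have es : (4 * γ - 5) / (2 * γ - 2) + (b : ℕ) = 2 - bt γ / 2 + b := by
    unfold bt
    have : γ - 1 ≠ 0 := by linarith
    have : 2 * γ - 2 ≠ 0 := by linarith
    field_simp
    ring
  have ef : ⌊2 - bt γ / 2 + (b : ℝ)⌋₊ = 1 + b := by
    rw [Nat.floor_eq_iff (by positivity [show 0 ≤ 2 - bt γ / 2 by linarith])]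
    push_cast
    constructor <;> linarith
  rw [es, SobSq, ef, if_neg (by push_cast; intro hh; linarith)]
  have hs : HSq (1 + b) (fun y => ddg γ y ^ b * lm U Q 0 y) ≤ 8 * (C * K) := by
    have : ∀ j ∈ Finset.range (1 + b + 1),
        ∫ x in Ω₀, iteratedDeriv j (fun y => ddg γ y ^ b * lm U Q 0 y) x ^ 2 ≤ 2 * (C * K) := by
      intro j hj
      have hj : j ≤ 1 + b := Nat.lt_succ_iff.1 (Finset.mem_range.1 hj)
      rw [setIntegral_congr_fun (s := Ω₀) (g := fun x => wt γ 0 x * iteratedDeriv j (lm U R 0) x ^ 2)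
        measurableSet_Ioo fun x hx => by
          simp only [eD j hj hx, h.iteratedDeriv_lm hγ U hj hx, wt_zero, one_mul]]
      refine h.integral_lm_le hγ U hj le_rfl fun n => ?_
      have c := continuous_dv (R n) j
      exact iint_wt_le hγ le_rfl (g := fun x => dv (R n) j x ^ 2) (by fun_prop)
        (fun x hx => ((hw (Q n) b hb).1 j hj x hx).trans
          (mul_le_mul_of_nonneg_left (hQ n) (by linarith))) (by positivity)
    refine (Finset.sum_le_sum this).trans ?_
    rw [Finset.sum_const, Finset.card_range, nsmul_eq_mul]
    have hb' : (b : ℝ) ≤ 2 := by exact_mod_cast hb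
    have : 0 ≤ C * K := by positivity
    push_cast
    nlinarith
  have hG : ∫ x in Ω₀, ∫ y in Ω₀,
      (iteratedDeriv (1 + b) (fun y => ddg γ y ^ b * lm U Q 0 y) x -
        iteratedDeriv (1 + b) (fun y => ddg γ y ^ b * lm U Q 0 y) y) ^ 2 /
          |x - y| ^ (1 + 2 * (2 - bt γ / 2 + (b : ℝ) - ((1 + b : ℕ) : ℝ))) ≤ C' * (C * K) := by
    rw [show 1 + 2 * (2 - bt γ / 2 + (b : ℝ) - ((1 + b : ℕ) : ℝ)) = 3 - bt γ by push_cast; ring]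
    rw [setIntegral_congr_fun (s := Ω₀) (g := fun x => ∫ y in Ω₀,
        (lm U R (1 + b) x - lm U R (1 + b) y) ^ 2 / |x - y| ^ (3 - bt γ))
        measurableSet_Ioo fun x hx => setIntegral_congr_fun (s := Ω₀) measurableSet_Ioo fun y hy => by
          simp only [eD _ le_rfl hx, eD _ le_rfl hy]]
    exact hg _ _ h U _ (by positivity) fun n => ((hw (Q n) b hb).2 _ le_rfl).trans
      (mul_le_mul_of_nonneg_left (hQ n) (by linarith))
  linarith

theorem w1InfSq_le {γ : ℝ} (hγ : 3 < γ) : ∃ C ≥ (1 : ℝ),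
    ∀ (U : Ultrafilter ℕ) (Q : ℕ → Polynomial ℝ) (K : ℝ), (∀ n, S4 γ (Q n) ≤ K) →
      W1InfSq (lm U Q 0) ≤ C * K := by
  obtain ⟨C, hC⟩ := exists_statBd hγ
  have hC1 := hC.one_le
  refine ⟨2 * C, by linarith, fun U Q K hQ => ?_⟩
  have hK : 0 ≤ K := (S4_nonneg hγ _).trans (hQ 0)
  have h := limBd_three hγ hQ
  have k : ∀ n, C * S4 γ (Q n) ≤ C * K := fun n => mul_le_mul_of_nonneg_left (hQ n) (by linarith)
  have key : ∀ g : ℝ → ℝ, (∀ x ∈ Ω₀, g x ^ 2 ≤ C * K) →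
      sSup ((fun x => |g x|) '' Ω₀) ^ 2 ≤ C * K := by
    intro g hg
    have h1 : sSup ((fun x => |g x|) '' Ω₀) ≤ √(C * K) := by
      refine Real.sSup_le ?_ (Real.sqrt_nonneg _)
      rintro _ ⟨x, hx, rfl⟩
      exact Real.abs_le_sqrt (hg x hx)
    have h0 : 0 ≤ sSup ((fun x => |g x|) '' Ω₀) := by
      refine Real.sSup_nonneg ?_
      rintro _ ⟨x, hx, rfl⟩
      exact abs_nonneg _
    calc _ ≤ √(C * K) ^ 2 := pow_le_pow_left₀ h0 h1 2
      _ = C * K := Real.sq_sqrt (by positivity)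
  have a0 := key (lm U Q 0) fun x hx => h.sq_lm_le U (by norm_num) hx fun n =>
    (hC.s0 _ x (Ioo_subset_Icc_self hx)).trans (k n)
  have a1 := key (deriv (lm U Q 0)) fun x hx => by
    rw [(h.hasDerivAt_lm hγ U (by norm_num : 0 < 3) hx).deriv]
    exact h.sq_lm_le U (by norm_num) hx fun n => (hC.s1 _ x (Ioo_subset_Icc_self hx)).trans (k n)
  unfold W1InfSq
  linarith

theorem weighted_sum_le {γ : ℝ} (hγ : 3 < γ) : ∃ C ≥ (1 : ℝ),
    ∀ (U : Ultrafilter ℕ) (Q : ℕ → Polynomial ℝ) (K : ℝ), (∀ n, S4 γ (Q n) ≤ K) → ∀ b : ℕ, b < 5 →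
      ∫ x in Ω₀, ddg γ x ^ ((1 + (b : ℝ) * (γ - 1)) / (γ - 1)) *
        iteratedDeriv b (lm U Q 0) x ^ 2 ≤ C * K := by
  obtain ⟨C, hC, hj⟩ := J_interp_S4 hγ
  have hb0 := bt_pos hγ
  refine ⟨C + 1, by linarith, fun U Q K hQ b hb => ?_⟩
  have hK : 0 ≤ K := (S4_nonneg hγ _).trans (hQ 0)
  have h := limBd_three hγ hQ
  have k : ∀ n, C * S4 γ (Q n) ≤ C * K := fun n => mul_le_mul_of_nonneg_left (hQ n) (by linarith)
  simp only [ddg_rpow_eq hγ]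
  have n0 := fun n => J_nonneg hγ (bt γ) (Q n) 0
  have n4 := fun n => J_nonneg hγ (bt γ + 4) (Q n) 4
  have bd : ∀ n, J γ (bt γ + b) (Q n) b ≤ (C + 1) * K := fun n => by
    have hq := hQ n
    obtain ⟨h1, h2, h3⟩ := hj (Q n)
    have := k n
    have := n0 n
    have := n4 n
    have : 0 ≤ C * K := by positivity
    unfold S4 at *
    interval_cases b <;> norm_num <;> linarith
  rcases (Nat.lt_succ_iff.1 hb).lt_or_eq with hb | rfl
  · exact h.integral_lm_le hγ U (by omega) (by positivity) bd
  · exact h.integral_top_le hγ U (by positivity) bd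

theorem weighted_top_le {γ : ℝ} (hγ : 3 < γ) (U : Ultrafilter ℕ) (Q : ℕ → Polynomial ℝ) {K K' : ℝ}
    (hQ : ∀ n, S4 γ (Q n) ≤ K) (hQ' : ∀ n, J γ (bt γ + 5) (Q n) 5 ≤ K') :
    ∫ x in Ω₀, ddg γ x ^ ((5 * γ - 4) / (γ - 1)) * iteratedDeriv 5 (lm U Q 0) x ^ 2 ≤ K' := by
  have hb0 := bt_pos hγ
  have e := fun x => ddg_rpow_eq hγ 5 x
  rw [show ((1 : ℝ) + (5 : ℕ) * (γ - 1)) / (γ - 1) = (5 * γ - 4) / (γ - 1) by push_cast; ring] at e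
  simp only [e]
  exact (limBd_four hγ hQ hQ').integral_top_le hγ U (by positivity) (by simpa using hQ')

theorem abs_sub_sub_mul_le {b b' : ℝ → ℝ} {T s t m e : ℝ} (hb : ContinuousOn b (Icc 0 T))
    (hd : ∀ r ∈ Ioo 0 T, HasDerivAt b (b' r) r) (hs : s ∈ Icc 0 T) (ht : t ∈ Icc 0 T)
    (h : ∀ r ∈ Ioo 0 T, |r - s| ≤ |t - s| → |b' r - m| ≤ e) :
    |b t - b s - (t - s) * m| ≤ e * |t - s| := by
  have key : ∀ p q, p ∈ Icc 0 T → q ∈ Icc 0 T → p < q → (∀ r ∈ Ioo p q, |r - s| ≤ |t - s|) →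
      |b q - b p - (q - p) * m| ≤ e * |q - p| := by
    intro p q hp hq hpq hr
    obtain ⟨ξ, hξ, he⟩ := exists_hasDerivAt_eq_slope (fun r => b r - r * m) (fun r => b' r - m) hpq
      ((hb.mono (Icc_subset_Icc hp.1 hq.2)).sub (by fun_prop)) fun r hr => by
        simpa using (hd r ⟨by linarith [hp.1, hr.1], by linarith [hq.2, hr.2]⟩).fun_sub
          ((hasDerivAt_id r).mul_const m)
    have hξT : ξ ∈ Ioo 0 T := ⟨by linarith [hp.1, hξ.1], by linarith [hq.2, hξ.2]⟩
    have h1 := h ξ hξT (hr ξ hξ)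
    have h2 : b q - b p - (q - p) * m = (b' ξ - m) * (q - p) := by
      rw [he]; field_simp [(sub_pos.2 hpq).ne']; ring
    rw [h2, abs_mul]
    exact mul_le_mul_of_nonneg_right h1 (abs_nonneg _)
  rcases lt_trichotomy s t with hst | rfl | hst
  · exact key s t hs ht hst fun r hr => by
      rw [abs_of_pos (by linarith [hr.1]), abs_of_pos (by linarith)]; linarith [hr.2]
  · simp
  · have := key t s ht hs hst fun r hr => by
      rw [abs_of_neg (by linarith [hr.2]), abs_of_neg (by linarith)]; linarith [hr.1]
    rw [abs_sub_comm t s, ← abs_neg]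
    convert this using 2
    ring

/-- Weighted `L¹` norm of a polynomial. -/
def L1 (γ : ℝ) (φ : Polynomial ℝ) : ℝ := ∫ x in (-1 : ℝ)..1, wt γ (bt γ) x * |dv φ 0 x|

theorem L1_nonneg {γ : ℝ} (hγ : 3 < γ) (φ : Polynomial ℝ) : 0 ≤ L1 γ φ :=
  iint_nonneg fun _ hx => mul_nonneg (wt_nonneg hγ _ hx) (abs_nonneg _)

theorem abs_iint_wt_mul_le {γ : ℝ} (hγ : 3 < γ) {g : ℝ → ℝ} (hg : ContinuousOn g (Icc (-1) 1))
    {M : ℝ} (hM : ∀ x ∈ Icc (-1 : ℝ) 1, |g x| ≤ M) (φ : Polynomial ℝ) :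
    |∫ x in (-1 : ℝ)..1, wt γ (bt γ) x * (g x * dv φ 0 x)| ≤ M * L1 γ φ := by
  have w := (continuous_wt γ (bt_pos hγ).le).continuousOn (s := Icc (-1) 1)
  have c := (continuous_dv φ 0).continuousOn (s := Icc (-1) 1)
  rw [L1, ← intervalIntegral.integral_const_mul]
  refine (intervalIntegral.abs_integral_le_integral_abs (by norm_num)).trans
    (iint_mono (by fun_prop) (by fun_prop) fun x hx => ?_)
  have hw := wt_nonneg hγ (bt γ) hx
  rw [abs_mul, abs_mul, abs_of_nonneg hw]
  nlinarith [mul_le_mul_of_nonneg_left (mul_le_mul_of_nonneg_right (hM x hx)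
    (abs_nonneg (dv φ 0 x))) hw]

theorem hasDerivAt_En_time {γ : ℝ} {p p' : ℝ → Polynomial ℝ} {c d t : ℝ} (h : PolCurve p p' c d)
    (ht : t ∈ Ioo c d) (k : ℕ) {x : ℝ} (hq : qq (p t) x ≠ 0) :
    HasDerivAt (fun s => En γ (p s) k x) (En γ (p t) (k + 1) x * dv (p' t) 1 x) t := by
  have h1 : HasDerivAt (fun s => qq (p s) x) (dv (p' t) 1 x) t :=
    (h.deriv 1 t ht x).const_add 1
  refine ((h1.rpow_const (p := -γ - k) (Or.inl hq)).const_mul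
    (∏ i ∈ Finset.range k, (-γ - i))).congr_deriv ?_
  rw [En, Finset.prod_range_succ, show -γ - ((k + 1 : ℕ) : ℝ) = -γ - k - 1 by push_cast; ring]
  ring

theorem hasDerivAt_GG_time {γ : ℝ} (hγ : 3 < γ) {p p' : ℝ → Polynomial ℝ} {c d t : ℝ}
    (h : PolCurve p p' c d) (ht : t ∈ Ioo c d) {x : ℝ} (hq : qq (p t) x ≠ 0) :
    HasDerivAt (fun s => GG γ (p s) 0 x) (dv (p' t) 0 x + ddg γ x * (En γ (p t) 2 x *
      dv (p' t) 1 x * dv (p t) 2 x + En γ (p t) 1 x * dv (p' t) 2 x) -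
        x * (En γ (p t) 1 x * dv (p' t) 1 x)) t := by
  simp only [GG_zero_eq hγ]
  have e : ∀ s, qq (p s) x ^ (-γ) = En γ (p s) 0 x := fun s => by simp [En]
  simp only [e]
  exact ((h.deriv 0 t ht x).fun_add (((hasDerivAt_En_time h ht 1 hq).fun_mul
    (h.deriv 2 t ht x)).const_mul _)).fun_sub
      (((hasDerivAt_En_time h ht 0 hq).sub_const 1).const_mul x)

theorem GG_time_deriv_le {γ : ℝ} (hγ : 3 < γ) (K : ℝ) : ∃ L ≥ (1 : ℝ), ∀ p r, NearId p →
    S4 γ p ≤ K → S4 γ r ≤ K → ∀ x ∈ Icc (-1 : ℝ) 1,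
    |dv r 0 x + ddg γ x * (En γ p 2 x * dv r 1 x * dv p 2 x + En γ p 1 x * dv r 2 x) -
        x * (En γ p 1 x * dv r 1 x)| ≤ L ∧ |dv r 0 x| ≤ L ∧ |GG γ p 0 x| ≤ L := by
  obtain ⟨C, hS⟩ := exists_statBd hγ
  obtain ⟨M, hM, hE⟩ := En_sq_le hγ
  obtain ⟨C', hC', hG⟩ := GG_zero_sq_le hγ
  have hC := hS.one_le
  set A := √(C * |K|)
  set B := √M
  set D := √(C' * |K|)
  have hA : 0 ≤ A := Real.sqrt_nonneg _
  have hB : 0 ≤ B := Real.sqrt_nonneg _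
  have hD : 0 ≤ D := Real.sqrt_nonneg _
  refine ⟨1 + A + (B * A * A + B * A) + B * A + D, by
    have := mul_nonneg hB hA; have := mul_nonneg this hA; linarith, fun p r hn hp hr x hx => ?_⟩
  have k : ∀ q, S4 γ q ≤ K → C * S4 γ q ≤ C * |K| := fun q h =>
    mul_le_mul_of_nonneg_left (h.trans (le_abs_self K)) (by linarith)
  have r0 : |dv r 0 x| ≤ A := Real.abs_le_sqrt ((hS.s0 r x hx).trans (k r hr))
  have r1 : |dv r 1 x| ≤ A := Real.abs_le_sqrt ((hS.s1 r x hx).trans (k r hr))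
  have r2 : |ddg γ x * dv r 2 x| ≤ A := Real.abs_le_sqrt (by
    rw [mul_pow]; exact (hS.s2 r x hx).trans (k r hr))
  have p2 : |ddg γ x * dv p 2 x| ≤ A := Real.abs_le_sqrt (by
    rw [mul_pow]; exact (hS.s2 p x hx).trans (k p hp))
  have e1 : |En γ p 1 x| ≤ B := Real.abs_le_sqrt (hE p hn 1 (by norm_num) x hx)
  have e2 : |En γ p 2 x| ≤ B := Real.abs_le_sqrt (hE p hn 2 (by norm_num) x hx)
  have g : |GG γ p 0 x| ≤ D := Real.abs_le_sqrt ((hG p hn x hx).trans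
    (mul_le_mul_of_nonneg_left (hp.trans (le_abs_self K)) (by linarith)))
  have hx1 : |x| ≤ 1 := abs_le.2 hx
  have t1 : |En γ p 2 x * dv r 1 x * (ddg γ x * dv p 2 x)| ≤ B * A * A := by
    rw [abs_mul, abs_mul]; gcongr
  have t2 : |En γ p 1 x * (ddg γ x * dv r 2 x)| ≤ B * A := by
    rw [abs_mul]; gcongr
  have t3 : |x * (En γ p 1 x * dv r 1 x)| ≤ 1 * (B * A) := by
    rw [abs_mul, abs_mul]; gcongr
  have hBA := mul_nonneg hB hA
  have hBAA := mul_nonneg hBA hA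
  refine ⟨?_, by linarith, by linarith⟩
  rw [abs_le] at r0 t1 t2 t3 ⊢
  constructor <;> linarith

/-- Approximate weak evolution equations satisfied by a Galerkin solution. -/
structure WeakEvol (γ L : ℝ) (N : ℕ) (T : ℝ) (c a : ℝ → ℝ) (f z : ℝ → Polynomial ℝ) : Prop where
  sup_z : ∀ t ∈ Icc 0 T, ∀ x ∈ Icc (-1 : ℝ) 1, |dv (z t) 0 x| ≤ L
  sup_G : ∀ t ∈ Icc 0 T, ∀ x ∈ Icc (-1 : ℝ) 1, |GG γ (f t) 0 x| ≤ L
  evol_f : ∀ s ∈ Icc 0 T, ∀ t ∈ Icc 0 T, ∀ e, (∀ r ∈ Ioo 0 T, |r - s| ≤ |t - s| → |c r - c s| ≤ e) →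
    ∀ φ : Polynomial ℝ, φ.natDegree ≤ N →
      |ip γ (f t) φ - ip γ (f s) φ - (t - s) * (c s * ip γ (z s) φ)| ≤
        (e + |t - s|) * (L * L1 γ φ) * |t - s|
  evol_z : ∀ s ∈ Ioo 0 T, ∀ t ∈ Icc 0 T, ∀ e, (∀ r ∈ Ioo 0 T, |r - s| ≤ |t - s| → |a r - a s| ≤ e) →
    ∀ φ : Polynomial ℝ, φ.natDegree ≤ N →
      |ip γ (z t) φ - ip γ (z s) φ - (t - s) * (-a s * frc γ (f s) φ)| ≤
        (e + |t - s|) * (L * L1 γ φ) * |t - s|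

theorem abs_mul_sub_mul_le {a b u v L W e d : ℝ} (hab : |a - b| ≤ e) (hb : |b| ≤ 1)
    (hu : |u| ≤ L * W) (huv : |u - v| ≤ L * W * d) :
    |a * u - b * v| ≤ (e + d) * (L * W) := by
  have h1 : |(a - b) * u| ≤ e * (L * W) := by
    rw [abs_mul]
    exact mul_le_mul hab hu (abs_nonneg _) ((abs_nonneg _).trans hab)
  have h2 : |b * (u - v)| ≤ 1 * (L * W * d) := by
    rw [abs_mul]
    exact mul_le_mul hb huv (abs_nonneg _) zero_le_one
  calc |a * u - b * v| = |(a - b) * u + b * (u - v)| := by congr 1; ring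
    _ ≤ _ := (abs_add_le _ _).trans (by linarith)

theorem Galerkin.weakEvol {γ : ℝ} (hγ : 3 < γ) (K : ℝ) : ∃ L ≥ (1 : ℝ), ∀ (C : ℝ) (N : ℕ) (T : ℝ)
    (c σ : ℝ → ℝ) (u : Polynomial ℝ) (f z z' : ℝ → Polynomial ℝ), 0 ≤ T → C * S4 γ u ≤ K →
    (∀ t ∈ Icc 0 T, |c t| ≤ 1) → (∀ t ∈ Icc 0 T, |σ t * c t| ≤ 1) →
    Galerkin γ C N T c σ u f z z' → WeakEvol γ L N T c (fun t => σ t * c t) f z := by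
  obtain ⟨L, hL, hb⟩ := GG_time_deriv_le hγ K
  refine ⟨L, hL, fun C N T c σ u f z z' hT hK hc ha g => ?_⟩
  have sub : Ioo 0 T ⊆ Icc 0 T := Ioo_subset_Icc_self
  have Sf : ∀ t ∈ Icc 0 T, S4 γ (f t) ≤ K := fun t ht => by
    linarith [g.bound t ht, S4_nonneg hγ (z t)]
  have Sz : ∀ t ∈ Icc 0 T, S4 γ (z t) ≤ K := fun t ht => by
    linarith [g.bound t ht, S4_nonneg hγ (f t)]
  have cG : ∀ t ∈ Icc 0 T, ContinuousOn (GG γ (f t) 0) (Icc (-1) 1) := fun t ht =>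
    continuousOn_GG γ (g.near t ht) 0 (by norm_num)
  have sup_z : ∀ t ∈ Icc 0 T, ∀ x ∈ Icc (-1 : ℝ) 1, |dv (z t) 0 x| ≤ L := fun t ht x hx =>
    (hb _ _ (g.near t ht) (Sf t ht) (Sz t ht) x hx).2.1
  have sup_G : ∀ t ∈ Icc 0 T, ∀ x ∈ Icc (-1 : ℝ) 1, |GG γ (f t) 0 x| ≤ L := fun t ht x hx =>
    (hb _ _ (g.near t ht) (Sf t ht) (Sz t ht) x hx).2.2
  have ipz : ∀ t ∈ Icc 0 T, ∀ φ, |ip γ (z t) φ| ≤ L * L1 γ φ := fun t ht φ =>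
    abs_iint_wt_mul_le hγ (continuous_dv _ _).continuousOn (sup_z t ht) φ
  have frG : ∀ t ∈ Icc 0 T, ∀ φ, |frc γ (f t) φ| ≤ L * L1 γ φ := fun t ht φ =>
    abs_iint_wt_mul_le hγ (cG t ht) (sup_G t ht) φ
  have dz : ∀ φ : Polynomial ℝ, φ.natDegree ≤ N → ∀ r ∈ Ioo 0 T,
      HasDerivAt (fun s => ip γ (z s) φ) (-(σ r * c r) * frc γ (f r) φ) r := fun φ hφ r hr =>
    (g.curve_z.hasDerivAt_ip hγ hr φ).congr_deriv (g.weak r (sub hr) φ hφ)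
  have lipz : ∀ s ∈ Icc 0 T, ∀ t ∈ Icc 0 T, ∀ φ : Polynomial ℝ, φ.natDegree ≤ N →
      |ip γ (z t) φ - ip γ (z s) φ| ≤ L * L1 γ φ * |t - s| := by
    intro s hs t ht φ hφ
    have := abs_sub_sub_mul_le (m := 0) (e := L * L1 γ φ) (g.curve_z.continuousOn_ip hγ hT φ)
      (dz φ hφ) hs ht fun r hr _ => by
        rw [sub_zero, abs_mul, abs_neg]
        exact (mul_le_of_le_one_left (abs_nonneg _) (ha r (sub hr))).trans (frG r (sub hr) φ)
    simpa using this
  have lipG : ∀ s ∈ Ioo 0 T, ∀ t ∈ Ioo 0 T, ∀ x ∈ Icc (-1 : ℝ) 1,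
      |GG γ (f t) 0 x - GG γ (f s) 0 x| ≤ L * |t - s| := by
    intro s hs t ht x hx
    have hq : ∀ r ∈ Ioo 0 T, qq (f r) x ≠ 0 := fun r hr =>
      (by linarith [(g.near r (sub hr)).half_le hx] : 0 < qq (f r) x).ne'
    refine (convex_Ioo 0 T).norm_image_sub_le_of_norm_hasDerivWithin_le
      (fun r hr => (hasDerivAt_GG_time hγ g.curve_f hr (hq r hr)).hasDerivWithinAt)
      (fun r hr => ?_) hs ht
    have h1 := (hb _ _ (g.near r (sub hr)) (Sf r (sub hr)) (Sz r (sub hr)) x hx).1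
    simp only [dv_smul]
    rw [Real.norm_eq_abs]
    refine le_trans (le_of_eq ?_) ((mul_le_of_le_one_left (abs_nonneg _) (hc r (sub hr))).trans h1)
    rw [← abs_mul]
    congr 1
    ring
  have lipF : ∀ s ∈ Ioo 0 T, ∀ t ∈ Ioo 0 T, ∀ φ,
      |frc γ (f t) φ - frc γ (f s) φ| ≤ L * L1 γ φ * |t - s| := by
    intro s hs t ht φ
    have w := (continuous_wt γ (bt_pos hγ).le).continuousOn (s := Icc (-1) 1)
    have c0 := (continuous_dv φ 0).continuousOn (s := Icc (-1) 1)
    have c1 := cG t (sub ht)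
    have c2 := cG s (sub hs)
    have h1 := abs_iint_wt_mul_le hγ (g := fun x => GG γ (f t) 0 x - GG γ (f s) 0 x) (c1.sub c2) (lipG s hs t ht) φ
    have h2 : frc γ (f t) φ - frc γ (f s) φ = ∫ x in (-1 : ℝ)..1, wt γ (bt γ) x *
        ((GG γ (f t) 0 x - GG γ (f s) 0 x) * dv φ 0 x) := by
      rw [frc, frc, ← intervalIntegral.integral_sub (iintegrable (by fun_prop))
        (iintegrable (by fun_prop))]
      congr 1; ext x; ring
    rw [h2]
    linarith
  refine ⟨sup_z, sup_G, fun s hs t ht e he φ hφ => ?_, fun s hs t ht e he φ hφ => ?_⟩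
  · refine abs_sub_sub_mul_le (b' := fun r => c r * ip γ (z r) φ)
      (g.curve_f.continuousOn_ip hγ hT φ)
      (fun r hr => (g.curve_f.hasDerivAt_ip hγ hr φ).congr_deriv (ip_smul _ _ _ _)) hs ht
      fun r hr hrs => ?_
    refine (abs_mul_sub_mul_le (he r hr hrs) (hc s hs) (ipz r (sub hr) φ)
      (lipz s hs r (sub hr) φ hφ)).trans ?_
    have := mul_nonneg (by linarith : 0 ≤ L) (L1_nonneg hγ φ)
    gcongr
  · refine abs_sub_sub_mul_le (g.curve_z.continuousOn_ip hγ hT φ) (dz φ hφ) (sub hs) ht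
      fun r hr hrs => ?_
    have h1 := abs_mul_sub_mul_le (he r hr hrs) (ha s (sub hs)) (frG r (sub hr) φ)
      (lipF s hs r hr φ)
    have := mul_nonneg (by linarith : 0 ≤ L) (L1_nonneg hγ φ)
    rw [← abs_neg]
    refine (le_trans (le_of_eq (by congr 1; ring)) h1).trans ?_
    gcongr


theorem LimBd.tendsto_pairing {γ : ℝ} (hγ : 3 < γ) {m : ℕ} {Q : ℕ → Polynomial ℝ}
    (h : LimBd γ m Q) (U : Ultrafilter ℕ) {g : ℕ → ℝ → ℝ} {G : ℝ → ℝ} {M : ℝ}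
    (hg : ∀ n, ContinuousOn (g n) (Icc (-1) 1)) (hM : ∀ n, ∀ x ∈ Icc (-1 : ℝ) 1, |g n x| ≤ M)
    (hG : ∀ k : ℕ → ℕ, (∀ j ≤ m, ∀ x ∈ Ioo (-1 : ℝ) 1,
        Tendsto (fun n => dv (Q (k n)) j x) atTop (nhds (lm U Q j x))) →
      ∀ x ∈ Ioo (-1 : ℝ) 1, Tendsto (fun n => g (k n) x) atTop (nhds (G x)))
    (φ : Polynomial ℝ) :
    Tendsto (fun n => ∫ x in (-1 : ℝ)..1, wt γ (bt γ) x * (g n x * dv φ 0 x)) U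
      (nhds (∫ x in (-1 : ℝ)..1, wt γ (bt γ) x * (G x * dv φ 0 x))) := by
  have w0 := continuous_wt γ (bt_pos hγ).le
  have w := w0.continuousOn (s := Icc (-1) 1)
  have c0 := continuous_dv φ 0
  have c := c0.continuousOn (s := Icc (-1) 1)
  have hl := tendsto_limUnder_of_bounded U fun n => abs_iint_wt_mul_le hγ (hg n) (hM n) φ
  obtain ⟨k, hk, hk'⟩ := h.exists_seq hγ U (ι := Unit) (fun _ => _) (fun _ => _) fun _ => hl
  have hd : Tendsto (fun n => ∫ x in (-1 : ℝ)..1, wt γ (bt γ) x * (g (k n) x * dv φ 0 x)) atTop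
      (nhds (∫ x in (-1 : ℝ)..1, wt γ (bt γ) x * (G x * dv φ 0 x))) := by
    refine intervalIntegral.tendsto_integral_filter_of_dominated_convergence
      (fun x => wt γ (bt γ) x * (M * |dv φ 0 x|)) (Eventually.of_forall fun n => ?_)
      (Eventually.of_forall fun n => ae_of_all _ fun x hx => ?_) (iintegrable (by fun_prop))
      (ae_of_all _ fun x hx => ?_)
    · have e : IntervalIntegrable (fun x => wt γ (bt γ) x * (g (k n) x * dv φ 0 x)) volume (-1) 1 :=
        iintegrable (w.mul ((hg (k n)).mul c))
      exact (intervalIntegrable_iff.1 e).aestronglyMeasurable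
    · rw [uIoc_of_le (by norm_num)] at hx
      have hx' := Ioc_subset_Icc_self hx
      rw [Real.norm_eq_abs, abs_mul, abs_mul, abs_of_nonneg (wt_nonneg hγ _ hx')]
      exact mul_le_mul_of_nonneg_left (mul_le_mul_of_nonneg_right (hM _ x hx') (abs_nonneg _))
        (wt_nonneg hγ _ hx')
    · rw [uIoc_of_le (by norm_num)] at hx
      rcases hx.2.eq_or_lt with rfl | hlt
      · simp [wt, ddg_one, Real.zero_rpow (bt_pos hγ).ne']
      · exact ((hG k hk' x ⟨hx.1, hlt⟩).mul_const _).const_mul _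
  rwa [tendsto_nhds_unique (hk ()) hd] at hl

theorem intervalIntegrable_of_bounded {r : ℝ → ℝ} {M : ℝ} (hr : ContinuousOn r (Ioo (-1) 1))
    (hM : ∀ x ∈ Ioo (-1 : ℝ) 1, |r x| ≤ M) : IntervalIntegrable r volume (-1) 1 := by
  rw [intervalIntegrable_iff_integrableOn_Ioo_of_le (by norm_num)]
  exact Integrable.of_bound (hr.aestronglyMeasurable measurableSet_Ioo) M
    ((ae_restrict_iff' measurableSet_Ioo).2 (ae_of_all _ hM))

/-- A function is bounded by the norm of the functional it induces on polynomials. -/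
theorem abs_le_of_pairing_le {γ : ℝ} (hγ : 3 < γ) {r : ℝ → ℝ} {M K : ℝ}
    (hr : ContinuousOn r (Ioo (-1) 1)) (hM : ∀ x ∈ Ioo (-1 : ℝ) 1, |r x| ≤ M) (hK0 : 0 ≤ K)
    (hK : ∀ φ : Polynomial ℝ,
      |∫ x in (-1 : ℝ)..1, wt γ (bt γ) x * (r x * dv φ 0 x)| ≤ K * L1 γ φ) :
    ∀ x ∈ Ioo (-1 : ℝ) 1, |r x| ≤ K := by
  have w0 := continuous_wt γ (bt_pos hγ).le
  have ri := intervalIntegrable_of_bounded hr hM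
  have rwi : ∀ {u : ℝ → ℝ}, Continuous u →
      IntervalIntegrable (fun x => wt γ (bt γ) x * (r x * u x)) volume (-1) 1 := fun {u} hu =>
    (ri.mul_continuousOn (g := u) hu.continuousOn).continuousOn_mul w0.continuousOn
  set W := ∫ x in (-1 : ℝ)..1, wt γ (bt γ) x
  have hext : ∀ ψ : ℝ → ℝ, Continuous ψ → ∫ x in (-1 : ℝ)..1, wt γ (bt γ) x * (r x * ψ x) ≤
      K * ∫ x in (-1 : ℝ)..1, wt γ (bt γ) x * |ψ x| := by
    intro ψ hψ
    have key : ∀ e > 0, ∫ x in (-1 : ℝ)..1, wt γ (bt γ) x * (r x * ψ x) ≤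
        (K * ∫ x in (-1 : ℝ)..1, wt γ (bt γ) x * |ψ x|) + e * ((K + M) * W) := by
      intro e he
      obtain ⟨φ, hφ⟩ := exists_polynomial_near_of_continuousOn (-1) 1 ψ hψ.continuousOn e he
      have cφ := continuous_dv φ 0
      have hφ' : ∀ x ∈ Icc (-1 : ℝ) 1, |dv φ 0 x - ψ x| ≤ e := fun x hx => (hφ x hx).le
      have h1 : ∫ x in (-1 : ℝ)..1, wt γ (bt γ) x * (r x * ψ x) ≤
          ∫ x in (-1 : ℝ)..1, (wt γ (bt γ) x * (r x * dv φ 0 x) + e * M * wt γ (bt γ) x) := by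
        refine intervalIntegral.integral_mono_on_of_le_Ioo (by norm_num) (rwi hψ)
          ((rwi cφ).add (iintegrable (by fun_prop))) fun x hx => ?_
        have hw := wt_nonneg hγ (bt γ) (Ioo_subset_Icc_self hx)
        have h2 : r x * (ψ x - dv φ 0 x) ≤ M * e := by
          refine (le_abs_self _).trans ?_
          rw [abs_mul, abs_sub_comm]
          exact mul_le_mul (hM x hx) (hφ' x (Ioo_subset_Icc_self hx)) (abs_nonneg _)
            ((abs_nonneg _).trans (hM x hx))
        nlinarith
      rw [intervalIntegral.integral_add (rwi cφ) (iintegrable (by fun_prop)),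
        intervalIntegral.integral_const_mul] at h1
      have h3 : L1 γ φ ≤ ∫ x in (-1 : ℝ)..1, (wt γ (bt γ) x * |ψ x| + e * wt γ (bt γ) x) := by
        refine iint_mono (by fun_prop) (by fun_prop) fun x hx => ?_
        have hw := wt_nonneg hγ (bt γ) hx
        have h4 := abs_add_le (dv φ 0 x - ψ x) (ψ x)
        rw [sub_add_cancel] at h4
        nlinarith [hφ' x hx]
      rw [intervalIntegral.integral_add (iintegrable (by fun_prop)) (iintegrable (by fun_prop)),
        intervalIntegral.integral_const_mul] at h3
      have h5 := (le_abs_self _).trans (hK φ)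
      nlinarith [mul_le_mul_of_nonneg_left h3 hK0]
    refine le_of_forall_pos_le_add fun e he => ?_
    set B := (K + M) * W
    have h1 := key (e / (|B| + 1)) (by positivity)
    have h2 : e / (|B| + 1) * B ≤ e := by
      rw [div_mul_eq_mul_div, div_le_iff₀ (by positivity)]
      nlinarith [le_abs_self B]
    linarith
  intro x₀ hx₀
  by_contra! hlt
  obtain ⟨s, hs, hs1⟩ : ∃ s : ℝ, |s| = 1 ∧ s * r x₀ = |r x₀| := by
    rcases le_total 0 (r x₀) with h | h
    · exact ⟨1, abs_one, by rw [abs_of_nonneg h, one_mul]⟩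
    · exact ⟨-1, by simp, by rw [abs_of_nonpos h]; ring⟩
  set c := (|r x₀| - K) / 2 with hc
  have hev : ∀ᶠ x in nhds x₀, x ∈ Ioo (-1 : ℝ) 1 ∧ K + c < s * r x := by
    have hcont : ContinuousAt (fun x => s * r x) x₀ :=
      (hr.continuousAt (isOpen_Ioo.mem_nhds hx₀)).const_mul _
    exact (isOpen_Ioo.eventually_mem hx₀).and (hcont.eventually (lt_mem_nhds (by simp only [hs1]; linarith)))
  obtain ⟨δ, hδ, hδ'⟩ := Metric.eventually_nhds_iff.1 hev
  set ψ : ℝ → ℝ := fun x => max 0 (δ - |x - x₀|) with hψ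
  have cψ : Continuous ψ := by fun_prop
  have h1 := hext (fun x => s * ψ x) (by fun_prop)
  have h2 : ∫ x in (-1 : ℝ)..1, (K + c) * (wt γ (bt γ) x * ψ x) ≤
      ∫ x in (-1 : ℝ)..1, wt γ (bt γ) x * (r x * (s * ψ x)) := by
    refine intervalIntegral.integral_mono_on_of_le_Ioo (by norm_num) (iintegrable (by fun_prop))
      (rwi (by fun_prop)) fun x hx => ?_
    have hw := wt_nonneg hγ (bt γ) (Ioo_subset_Icc_self hx)
    have h3 : (K + c) * ψ x ≤ s * r x * ψ x := by
      rcases lt_or_ge |x - x₀| δ with hd | hd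
      · exact mul_le_mul_of_nonneg_right (hδ' hd).2.le (le_max_left _ _)
      · have : ψ x = 0 := max_eq_left (by linarith)
        simp [this]
    nlinarith
  have h4 : 0 < ∫ x in (-1 : ℝ)..1, wt γ (bt γ) x * ψ x := by
    refine intervalIntegral.integral_pos (by norm_num) (by fun_prop)
      (fun x hx => mul_nonneg (wt_nonneg hγ _ (Ioc_subset_Icc_self hx)) (le_max_left _ _))
      ⟨x₀, Ioo_subset_Icc_self hx₀, mul_pos (wt_pos hγ _ hx₀) ?_⟩
    simpa [hψ] using hδ
  have h5 : ∀ x, |s * ψ x| = ψ x := fun x => by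
    rw [abs_mul, hs, one_mul, abs_of_nonneg (le_max_left _ _)]
  simp only [h5] at h1
  rw [intervalIntegral.integral_const_mul] at h2
  nlinarith

/-- Weighted pairing of a function with a polynomial. -/
def pairing (γ : ℝ) (r : ℝ → ℝ) (φ : Polynomial ℝ) : ℝ :=
  ∫ x in (-1 : ℝ)..1, wt γ (bt γ) x * (r x * dv φ 0 x)

/-- A bounded continuous function on the open interval. -/
structure BddCont (r : ℝ → ℝ) : Prop where
  cont : ContinuousOn r (Ioo (-1) 1)
  bdd : ∃ M, ∀ x ∈ Ioo (-1 : ℝ) 1, |r x| ≤ M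

theorem BddCont.combination {r₁ r₂ r₃ : ℝ → ℝ} (h₁ : BddCont r₁) (h₂ : BddCont r₂)
    (h₃ : BddCont r₃) (k : ℝ) : BddCont fun x => r₁ x - r₂ x - k * r₃ x := by
  obtain ⟨M₁, hM₁⟩ := h₁.bdd
  obtain ⟨M₂, hM₂⟩ := h₂.bdd
  obtain ⟨M₃, hM₃⟩ := h₃.bdd
  refine ⟨(h₁.cont.sub h₂.cont).sub (continuousOn_const.mul h₃.cont), M₁ + M₂ + |k| * M₃,
    fun x hx => ?_⟩
  have a := abs_sub (r₁ x - r₂ x) (k * r₃ x)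
  have b := abs_sub (r₁ x) (r₂ x)
  rw [abs_mul] at a
  linarith [hM₁ x hx, hM₂ x hx, mul_le_mul_of_nonneg_left (hM₃ x hx) (abs_nonneg k)]

theorem BddCont.pairing_combination {γ : ℝ} (hγ : 3 < γ) {r₁ r₂ r₃ : ℝ → ℝ} (h₁ : BddCont r₁)
    (h₂ : BddCont r₂) (h₃ : BddCont r₃) (k : ℝ) (φ : Polynomial ℝ) :
    pairing γ (fun x => r₁ x - r₂ x - k * r₃ x) φ =
      pairing γ r₁ φ - pairing γ r₂ φ - k * pairing γ r₃ φ := by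
  have hi : ∀ {r : ℝ → ℝ}, BddCont r →
      IntervalIntegrable (fun x => wt γ (bt γ) x * (r x * dv φ 0 x)) volume (-1) 1 := fun {r} h =>
    ((intervalIntegrable_of_bounded h.cont h.bdd.choose_spec).mul_continuousOn
      (continuous_dv φ 0).continuousOn).continuousOn_mul
        (continuous_wt γ (bt_pos hγ).le).continuousOn
  unfold pairing
  rw [← intervalIntegral.integral_const_mul, ← intervalIntegral.integral_sub (hi h₁) (hi h₂),
    ← intervalIntegral.integral_sub ((hi h₁).sub (hi h₂)) ((hi h₃).const_mul k)]
  congr 1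
  ext x
  ring

/-- An increment estimate tested against polynomials passes to the limit pointwise. -/
theorem BddCont.abs_combination_le {γ : ℝ} (hγ : 3 < γ) {r₁ r₂ r₃ : ℝ → ℝ} (h₁ : BddCont r₁)
    (h₂ : BddCont r₂) (h₃ : BddCont r₃) (k : ℝ) {B : ℝ} (hB : 0 ≤ B) {U : Ultrafilter ℕ}
    {a₁ a₂ a₃ : Polynomial ℝ → ℕ → ℝ} (t₁ : ∀ φ, Tendsto (a₁ φ) U (nhds (pairing γ r₁ φ)))
    (t₂ : ∀ φ, Tendsto (a₂ φ) U (nhds (pairing γ r₂ φ)))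
    (t₃ : ∀ φ, Tendsto (a₃ φ) U (nhds (pairing γ r₃ φ)))
    (h : ∀ φ, ∀ᶠ n in (U : Filter ℕ), |a₁ φ n - a₂ φ n - k * a₃ φ n| ≤ B * L1 γ φ) :
    ∀ x ∈ Ioo (-1 : ℝ) 1, |r₁ x - r₂ x - k * r₃ x| ≤ B := by
  have hc := h₁.combination h₂ h₃ k
  refine abs_le_of_pairing_le hγ hc.cont hc.bdd.choose_spec hB fun φ => ?_
  change |pairing γ _ φ| ≤ _
  rw [h₁.pairing_combination hγ h₂ h₃]
  exact le_of_tendsto (((t₁ φ).sub (t₂ φ)).sub ((t₃ φ).const_mul k)).abs (h φ)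

/-- Differentiability from a first order Taylor estimate with a modulus of continuity. -/
theorem hasDerivWithinAt_of_modulus {g c : ℝ → ℝ} {S : Set ℝ} {s D L : ℝ} (hL : 1 ≤ L)
    (hc : ContinuousWithinAt c S s)
    (h : ∀ t ∈ S, ∀ e, (∀ r ∈ S, |r - s| ≤ |t - s| → |c r - c s| ≤ e) →
      |g t - g s - (t - s) * D| ≤ (e + |t - s|) * L * |t - s|) : HasDerivWithinAt g D S s := by
  rw [hasDerivWithinAt_iff_isLittleO, Asymptotics.isLittleO_iff]
  intro ε hε
  obtain ⟨δ, hδ, hδ'⟩ := Metric.continuousWithinAt_iff.1 hc (ε / (2 * L)) (by positivity)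
  have hm : Metric.ball s (min δ (ε / (2 * L))) ∈ nhds s := Metric.ball_mem_nhds _ (by positivity)
  filter_upwards [mem_nhdsWithin_of_mem_nhds hm, self_mem_nhdsWithin] with t ht htS
  rw [Metric.mem_ball, Real.dist_eq, lt_min_iff] at ht
  have h1 := h t htS (ε / (2 * L)) fun r hr hrs => by
    have := hδ' hr (by rw [Real.dist_eq]; linarith)
    rw [Real.dist_eq] at this
    exact this.le
  rw [smul_eq_mul, Real.norm_eq_abs, Real.norm_eq_abs]
  refine h1.trans (mul_le_mul_of_nonneg_right ?_ (abs_nonneg _))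
  have h2 : ε / (2 * L) * L = ε / 2 := by field_simp
  nlinarith

theorem bddCont_lm {γ : ℝ} (hγ : 3 < γ) {Q : ℕ → Polynomial ℝ} {K : ℝ}
    (hQ : ∀ n, S4 γ (Q n) ≤ K) (U : Ultrafilter ℕ) : BddCont (lm U Q 0) := by
  obtain ⟨C, h⟩ := exists_statBd hγ
  have hl := limBd_three hγ hQ
  refine ⟨hl.continuousOn_lm hγ U (by norm_num), √(C * K), fun x hx => ?_⟩
  refine Real.abs_le_sqrt (hl.sq_lm_le U (by norm_num) hx fun n => ?_)
  exact (h.s0 (Q n) x (Ioo_subset_Icc_self hx)).trans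
    (mul_le_mul_of_nonneg_left (hQ n) (by linarith [h.one_le]))

theorem tendsto_ip {γ : ℝ} (hγ : 3 < γ) {Q : ℕ → Polynomial ℝ} {K : ℝ}
    (hQ : ∀ n, S4 γ (Q n) ≤ K) (U : Ultrafilter ℕ) (φ : Polynomial ℝ) :
    Tendsto (fun n => ip γ (Q n) φ) U (nhds (pairing γ (lm U Q 0) φ)) := by
  obtain ⟨C, h⟩ := exists_statBd hγ
  refine (limBd_three hγ hQ).tendsto_pairing hγ U (g := fun n => dv (Q n) 0) (M := √(C * K))
    (fun n => (continuous_dv _ _).continuousOn) (fun n x hx => Real.abs_le_sqrt ?_)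
    (fun k hk x hx => hk 0 (by norm_num) x hx) φ
  exact (h.s0 (Q n) x hx).trans
    (mul_le_mul_of_nonneg_left (hQ n) (by linarith [h.one_le]))

/-- The force exerted by the limit of a sequence of displacements. -/
def limForce (γ : ℝ) (U : Ultrafilter ℕ) (Q : ℕ → Polynomial ℝ) (x : ℝ) : ℝ :=
  lm U Q 0 x + ddg γ x * (-γ * (1 + lm U Q 1 x) ^ (-γ - 1) * lm U Q 2 x) -
    x * ((1 + lm U Q 1 x) ^ (-γ) - 1)

theorem half_le_lm {γ : ℝ} (hγ : 3 < γ) {Q : ℕ → Polynomial ℝ} {K : ℝ}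
    (hQ : ∀ n, S4 γ (Q n) ≤ K) (hN : ∀ n, NearId (Q n)) (U : Ultrafilter ℕ) {x : ℝ}
    (hx : x ∈ Ioo (-1 : ℝ) 1) : 1 / 2 ≤ 1 + lm U Q 1 x :=
  ge_of_tendsto (((limBd_three hγ hQ).tendsto U (by norm_num : 1 ≤ 3) hx).const_add 1)
    (Eventually.of_forall fun n => (hN n).half_le (Ioo_subset_Icc_self hx))

theorem tendsto_GG {γ : ℝ} (hγ : 3 < γ) {Q : ℕ → Polynomial ℝ} {U : Ultrafilter ℕ} {l : Filter ℕ}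
    {x : ℝ} (hx : 0 < 1 + lm U Q 1 x) {k : ℕ → ℕ}
    (h : ∀ j ≤ 3, Tendsto (fun n => dv (Q (k n)) j x) l (nhds (lm U Q j x))) :
    Tendsto (fun n => GG γ (Q (k n)) 0 x) l (nhds (limForce γ U Q x)) := by
  simp only [GG_zero_eq hγ]
  have hq := (h 1 (by norm_num)).const_add 1
  refine ((h 0 (by norm_num)).add (((?_ : Tendsto _ _ _).mul (h 2 (by norm_num))).const_mul _)).sub
    (((hq.rpow_const (Or.inl hx.ne')).sub_const 1).const_mul x)
  have := (hq.rpow_const (p := -γ - 1) (Or.inl hx.ne')).const_mul (-γ)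
  simpa [En, qq] using this

theorem bddCont_limForce {γ : ℝ} (hγ : 3 < γ) {Q : ℕ → Polynomial ℝ} {K : ℝ}
    (hQ : ∀ n, S4 γ (Q n) ≤ K) (hN : ∀ n, NearId (Q n)) (U : Ultrafilter ℕ) :
    BddCont (limForce γ U Q) := by
  obtain ⟨L, -, h⟩ := GG_time_deriv_le hγ K
  have hl := limBd_three hγ hQ
  have hq : ∀ x ∈ Ioo (-1 : ℝ) 1, 0 < 1 + lm U Q 1 x := fun x hx => by
    linarith [half_le_lm hγ hQ hN U hx]
  refine ⟨?_, L, fun x hx => ?_⟩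
  · have c0 := hl.continuousOn_lm hγ U (j := 0) (by norm_num)
    have c1 := hl.continuousOn_lm hγ U (j := 1) (by norm_num)
    have c2 := hl.continuousOn_lm hγ U (j := 2) (by norm_num)
    have cd := (continuous_ddg γ).continuousOn (s := Ioo (-1 : ℝ) 1)
    have cr : ∀ p : ℝ, ContinuousOn (fun x => (1 + lm U Q 1 x) ^ p) (Ioo (-1) 1) := fun p =>
      (continuousOn_const.add c1).rpow_const fun x hx => Or.inl (hq x hx).ne'
    have r1 := cr (-γ)
    have r2 := cr (-γ - 1)
    unfold limForce
    fun_prop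
  · exact le_of_tendsto (tendsto_GG hγ (hq x hx) (k := id) fun j hj => hl.tendsto U hj hx).abs
      (Eventually.of_forall fun n => (h _ _ (hN n) (hQ n) (hQ n) x (Ioo_subset_Icc_self hx)).2.2)

theorem tendsto_frc {γ : ℝ} (hγ : 3 < γ) {Q : ℕ → Polynomial ℝ} {K : ℝ}
    (hQ : ∀ n, S4 γ (Q n) ≤ K) (hN : ∀ n, NearId (Q n)) (U : Ultrafilter ℕ) (φ : Polynomial ℝ) :
    Tendsto (fun n => frc γ (Q n) φ) U (nhds (pairing γ (limForce γ U Q) φ)) := by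
  obtain ⟨L, -, h⟩ := GG_time_deriv_le hγ K
  refine (limBd_three hγ hQ).tendsto_pairing hγ U (g := fun n => GG γ (Q n) 0)
    (fun n => continuousOn_GG γ (hN n) 0 (by norm_num))
    (fun n x hx => (h _ _ (hN n) (hQ n) (hQ n) x hx).2.2) (fun k hk x hx => ?_) φ
  exact tendsto_GG hγ (by linarith [half_le_lm hγ hQ hN U hx]) fun j hj => hk j hj x hx

/-- A sequence of approximate solutions existing on longer and longer time intervals. -/
structure ApproxSol (γ K L : ℝ) (c σ : ℝ → ℝ) (F Z : ℕ → ℝ → Polynomial ℝ) : Prop where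
  near : ∀ n t, NearId (F n t)
  bound_F : ∀ n t, S4 γ (F n t) ≤ K
  bound_Z : ∀ n t, S4 γ (Z n t) ≤ K
  bound_top : ∀ n t, σ t * J γ (bt γ + 5) (F n t) 5 ≤ K
  zero_F : ∀ n, F n 0 = 0
  evol : ∀ n : ℕ, WeakEvol γ L n n c (fun t => σ t * c t) (F n) (Z n)

theorem dv_zero_pol (k : ℕ) (x : ℝ) : dv 0 k x = 0 := by simp [dv]

theorem J_zero_pol (γ a : ℝ) (k : ℕ) : J γ a 0 k = 0 := by simp [J, dv_zero_pol]

theorem S4_zero_pol (γ : ℝ) : S4 γ 0 = 0 := by simp [S4, J_zero_pol]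

theorem WeakEvol.congr {γ L T : ℝ} {N M : ℕ} {c a : ℝ → ℝ} {f z g w : ℝ → Polynomial ℝ}
    (h : WeakEvol γ L N T c a f z) (hM : M ≤ N) (hf : ∀ t ∈ Icc 0 T, g t = f t)
    (hz : ∀ t ∈ Icc 0 T, w t = z t) : WeakEvol γ L M T c a g w where
  sup_z t ht := by rw [hz t ht]; exact h.sup_z t ht
  sup_G t ht := by rw [hf t ht]; exact h.sup_G t ht
  evol_f s hs t ht e he φ hφ := by
    rw [hf t ht, hf s hs, hz s hs]
    exact h.evol_f s hs t ht e he φ (hφ.trans hM)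
  evol_z s hs t ht e he φ hφ := by
    rw [hz t ht, hf s (Ioo_subset_Icc_self hs), hz s (Ioo_subset_Icc_self hs)]
    exact h.evol_z s hs t ht e he φ (hφ.trans hM)

theorem Expansion.exists_approxSol {γ : ℝ} (hγ : 3 < γ) {α α' : ℝ → ℝ} (h : Expansion γ α α') :
    ∃ δ > (0 : ℝ), ∃ C ≥ (1 : ℝ), ∃ L ≥ (1 : ℝ), ∀ ε ≤ δ, ∀ p : ℕ → Polynomial ℝ,
      (∀ n, S4 γ (p n) ≤ ε) → ∃ F Z, ApproxSol γ (C * ε) L (fun t => α t ^ (-2 : ℝ))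
        (fun t => α t ^ (3 - γ)) F Z ∧ ∀ n, Z n 0 = p n := by
  obtain ⟨δ, hδ, C, hC, hG⟩ := h.exists_galerkin hγ
  obtain ⟨L, hL, hW⟩ := Galerkin.weakEvol hγ (C * δ)
  refine ⟨δ, hδ, C, hC, L, hL, fun ε hε p hp => ?_⟩
  have hCp : ∀ n, C * S4 γ (p n) ≤ C * ε := fun n => mul_le_mul_of_nonneg_left (hp n) (by linarith)
  have hK : 0 ≤ C * ε := (mul_nonneg (by linarith) (S4_nonneg hγ (p 0))).trans (hCp 0)
  have hpow : ∀ a ≤ (0 : ℝ), ∀ t ∈ Ici (0 : ℝ), 0 < α t ^ a ∧ α t ^ a ≤ 1 := fun a ha t ht =>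
    ⟨Real.rpow_pos_of_pos (by linarith [h.one_le t ht]) _,
      Real.rpow_le_one_of_one_le_of_nonpos (h.one_le t ht) ha⟩
  have ex : ∀ n : ℕ, ∃ f z z', Galerkin γ C (max (n + 4) (p n).natDegree) n
      (fun t => α t ^ (-2 : ℝ)) (fun t => α t ^ (3 - γ)) (p n) f z z' := fun n =>
    hG _ n _ (le_max_of_le_left (by omega)) n.cast_nonneg (le_max_right _ _) ((hp n).trans hε)
  choose f z z' hg using ex
  have mem0 : ∀ n : ℕ, (0 : ℝ) ∈ Icc (0 : ℝ) n := fun n => ⟨le_rfl, n.cast_nonneg⟩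
  refine ⟨fun n t => if t ∈ Icc (0 : ℝ) n then f n t else 0,
    fun n t => if t ∈ Icc (0 : ℝ) n then z n t else 0, ⟨fun n t => ?_, fun n t => ?_, fun n t => ?_,
    fun n t => ?_, fun n => ?_, fun n => ?_⟩, fun n => ?_⟩
  · split_ifs with ht
    · exact (hg n).near t ht
    · intro x _
      rw [dv_zero_pol, abs_zero]
      norm_num
  · split_ifs with ht
    · linarith [(hg n).bound t ht, S4_nonneg hγ (z n t), hCp n]
    · rwa [S4_zero_pol]
  · split_ifs with ht
    · linarith [(hg n).bound t ht, S4_nonneg hγ (f n t), hCp n]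
    · rwa [S4_zero_pol]
  · split_ifs with ht
    · linarith [(hg n).bound_top t ht, hCp n]
    · rwa [J_zero_pol, mul_zero]
  · simp only [if_pos (mem0 n), (hg n).f_zero]
  · refine (hW C _ n _ _ _ _ _ _ n.cast_nonneg (mul_le_mul_of_nonneg_left ((hp n).trans hε)
      (by linarith)) (fun t ht => ?_) (fun t ht => ?_) (hg n)).congr
      (le_max_of_le_left (by omega)) (fun t ht => if_pos ht) fun t ht => if_pos ht
    · have := hpow (-2) (by norm_num) t ht.1
      rw [abs_of_pos this.1]
      exact this.2
    · have h1 := hpow (-2) (by norm_num) t ht.1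
      have h2 := hpow (3 - γ) (by linarith) t ht.1
      rw [abs_of_pos (mul_pos h2.1 h1.1)]
      exact mul_le_one₀ h2.2 h1.1.le h1.2
  · simp only [if_pos (mem0 n), (hg n).z_zero]

theorem ApproxSol.hasDerivWithinAt_lm {γ : ℝ} (hγ : 3 < γ) {K L : ℝ} (hL : 1 ≤ L) {c σ : ℝ → ℝ}
    {F Z : ℕ → ℝ → Polynomial ℝ} (h : ApproxSol γ K L c σ F Z) {U : Ultrafilter ℕ}
    (hU : (U : Filter ℕ) ≤ atTop) (hc : ContinuousOn c (Ici 0)) {s : ℝ} (hs : s ∈ Ici (0 : ℝ))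
    {x : ℝ} (hx : x ∈ Ioo (-1 : ℝ) 1) :
    HasDerivWithinAt (fun t => lm U (fun n => F n t) 0 x) (c s * lm U (fun n => Z n s) 0 x)
      (Ici 0) s := by
  refine hasDerivWithinAt_of_modulus hL (hc s hs) fun t ht e he => ?_
  have he0 : 0 ≤ e := (abs_nonneg _).trans (he s hs (by simp))
  have bF := fun t => bddCont_lm hγ (fun n => h.bound_F n t) U
  rw [← mul_assoc]
  refine (bF t).abs_combination_le hγ (bF s) (bddCont_lm hγ (fun n => h.bound_Z n s) U)
    ((t - s) * c s) (by positivity) (tendsto_ip hγ (fun n => h.bound_F n t) U)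
    (tendsto_ip hγ (fun n => h.bound_F n s) U) (tendsto_ip hγ (fun n => h.bound_Z n s) U)
    (fun φ => ?_) x hx
  filter_upwards [hU (eventually_ge_atTop φ.natDegree),
    hU (tendsto_natCast_atTop_atTop.eventually_ge_atTop s),
    hU (tendsto_natCast_atTop_atTop.eventually_ge_atTop t)] with n hn hns hnt
  have := (h.evol n).evol_f s ⟨hs, hns⟩ t ⟨ht, hnt⟩ e (fun r hr => he r hr.1.le) φ hn
  rw [← mul_assoc] at this
  exact this.trans (le_of_eq (by ring))

theorem ApproxSol.hasDerivAt_lm {γ : ℝ} (hγ : 3 < γ) {K L : ℝ} (hL : 1 ≤ L) {c σ : ℝ → ℝ}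
    {F Z : ℕ → ℝ → Polynomial ℝ} (h : ApproxSol γ K L c σ F Z) {U : Ultrafilter ℕ}
    (hU : (U : Filter ℕ) ≤ atTop) (hc : ContinuousOn (fun t => σ t * c t) (Ici 0)) {s : ℝ}
    (hs : 0 < s) {x : ℝ} (hx : x ∈ Ioo (-1 : ℝ) 1) :
    HasDerivAt (fun t => lm U (fun n => Z n t) 0 x)
      (-(σ s * c s) * limForce γ U (fun n => F n s) x) s := by
  have hs' : s ∈ Ici (0 : ℝ) := hs.le
  refine (hasDerivWithinAt_of_modulus hL (hc s hs') fun t ht e he => ?_).hasDerivAt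
    (Ici_mem_nhds hs)
  have he0 : 0 ≤ e := (abs_nonneg _).trans (he s hs' (by simp))
  have bZ := fun t => bddCont_lm hγ (fun n => h.bound_Z n t) U
  rw [← mul_assoc]
  refine (bZ t).abs_combination_le hγ (bZ s)
    (bddCont_limForce hγ (fun n => h.bound_F n s) (fun n => h.near n s) U)
    ((t - s) * -(σ s * c s)) (by positivity) (tendsto_ip hγ (fun n => h.bound_Z n t) U)
    (tendsto_ip hγ (fun n => h.bound_Z n s) U)
    (tendsto_frc hγ (fun n => h.bound_F n s) (fun n => h.near n s) U) (fun φ => ?_) x hx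
  filter_upwards [hU (eventually_ge_atTop φ.natDegree),
    hU (tendsto_natCast_atTop_atTop.eventually_gt_atTop s),
    hU (tendsto_natCast_atTop_atTop.eventually_ge_atTop t)] with n hn hns hnt
  have := (h.evol n).evol_z s ⟨hs, hns⟩ t ⟨ht, hnt⟩ e (fun r hr => he r hr.1.le) φ hn
  rw [← mul_assoc] at this
  exact this.trans (le_of_eq (by ring))

theorem J_smul (γ a c : ℝ) (p : Polynomial ℝ) (k : ℕ) : J γ a (c • p) k = c ^ 2 * J γ a p k := by
  simp only [J, dv_smul]
  rw [← intervalIntegral.integral_const_mul]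
  congr 1
  ext x
  ring

theorem S4_smul (γ c : ℝ) (p : Polynomial ℝ) : S4 γ (c • p) = c ^ 2 * S4 γ p := by
  simp only [S4, J_smul]
  ring

theorem Eγ_le {γ : ℝ} (hγ : 3 < γ) : ∃ C ≥ (1 : ℝ), ∀ (U : Ultrafilter ℕ) (α : ℝ → ℝ)
    (η v : ℝ → ℝ → ℝ) (t : ℝ) (Q R : ℕ → Polynomial ℝ) (K : ℝ), 0 < α t →
    (∀ y, η y t - y = lm U Q 0 y) → (∀ y, v y t = lm U R 0 y) → (∀ n, S4 γ (Q n) ≤ K) →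
    (∀ n, α t ^ (3 - γ) * J γ (bt γ + 5) (Q n) 5 ≤ K) → (∀ n, α t ^ 4 * S4 γ (R n) ≤ K) →
    Eγ γ α η v t ≤ C * K := by
  obtain ⟨A, hA, hs⟩ := weighted_sum_le hγ
  obtain ⟨B, hB, hw⟩ := w1InfSq_le hγ
  obtain ⟨D, hD, hf⟩ := sobSq_weighted_le hγ
  refine ⟨1 + 10 * A + 2 * B + 6 * D, by linarith, fun U α η v t Q R K hα hη hv hQ hT hR => ?_⟩
  have hα4 : 0 < α t ^ 4 := by positivity
  have hσ : 0 < α t ^ (3 - γ) := Real.rpow_pos_of_pos hα _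
  have hR' : ∀ n, S4 γ (R n) ≤ K / α t ^ 4 := fun n => by
    rw [le_div_iff₀ hα4]
    linarith [hR n]
  have hT' : ∀ n, J γ (bt γ + 5) (Q n) 5 ≤ K / α t ^ (3 - γ) := fun n => by
    rw [le_div_iff₀ hσ]
    linarith [hT n]
  have scale : ∀ {X E : ℝ}, X ≤ E * (K / α t ^ 4) → α t ^ 4 * X ≤ E * K := fun {X E} h => by
    refine (mul_le_mul_of_nonneg_left h hα4.le).trans (le_of_eq ?_)
    field_simp
  have e1 : eγ γ α η v t ≤ K + 5 * (2 * A * K) := by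
    unfold eγ
    simp only [hη, hv]
    refine add_le_add ?_ ((Finset.sum_le_card_nsmul _ _ (2 * A * K) fun b hb => ?_).trans
      (le_of_eq (by simp)))
    · refine (mul_le_mul_of_nonneg_left (weighted_top_le hγ U Q hQ hT') hσ.le).trans (le_of_eq ?_)
      field_simp
    · have hb' := Finset.mem_range.1 hb
      linarith [scale (hs U R _ hR' b hb'), hs U Q K hQ b hb']
  have e2 : ∑ b ∈ Finset.range 3,
      (α t ^ 4 * SobSq ((4 * γ - 5) / (2 * γ - 2) + b) (fun y => ddg γ y ^ b * v y t) +
        SobSq ((4 * γ - 5) / (2 * γ - 2) + b) (fun y => ddg γ y ^ b * (η y t - y))) ≤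
      3 * (2 * D * K) := by
    simp only [hη, hv]
    refine (Finset.sum_le_card_nsmul _ _ (2 * D * K) fun b hb => ?_).trans (le_of_eq (by simp))
    have hb' : b ≤ 2 := Nat.lt_succ_iff.1 (Finset.mem_range.1 hb)
    linarith [scale (hf U R _ hR' b hb'), hf U Q K hQ b hb']
  have e3 : W1InfSq (fun y => η y t - y) ≤ B * K := by
    simp only [hη]
    exact hw U Q K hQ
  have e4 : α t ^ 4 * W1InfSq (fun y => v y t) ≤ B * K := by
    simp only [hv]
    exact scale (hw U R _ hR')
  unfold Eγ
  linarith

theorem LimBd.contDiffOn_lm {γ : ℝ} (hγ : 3 < γ) {m : ℕ} {Q : ℕ → Polynomial ℝ}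
    (h : LimBd γ m Q) (U : Ultrafilter ℕ) (k : ℕ) {j : ℕ} (hj : j + k ≤ m) :
    ContDiffOn ℝ k (lm U Q j) (Ioo (-1) 1) := by
  induction k generalizing j with
  | zero => exact contDiffOn_zero.2 (h.continuousOn_lm hγ U hj)
  | succ k ih =>
    have hd : ∀ x ∈ Ioo (-1 : ℝ) 1, HasDerivAt (lm U Q j) (lm U Q (j + 1) x) x := fun x hx =>
      h.hasDerivAt_lm hγ U (by omega) hx
    rw [Nat.cast_succ, contDiffOn_succ_iff_deriv_of_isOpen isOpen_Ioo]
    refine ⟨fun x hx => (hd x hx).differentiableAt.differentiableWithinAt, by simp, ?_⟩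
    exact (ih (by omega)).congr fun x hx => (hd x hx).deriv

/-- The limit of a sequence of approximate solutions solves the perturbation system. -/
theorem ApproxSol.isSolγ {γ : ℝ} (hγ : 3 < γ) {α α' : ℝ → ℝ} (hα : Expansion γ α α') {K L : ℝ}
    (hL : 1 ≤ L) {F Z : ℕ → ℝ → Polynomial ℝ}
    (h : ApproxSol γ K L (fun t => α t ^ (-2 : ℝ)) (fun t => α t ^ (3 - γ)) F Z)
    {U : Ultrafilter ℕ} (hU : (U : Filter ℕ) ≤ atTop) {v : ℝ → ℝ → ℝ}
    (hv : ∀ x ∈ Ω₀, ∀ t ∈ Ici (0 : ℝ), v x t = α t ^ (-2 : ℝ) * lm U (fun n => Z n t) 0 x) :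
    IsSolγ γ α α' (fun x t => x + lm U (fun n => F n t) 0 x) v := by
  have hl := fun t => limBd_three hγ fun n => h.bound_F n t
  have hd : ∀ t, ∀ x ∈ Ω₀, HasDerivAt (fun y => y + lm U (fun n => F n t) 0 y)
      (1 + lm U (fun n => F n t) 1 x) x := fun t x hx =>
    (hasDerivAt_id x).add ((hl t).hasDerivAt_lm hγ U (by norm_num) hx)
  have hd2 : ∀ t, ∀ x ∈ Ω₀, iteratedDeriv 2 (fun y => y + lm U (fun n => F n t) 0 y) x =
      lm U (fun n => F n t) 2 x := fun t x hx => by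
    rw [iteratedDeriv_succ, iteratedDeriv_one]
    have he : deriv (fun y => y + lm U (fun n => F n t) 0 y) =ᶠ[nhds x]
        fun y => 1 + lm U (fun n => F n t) 1 y := by
      filter_upwards [isOpen_Ioo.mem_nhds hx] with y hy using (hd t y hy).deriv
    rw [he.deriv_eq]
    exact (((hl t).hasDerivAt_lm hγ U (by norm_num) hx).const_add 1).deriv
  have hq : ∀ t, ∀ x ∈ Ω₀, 0 < 1 + lm U (fun n => F n t) 1 x := fun t x hx => by
    linarith [half_le_lm hγ (fun n => h.bound_F n t) (fun n => h.near n t) U hx]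
  have hvt : ∀ x ∈ Ω₀, ∀ t > (0 : ℝ), HasDerivAt (fun s => v x s)
      (α' t * (-2) * α t ^ ((-2 : ℝ) - 1) * lm U (fun n => Z n t) 0 x + α t ^ (-2 : ℝ) *
        (-(α t ^ (3 - γ) * α t ^ (-2 : ℝ)) * limForce γ U (fun n => F n t) x)) t :=
    fun x hx t ht => by
      refine ((hα.hasDerivAt_rpow (-2) ht).mul (h.hasDerivAt_lm hγ hL hU
        ((hα.continuousOn _).mul (hα.continuousOn _)) ht hx)).congr_of_eventuallyEq ?_
      filter_upwards [Ici_mem_nhds ht] with s hs using hv x hx s hs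
  refine ⟨fun t ht => ?_, fun x hx t ht => ?_, fun x hx t ht => ?_, fun x hx t ht => ?_,
    fun x hx t ht => ?_⟩
  · exact contDiffOn_id.add ((hl t).contDiffOn_lm hγ U 2 (by norm_num))
  · rw [(hd t x hx).deriv]
    exact hq t x hx
  · rw [hv x hx t ht]
    exact (h.hasDerivWithinAt_lm hγ hL hU (hα.continuousOn _) ht hx).const_add x
  · exact (hvt x hx t ht).differentiableAt
  · rw [(hvt x hx t ht).deriv, (hd t x hx).deriv, hd2 t x hx, (hasDerivAt_ddg γ x).deriv,
      hv x hx t ht.le]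
    have hα0 : 0 < α t := by linarith [hα.one_le t ht.le]
    have p1 : α t ^ (γ + 1) * α t ^ ((-2 : ℝ) - 1) = α t ^ γ * α t ^ (-2 : ℝ) := by
      rw [← Real.rpow_add hα0, ← Real.rpow_add hα0]
      congr 1
      ring
    have p2 : α t ^ (γ + 1) * (α t ^ (-2 : ℝ) * (α t ^ (3 - γ) * α t ^ (-2 : ℝ))) = 1 := by
      rw [← Real.rpow_add hα0, ← Real.rpow_add hα0, ← Real.rpow_add hα0]
      convert Real.rpow_zero (α t) using 2
      ring
    have hk : γ / (γ - 1) * (-2 * mu γ * x) = -x := by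
      have h1 : γ - 1 ≠ 0 := by linarith
      have h2 : γ ≠ 0 := by linarith
      unfold mu
      field_simp
    rw [hk]
    set z := lm U (fun n => Z n t) 0 x
    unfold limForce
    set f := lm U (fun n => F n t) 0 x
    set q := 1 + lm U (fun n => F n t) 1 x
    set g := lm U (fun n => F n t) 2 x
    linear_combination (-2 * α' t * z) * p1 -
      (f + ddg γ x * (-γ * q ^ (-γ - 1) * g) - x * (q ^ (-γ) - 1)) * p2

/-- Global existence for the 1-d compressible Euler equations with `γ > 3`: small data `u₀`
yield a global solution of the perturbation system with `E_γ(t) ≤ Cε` for all `t ≥ 0`. -/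
theorem stmt18 (γ : ℝ) (hγ : 3 < γ) (α α' : ℝ → ℝ)
    (hαpos : ∀ t ∈ Ici (0 : ℝ), 0 < α t)
    (hα : ∀ t ∈ Ici (0 : ℝ), HasDerivWithinAt α (α' t) (Ici 0) t)
    (hα' : ∀ t ∈ Ici (0 : ℝ), HasDerivWithinAt α' (α t ^ (-γ)) (Ici 0) t)
    (hα0 : α 0 = 1) (hα'0 : 0 ≤ α' 0) :
    ∃ ε₀ > (0 : ℝ), ∃ C ≥ (1 : ℝ),
      ∀ ε : ℝ, 0 < ε → ε ≤ ε₀ →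
      ∀ u₀ : ℝ → ℝ, (∀ n : ℕ, ContDiffOn ℝ n u₀ (Icc (-1) 1)) →
      (∑ b ∈ Finset.range 5,
          ∫ x in Ω₀, ddg γ x ^ ((1 + (b : ℝ) * (γ - 1)) / (γ - 1)) *
            (iteratedDeriv b u₀ x) ^ 2) < ε →
      ∃ η v : ℝ → ℝ → ℝ,
        IsSolγ γ α α' η v ∧
        (∀ x ∈ Ω₀, η x 0 = x ∧ v x 0 = u₀ x) ∧
        (∀ t ∈ Ici (0 : ℝ), Eγ γ α η v t ≤ C * ε) := by
  have hex := expansion_of_ode hαpos hα hα' hα0 hα'0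
  obtain ⟨δ, hδ, C, hC, L, hL, hA⟩ := hex.exists_approxSol hγ
  obtain ⟨D, hD, hE⟩ := Eγ_le hγ
  refine ⟨δ, hδ, D * C, by nlinarith, fun ε hε hεδ u₀ hu₀ hsum => ?_⟩
  obtain ⟨p, hp, hlim⟩ := exists_initial_approx hγ hu₀ hsum
  obtain ⟨F, Z, h, hZ0⟩ := hA ε hεδ p hp
  set U := hyperfilter ℕ
  have hU : (U : Filter ℕ) ≤ atTop := Nat.hyperfilter_le_atTop
  have hv : ∀ x ∈ Ω₀, ∀ t : ℝ, lm U (fun n => α t ^ (-2 : ℝ) • Z n t) 0 x =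
      α t ^ (-2 : ℝ) * lm U (fun n => Z n t) 0 x := fun x hx t => by
    refine Tendsto.limUnder_eq ?_
    simp only [dv_smul]
    exact ((limBd_three hγ fun n => h.bound_Z n t).tendsto U (by norm_num) hx).const_mul _
  refine ⟨fun x t => x + lm U (fun n => F n t) 0 x,
    fun x t => lm U (fun n => α t ^ (-2 : ℝ) • Z n t) 0 x,
    h.isSolγ hγ hex hL hU fun x hx t _ => hv x hx t, fun x hx => ⟨?_, ?_⟩, fun t ht => ?_⟩
  · have h0 : lm U (fun n => F n 0) 0 x = 0 := by
      refine Tendsto.limUnder_eq ?_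
      simp only [h.zero_F, dv_zero_pol]
      exact tendsto_const_nhds
    simp only [h0, add_zero]
  · refine Tendsto.limUnder_eq ?_
    simp only [hα0, Real.one_rpow, one_smul, hZ0]
    exact (hlim x (Ioo_subset_Icc_self hx)).mono_left hU
  · have ht0 := hαpos t ht
    rw [mul_assoc]
    refine hE U α _ _ t (fun n => F n t) (fun n => α t ^ (-2 : ℝ) • Z n t) (C * ε) ht0
      (fun y => add_sub_cancel_left _ _) (fun y => rfl) (fun n => h.bound_F n t)
      (fun n => h.bound_top n t) fun n => ?_
    have hα4 : α t ^ 4 * (α t ^ (-2 : ℝ)) ^ 2 = 1 := by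
      rw [Real.rpow_neg ht0.le, Real.rpow_two]
      field_simp
    rw [S4_smul, ← mul_assoc, hα4, one_mul]
    exact h.bound_Z n t
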